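/- arXiv:1508.02095 — 10 statements merged into one kernel-verified Lean document; each statement's English description precedes it below -/
import Mathlib

section
/- Let p be an odd prime, let K be an algebraically closed field of characteristic p, and let G be a finite subgroup of GL₂(K). Assume that (a) some element of G has trace 0, and (b) if there exists a one-dimensional subspace of K² mapped to itself by every element of G, then there exists a single P ∈ GL₂(K) such that P g P⁻¹ is a diagonal matrix for every g ∈ G. Let N be the number of elements g ∈ G with trace(g) = 0. Then 0 < N and 4·N ≤ 3·|G|; that is, the proportion α of trace-zero elements of G satisfies 0 < α ≤ 3/4. -/
/-- Two traceless `2 × 2` matrices whose product is traceless anticommute. -/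
lemma Matrix.mul_eq_neg_mul_of_trace_eq_zero {R : Type*} [CommRing R]
    {M N : Matrix (Fin 2) (Fin 2) R} (hM : M.trace = 0) (hN : N.trace = 0)
    (hMN : (M * N).trace = 0) : M * N = -(N * M) := by
  simp only [Matrix.trace_fin_two, Matrix.mul_apply, Fin.sum_univ_two] at hM hN hMN
  ext i j
  fin_cases i <;> fin_cases j <;>
    simp only [Matrix.neg_apply, Matrix.mul_apply, Fin.sum_univ_two, Fin.zero_eta, Fin.mk_one]
  · linear_combination hMN + N 0 0 * hM - M 1 1 * hN
  · linear_combination N 0 1 * hM + M 0 1 * hN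
  · linear_combination N 1 0 * hM + M 1 0 * hN
  · linear_combination hMN - N 0 0 * hM + M 1 1 * hN

/-- In a finite group, at most half of the elements lie in a set `A` that is disjoint from the
set of products of pairs of its elements. -/
lemma Finset.two_mul_card_le_of_mul_notMem {G : Type*} [Group G] [Fintype G] (A : Finset G)
    (hA : ∀ x ∈ A, ∀ y ∈ A, x * y ∉ A) : 2 * A.card ≤ Fintype.card G := by
  classical
  obtain rfl | ⟨x, hx⟩ := A.eq_empty_or_nonempty
  · simp
  have hdisj : Disjoint A (A.map (mulLeftEmbedding x)) := by
    refine Finset.disjoint_right.mpr fun z hz => ?_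
    obtain ⟨y, hy, rfl⟩ := Finset.mem_map.mp hz
    exact hA x hx y hy
  have hle := Finset.card_le_univ (A ∪ A.map (mulLeftEmbedding x))
  rw [Finset.card_union_of_disjoint hdisj, Finset.card_map] at hle
  lia

/-- If `h ∈ S` and `S ∩ h⁻¹ S` contains no product of two of its elements, then `S` makes up at
most three quarters of the finite group. -/
lemma Finset.four_mul_card_le_of_mul_notMem {G : Type*} [Group G] [Fintype G] (S : Finset G)
    (h : G) (hS : ∀ x y, x ∈ S → h * x ∈ S → y ∈ S → h * y ∈ S → x * y ∈ S → h * (x * y) ∉ S) :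
    4 * S.card ≤ 3 * Fintype.card G := by
  classical
  set T := S.map (mulLeftEmbedding h⁻¹)
  have hT : ∀ x, x ∈ T ↔ h * x ∈ S := fun x => by
    simp [T, inv_mul_eq_iff_eq_mul]
  have hinter : 2 * (S ∩ T).card ≤ Fintype.card G := by
    refine Finset.two_mul_card_le_of_mul_notMem _ fun x hx y hy hxy => ?_
    simp only [Finset.mem_inter, hT] at hx hy hxy
    exact hS x y hx.1 hx.2 hy.1 hy.2 hxy.1 hxy.2
  have hunion := Finset.card_union_add_card_inter S T
  have hle := Finset.card_le_univ (S ∪ T)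
  rw [Finset.card_map] at hunion
  lia


/-- Let `p` be an odd prime, `K` an algebraically closed field of characteristic `p`, and `G` a
finite subgroup of `GL₂ K`. Assume (a) some element of `G` has trace `0`, and (b) if there is a
one-dimensional subspace of `K²` stable under every element of `G`, then all elements of `G`
are simultaneously diagonalizable (i.e. the tautological representation is semisimple).
Then the number `N` of trace-zero elements of `G` satisfies `0 < N` and `4 N ≤ 3 |G|`. -/
theorem trace_zero_proportion_le_three_quarters
    (p : ℕ) (hp : p.Prime) (hp2 : p ≠ 2)
    (K : Type*) [Field K] [IsAlgClosed K] [CharP K p]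
    (G : Subgroup (Matrix.GeneralLinearGroup (Fin 2) K)) [Finite G]
    (ha : ∃ g ∈ G, Matrix.trace ((g : Matrix.GeneralLinearGroup (Fin 2) K) :
      Matrix (Fin 2) (Fin 2) K) = 0)
    (hb : (∃ W : Submodule K (Fin 2 → K), Module.finrank K W = 1 ∧
            ∀ g ∈ G, ∀ v ∈ W,
              Matrix.mulVec ((g : Matrix.GeneralLinearGroup (Fin 2) K) :
                Matrix (Fin 2) (Fin 2) K) v ∈ W) →
          ∃ P : Matrix.GeneralLinearGroup (Fin 2) K, ∀ g ∈ G,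
            Matrix.IsDiag ((P * g * P⁻¹ : Matrix.GeneralLinearGroup (Fin 2) K) :
              Matrix (Fin 2) (Fin 2) K)) :
    0 < Nat.card {g : G // Matrix.trace
        (((g : G) : Matrix.GeneralLinearGroup (Fin 2) K) : Matrix (Fin 2) (Fin 2) K) = 0} ∧
    4 * Nat.card {g : G // Matrix.trace
        (((g : G) : Matrix.GeneralLinearGroup (Fin 2) K) : Matrix (Fin 2) (Fin 2) K) = 0} ≤
      3 * Nat.card G := by
  classical
  have := Fintype.ofFinite G
  obtain ⟨h, hG, hh⟩ := ha
  refine ⟨Nat.card_pos_iff.mpr ⟨⟨⟨⟨h, hG⟩, hh⟩⟩, inferInstance⟩, ?_⟩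
  rw [Nat.card_eq_fintype_card, Nat.card_eq_fintype_card, Fintype.card_subtype]
  refine Finset.four_mul_card_le_of_mul_notMem _ ⟨h, hG⟩ ?_
  intro x y
  simp only [Finset.mem_filter, Finset.mem_univ, true_and, Subgroup.coe_mul, Units.val_mul]
  intro hx hhx hy hhy hxy hhxy
  have ex := Matrix.mul_eq_neg_mul_of_trace_eq_zero hh hx hhx
  have ey := Matrix.mul_eq_neg_mul_of_trace_eq_zero hh hy hhy
  have exy := Matrix.mul_eq_neg_mul_of_trace_eq_zero hh hxy hhxy
  rw [← mul_assoc, ex, neg_mul, mul_assoc, ey, mul_neg, neg_neg, ← mul_assoc] at exy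
  have h2 : (2 : K) ≠ 0 := Ring.two_ne_zero ((ringChar.eq K p).symm ▸ hp2)
  rw [eq_neg_iff_add_eq_zero, ← two_smul K, smul_eq_zero_iff_right h2] at exy
  exact ((x : Matrix.GeneralLinearGroup (Fin 2) K) * y * h).ne_zero exy
end

section
/- Let p be an odd prime, let K be an algebraically closed field of characteristic p, and let G be a finite subgroup of GL₂(K) such that no one-dimensional subspace of K² is mapped to itself by every element of G (i.e., the tautological representation of G is irreducible). Then the number N of elements g ∈ G with trace(g) = 0 satisfies 4·N ≤ 3·|G|. -/
/-- Traceless `2 × 2` matrices whose product is traceless anticommute. -/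
theorem Matrix.mul_eq_neg_mul_of_trace_eq_zero_s2 {R : Type*} [CommRing R]
    {A B : Matrix (Fin 2) (Fin 2) R} (hA : A.trace = 0) (hB : B.trace = 0)
    (hAB : (A * B).trace = 0) : A * B = -(B * A) := by
  rw [Matrix.trace_fin_two] at hA hB hAB
  simp only [Matrix.mul_apply, Fin.sum_univ_two] at hAB
  ext i j
  fin_cases i <;> fin_cases j <;>
    simp only [Fin.zero_eta, Fin.mk_one, Matrix.neg_apply, Matrix.mul_apply,
      Fin.sum_univ_two] <;> grind

/-- If `C` and `D` anticommute with the matrix `A`, then `C * D` commutes with `A`; so it cannot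
also anticommute with `A` if all three matrices are invertible and `2 ≠ 0`. -/
theorem Matrix.trace_mul_ne_zero_of_trace_eq_zero {K : Type*} [Field K] (h2 : (2 : K) ≠ 0)
    {A C D : Matrix (Fin 2) (Fin 2) K} (hdet : (A * (C * D)).det ≠ 0)
    (hA : A.trace = 0) (hC : C.trace = 0) (hD : D.trace = 0) (hAC : (A * C).trace = 0)
    (hAD : (A * D).trace = 0) (hCD : (C * D).trace = 0) : (A * (C * D)).trace ≠ 0 := by
  intro h
  have h₁ := Matrix.mul_eq_neg_mul_of_trace_eq_zero_s2 hA hC hAC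
  have h₂ := Matrix.mul_eq_neg_mul_of_trace_eq_zero_s2 hA hD hAD
  have h₃ := Matrix.mul_eq_neg_mul_of_trace_eq_zero_s2 hA hCD h
  have h₄ : A * (C * D) = C * D * A := by
    rw [← mul_assoc, h₁, neg_mul, mul_assoc, h₂, mul_neg, neg_neg, mul_assoc]
  have h₅ : (2 : K) • (A * (C * D)) = 0 := by
    rw [two_smul]
    nth_rewrite 1 [h₃]
    rw [h₄, neg_add_cancel]
  have h₆ : A * (C * D) = 0 := (smul_eq_zero.mp h₅).resolve_left h2
  exact hdet (by rw [h₆, Matrix.det_zero])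

/-- If a subset `S` of a finite group has an element `g` such that `S ∩ g⁻¹ S` contains no product
of two of its elements, then `S` fills at most three quarters of the group. -/
theorem Finset.four_mul_card_le_three_mul_card_of_product_free {G : Type*} [Group G] [Fintype G]
    [DecidableEq G] (S : Finset G) (g : G)
    (h : ∀ x ∈ S, ∀ y ∈ S, g * x ∈ S → g * y ∈ S → x * y ∈ S → g * (x * y) ∉ S) :
    4 * S.card ≤ 3 * Fintype.card G := by
  set T := S.image (g⁻¹ * ·) with hT
  have hTmem : ∀ x, x ∈ T ↔ g * x ∈ S := by
    intro x
    simp only [hT, Finset.mem_image]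
    exact ⟨by rintro ⟨y, hy, rfl⟩; simpa using hy, fun hx => ⟨g * x, hx, by simp⟩⟩
  have hTcard : T.card = S.card := Finset.card_image_of_injective _ (mul_right_injective _)
  have hunion := Finset.card_union_add_card_inter S T
  have hle := Finset.card_le_univ (S ∪ T)
  rcases (S ∩ T).eq_empty_or_nonempty with hempty | ⟨x, hx⟩
  · rw [hempty, Finset.card_empty] at hunion
    omega
  · have hdisj : Disjoint (S ∩ T) ((S ∩ T).image (x * ·)) := by
      rw [Finset.disjoint_right]
      intro z hz hz'
      obtain ⟨y, hy, rfl⟩ := Finset.mem_image.mp hz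
      simp only [Finset.mem_inter, hTmem] at hx hy hz'
      exact h x hx.1 y hy.1 hx.2 hy.2 hz'.1 hz'.2
    have hcard := Finset.card_le_univ ((S ∩ T) ∪ (S ∩ T).image (x * ·))
    rw [Finset.card_union_of_disjoint hdisj,
      Finset.card_image_of_injective _ (mul_right_injective x)] at hcard
    omega


/-- Let `p` be an odd prime, `K` an algebraically closed field of characteristic `p`, and `G` a
finite subgroup of `GL₂ K` such that no one-dimensional subspace of `K²` is mapped to itself by
every element of `G` (the tautological two-dimensional representation of `G` is irreducible).
Then the number `N` of elements of `G` with trace `0` satisfies `4 N ≤ 3 |G|`. -/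
theorem trace_zero_proportion_le_three_quarters_of_irreducible
    (p : ℕ) (hp : p.Prime) (hp2 : p ≠ 2)
    (K : Type*) [Field K] [IsAlgClosed K] [CharP K p]
    (G : Subgroup (Matrix.GeneralLinearGroup (Fin 2) K)) [Finite G]
    (hirr : ∀ W : Submodule K (Fin 2 → K), Module.finrank K W = 1 →
      ¬ (∀ g ∈ G, ∀ v ∈ W,
          Matrix.mulVec ((g : Matrix.GeneralLinearGroup (Fin 2) K) :
            Matrix (Fin 2) (Fin 2) K) v ∈ W)) :
    4 * Nat.card {g : G // Matrix.trace
        ((g : Matrix.GeneralLinearGroup (Fin 2) K) : Matrix (Fin 2) (Fin 2) K) = 0} ≤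
      3 * Nat.card G := by
  classical
  have h2 : (2 : K) ≠ 0 := by
    intro h
    have hdvd : p ∣ 2 := (CharP.cast_eq_zero_iff K p 2).mp (by exact_mod_cast h)
    exact hp2 ((Nat.prime_dvd_prime_iff_eq hp Nat.prime_two).mp hdvd)
  have : Fintype G := Fintype.ofFinite G
  rw [Nat.card_eq_fintype_card, Nat.card_eq_fintype_card, Fintype.card_subtype]
  set S := Finset.univ.filter fun g : G => Matrix.trace
    ((g : Matrix.GeneralLinearGroup (Fin 2) K) : Matrix (Fin 2) (Fin 2) K) = 0 with hS
  rcases S.eq_empty_or_nonempty with hempty | ⟨g, hg⟩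
  · simp [hempty]
  · refine S.four_mul_card_le_three_mul_card_of_product_free g ?_
    intro x hx y hy hgx hgy hxy
    simp only [hS, Finset.mem_filter, Finset.mem_univ, true_and, Subgroup.coe_mul,
      Units.val_mul] at hg hx hy hgx hgy hxy ⊢
    refine Matrix.trace_mul_ne_zero_of_trace_eq_zero h2 ?_ hg hx hy hgx hgy hxy
    simp only [← Units.val_mul]
    exact Matrix.GeneralLinearGroup.det_ne_zero _
end

section
/- Let K be a field of characteristic different from 2 and let G be a finite subgroup of GL₂(K) all of whose elements are diagonal matrices. Then the number N of elements g ∈ G with trace(g) = 0 satisfies 2·N ≤ |G|. -/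
/-- In a finite group, a product-free subset contains at most half of the elements. -/
theorem two_mul_card_subtype_le_of_product_free {G : Type*} [Group G] [Finite G] (p : G → Prop)
    (hp : ∀ g h, p g → p h → ¬ p (g * h)) : 2 * Nat.card {g // p g} ≤ Nat.card G := by
  classical
  rcases isEmpty_or_nonempty {g // p g} with _ | ⟨⟨t, ht⟩⟩
  · simp
  have hle : Nat.card {g // p g} ≤ Nat.card {g // ¬ p g} :=
    Nat.card_le_card_of_injective (fun g ↦ ⟨t * g.1, hp t g.1 ht g.2⟩) fun a b hab ↦
      Subtype.ext (mul_left_cancel (Subtype.mk.inj hab))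
  have hsum := Nat.card_congr (Equiv.sumCompl p)
  rw [Nat.card_sum] at hsum
  lia

/-- In characteristic different from `2`, the product of two invertible diagonal `2 × 2` matrices
of trace `0` has nonzero trace. -/
theorem Matrix.IsDiag.trace_mul_ne_zero_of_trace_eq_zero {K : Type*} [Field K]
    (hchar : ringChar K ≠ 2) {g h : Matrix.GeneralLinearGroup (Fin 2) K}
    (hgd : (g : Matrix (Fin 2) (Fin 2) K).IsDiag) (hhd : (h : Matrix (Fin 2) (Fin 2) K).IsDiag)
    (hg : (g : Matrix (Fin 2) (Fin 2) K).trace = 0)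
    (hh : (h : Matrix (Fin 2) (Fin 2) K).trace = 0) :
    ((g * h : Matrix.GeneralLinearGroup (Fin 2) K) : Matrix (Fin 2) (Fin 2) K).trace ≠ 0 := by
  have h2 : (2 : K) ≠ 0 := Ring.two_ne_zero hchar
  have hg01 : g.1 0 1 = 0 := hgd (by decide)
  have hg10 : g.1 1 0 = 0 := hgd (by decide)
  have hh01 : h.1 0 1 = 0 := hhd (by decide)
  have hgdet : g.1.det ≠ 0 := g.det_ne_zero
  have hhdet : h.1.det ≠ 0 := h.det_ne_zero
  rw [Matrix.det_fin_two] at hgdet hhdet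
  rw [Matrix.trace_fin_two] at hg hh
  rw [Units.val_mul, Matrix.trace_fin_two, Matrix.mul_apply, Matrix.mul_apply, Fin.sum_univ_two,
    Fin.sum_univ_two]
  grind

/-- Let `K` be a field of characteristic different from `2` and `G` a finite subgroup of
`GL₂ K` all of whose elements are diagonal matrices. Then the number `N` of elements of `G`
with trace `0` satisfies `2 N ≤ |G|`. -/
theorem trace_zero_proportion_le_half_of_diagonal
    (K : Type*) [Field K] (hchar : ringChar K ≠ 2)
    (G : Subgroup (Matrix.GeneralLinearGroup (Fin 2) K)) [Finite G]
    (hdiag : ∀ g ∈ G, Matrix.IsDiag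
      ((g : Matrix.GeneralLinearGroup (Fin 2) K) : Matrix (Fin 2) (Fin 2) K)) :
    2 * Nat.card {g : G // Matrix.trace
        ((g : Matrix.GeneralLinearGroup (Fin 2) K) : Matrix (Fin 2) (Fin 2) K) = 0} ≤
      Nat.card G :=
  two_mul_card_subtype_le_of_product_free _ fun g h hg hh ↦
    (hdiag g g.2).trace_mul_ne_zero_of_trace_eq_zero hchar (hdiag h h.2) hg hh
end

section
/- Let F be a finite field of odd cardinality q. Then the number of elements g ∈ SL₂(F) with trace(g) = 0 equals q² − q if −1 is not a square in F, and equals q² + q if −1 is a square in F. -/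
/-- Trace-zero matrices of determinant one, parametrized by the entries `a, b, c` of
`!![a, b; c, -a]`. -/
def Matrix.SpecialLinearGroup.traceZeroEquiv (F : Type*) [Field F] :
    {g : Matrix.SpecialLinearGroup (Fin 2) F //
      Matrix.trace ((g : Matrix (Fin 2) (Fin 2) F)) = 0} ≃
    Σ a : F, Σ b : F, {c : F // b * c = -(a ^ 2 + 1)} where
  toFun g := ⟨g.1 0 0, g.1 0 1, g.1 1 0, by
    have ht := g.2
    have hd := g.1.2
    rw [Matrix.trace_fin_two] at ht
    rw [Matrix.det_fin_two] at hd
    linear_combination g.1 0 0 * ht - hd⟩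
  invFun x := ⟨⟨!![x.1, x.2.1; x.2.2.1, -x.1], by
    rw [Matrix.det_fin_two_of]
    linear_combination -x.2.2.2⟩, by simp [Matrix.trace_fin_two]⟩
  left_inv g := by
    have ht := g.2
    rw [Matrix.trace_fin_two] at ht
    ext i j
    fin_cases i <;> fin_cases j <;> simp
    linear_combination -ht
  right_inv x := rfl

open scoped Classical in
theorem Nat.card_mul_left_eq (F : Type*) [Field F] [Fintype F] (b d : F) :
    Nat.card {c : F // b * c = d} =
      if b = 0 then (if d = 0 then Fintype.card F else 0) else 1 := by
  split_ifs with hb hd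
  · subst hb hd
    simp
  · subst hb
    simp [Ne.symm hd]
  · have : ∀ c : F, b * c = d ↔ c = b⁻¹ * d := fun c ↦ (eq_inv_mul_iff_mul_eq₀ hb).symm
    simp [this]

open scoped Classical in
theorem Matrix.SpecialLinearGroup.card_trace_zero (F : Type*) [Field F] [Fintype F] :
    Nat.card {g : Matrix.SpecialLinearGroup (Fin 2) F //
      Matrix.trace ((g : Matrix (Fin 2) (Fin 2) F)) = 0} =
    Fintype.card F * (Fintype.card F - 1) +
      (Finset.univ.filter fun a : F ↦ a ^ 2 = -1).card * Fintype.card F := by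
  have hinner (a : F) : Nat.card (Σ b : F, {c : F // b * c = -(a ^ 2 + 1)}) =
      (Fintype.card F - 1) + if a ^ 2 = -1 then Fintype.card F else 0 := by
    simp only [Nat.card_sigma, Nat.card_mul_left_eq, neg_eq_zero, add_eq_zero_iff_eq_neg]
    rw [← Finset.add_sum_erase _ _ (Finset.mem_univ (0 : F)), if_pos rfl, add_comm,
      Finset.sum_congr rfl fun b hb ↦ if_neg (Finset.ne_of_mem_erase hb)]
    simp [Finset.card_erase_of_mem]
  rw [Nat.card_congr (traceZeroEquiv F), Nat.card_sigma]
  simp only [hinner, Finset.sum_add_distrib, ← Finset.sum_filter]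
  simp

/-- Let `F` be a finite field of odd cardinality `q`. The number of elements of `SL₂ F` with
trace `0` equals `q² − q` if `−1` is not a square in `F`, and `q² + q` if `−1` is a square. -/
theorem card_trace_zero_SL_two_finite_field
    (F : Type*) [Field F] [Fintype F] (hodd : Odd (Fintype.card F)) :
    (¬ (∃ x : F, x ^ 2 = -1) →
      Nat.card {g : Matrix.SpecialLinearGroup (Fin 2) F //
          Matrix.trace ((g : Matrix (Fin 2) (Fin 2) F)) = 0} =
        Fintype.card F ^ 2 - Fintype.card F) ∧
    ((∃ x : F, x ^ 2 = -1) →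
      Nat.card {g : Matrix.SpecialLinearGroup (Fin 2) F //
          Matrix.trace ((g : Matrix (Fin 2) (Fin 2) F)) = 0} =
        Fintype.card F ^ 2 + Fintype.card F) := by
  classical
  rw [Matrix.SpecialLinearGroup.card_trace_zero]
  refine ⟨fun h ↦ ?_, fun ⟨x, hx⟩ ↦ ?_⟩
  · push Not at h
    rw [Finset.filter_false_of_mem fun a _ ↦ h a]
    simp [Nat.mul_sub, sq]
  · have h2 : ringChar F ≠ 2 := fun h ↦
      (Nat.not_even_iff_odd.mpr hodd) (Nat.even_iff.mpr (FiniteField.even_card_of_char_two h))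
    have hx0 : x ≠ 0 := by
      rintro rfl
      simp at hx
    have hroots : (Finset.univ.filter fun a : F ↦ a ^ 2 = -1) = {x, -x} := by
      ext a
      simp [← hx, sq_eq_sq_iff_eq_or_eq_neg]
    rw [hroots, Finset.card_pair fun h ↦
      hx0 ((Ring.eq_self_iff_eq_zero_of_char_ne_two h2).mp h.symm)]
    obtain ⟨n, hn⟩ := Nat.exists_eq_add_of_lt (Fintype.card_pos (α := F))
    rw [hn]
    simp only [Nat.add_sub_cancel]
    ring
end

section
/- Let p be a prime, let A be a commutative ring of characteristic p, let G be a group, and let (t, d) be a two-dimensional pseudo-representation of G over A; that is, t, d : G → A are maps such that d is multiplicative (d(gh) = d(g)d(h) and d(1) = 1), t is central (t(gh) = t(hg) for all g, h ∈ G), t(1) = 2, and t(gh) + t(gh⁻¹)·d(h) = t(g)·t(h) for all g, h ∈ G. Then t(g^p) = t(g)^p for every g ∈ G. -/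
open Polynomial in
/-- Every monic quadratic polynomial `X ^ 2 - s X + e` splits over some extension ring. -/
theorem exists_injective_add_eq_mul_eq {A : Type*} [CommRing A] [Nontrivial A] (s e : A) :
    ∃ (f : A[X]) (x y : AdjoinRoot f), Function.Injective (AdjoinRoot.of f) ∧
      x + y = AdjoinRoot.of f s ∧ x * y = AdjoinRoot.of f e := by
  let f : A[X] := X ^ 2 - C s * X + C e
  have hdeg : f.degree = 2 := by simp only [f]; compute_degree!
  have hmonic : f.Monic := by simp only [f]; monicity!
  refine ⟨f, AdjoinRoot.root f, AdjoinRoot.of f s - AdjoinRoot.root f, ?_, by ring, ?_⟩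
  · refine (injective_iff_map_eq_zero _).2 fun a ha => ?_
    by_contra h
    refine hmonic.not_dvd_of_degree_lt (C_ne_zero.2 h) ?_ (AdjoinRoot.mk_eq_zero.1 ha)
    rw [hdeg]
    exact degree_C_le.trans_lt (by norm_num)
  · have h := AdjoinRoot.eval₂_root f
    simp only [f, eval₂_add, eval₂_sub, eval₂_mul, eval₂_pow, eval₂_X, eval₂_C] at h
    linear_combination -h

/-- The trace of a power is the corresponding power sum of the roots of the characteristic
polynomial. -/
theorem map_trace_pow_eq_add_pow {A B G : Type*} [CommRing A] [CommRing B] [Group G]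
    {t d : G → A} (ht_one : t 1 = 2)
    (ht_rel : ∀ g h : G, t (g * h) + t (g * h⁻¹) * d h = t g * t h) (φ : A →+* B) (g : G)
    {x y : B} (hadd : x + y = φ (t g)) (hmul : x * y = φ (d g)) (n : ℕ) :
    φ (t (g ^ n)) = x ^ n + y ^ n := by
  induction n using Nat.twoStepInduction with
  | zero => rw [pow_zero, ht_one, map_ofNat, pow_zero, pow_zero, one_add_one_eq_two]
  | one => simp [hadd]
  | more n ih₀ ih₁ =>
    have h := congrArg φ (ht_rel (g ^ (n + 1)) g)
    rw [← pow_succ, pow_succ g n, mul_inv_cancel_right, ← pow_succ g n, map_add, map_mul,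
      map_mul, ih₀, ih₁, ← hadd, ← hmul] at h
    linear_combination h

/-- Let `p` be a prime, `A` a commutative ring of characteristic `p`, `G` a group, and
`(t, d)` a two-dimensional pseudo-representation of `G` over `A`: `d` is multiplicative,
`t` is central, `t 1 = 2`, and `t (g h) + t (g h⁻¹) d h = t g · t h` for all `g, h`.
Then `t (g ^ p) = (t g) ^ p` for every `g ∈ G`. -/
theorem pseudoRep_trace_pow_char
    (p : ℕ) (hp : p.Prime) (A : Type*) [CommRing A] [CharP A p]
    (G : Type*) [Group G] (t d : G → A)
    (hd_mul : ∀ g h : G, d (g * h) = d g * d h) (hd_one : d 1 = 1)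
    (ht_central : ∀ g h : G, t (g * h) = t (h * g)) (ht_one : t 1 = 2)
    (ht_rel : ∀ g h : G, t (g * h) + t (g * h⁻¹) * d h = t g * t h) :
    ∀ g : G, t (g ^ p) = (t g) ^ p := by
  intro g
  have : Fact p.Prime := ⟨hp⟩
  have : Nontrivial A := CharP.nontrivial_of_char_ne_one hp.ne_one
  obtain ⟨f, x, y, hf, hadd, hmul⟩ := exists_injective_add_eq_mul_eq (t g) (d g)
  have : CharP (AdjoinRoot f) p := charP_of_injective_ringHom hf p
  apply hf
  rw [map_trace_pow_eq_add_pow ht_one ht_rel _ g hadd hmul, map_pow, ← hadd, add_pow_char]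
end

section
/- Let A be a commutative ring, G a group, and (t, d) a two-dimensional pseudo-representation of G over A. Fix g ∈ G and let m be the 2×2 matrix over A given by m = [[0, −1], [d(g), t(g)]] (so trace(m) = t(g) and det(m) = d(g)). Then trace(m^n) = t(g^n) for every integer n ≥ 1. -/
/-- Let `A` be a commutative ring, `G` a group, and `(t, d)` a two-dimensional
pseudo-representation of `G` over `A`. Fix `g ∈ G` and let `m = [[0, −1], [d g, t g]]`,
the companion matrix of `X² − t(g) X + d(g)`. Then `trace (m ^ n) = t (g ^ n)` for every
integer `n ≥ 1`. -/
theorem pseudoRep_trace_companion_pow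
    (A : Type*) [CommRing A] (G : Type*) [Group G] (t d : G → A)
    (hd_mul : ∀ g h : G, d (g * h) = d g * d h) (hd_one : d 1 = 1)
    (ht_central : ∀ g h : G, t (g * h) = t (h * g)) (ht_one : t 1 = 2)
    (ht_rel : ∀ g h : G, t (g * h) + t (g * h⁻¹) * d h = t g * t h)
    (g : G) :
    ∀ n : ℕ, 1 ≤ n → Matrix.trace ((!![0, -1; d g, t g] : Matrix (Fin 2) (Fin 2) A) ^ n) =
      t (g ^ n) := by
  set m : Matrix (Fin 2) (Fin 2) A := !![0, -1; d g, t g] with hm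
  have hsq : m ^ 2 = t g • m - d g • (1 : Matrix (Fin 2) (Fin 2) A) := by
    ext i j
    fin_cases i <;> fin_cases j <;> simp [hm, pow_two, Matrix.mul_apply, Fin.sum_univ_two]
    ring
  have key : ∀ n : ℕ, Matrix.trace (m ^ n) = t (g ^ n) := by
    intro n
    induction n using Nat.twoStepInduction with
    | zero => simp [ht_one, Matrix.trace_one]
    | one => simp [hm, Matrix.trace_fin_two]
    | more n ih₀ ih₁ =>
      have hpow : m ^ (n + 2) = t g • m ^ (n + 1) - d g • m ^ n := by
        rw [pow_add, hsq, mul_sub, mul_smul_comm, mul_smul_comm, mul_one, pow_succ]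
      have hrel := ht_rel (g ^ (n + 1)) g
      rw [← pow_succ, pow_succ g n, mul_inv_cancel_right, ← pow_succ] at hrel
      rw [hpow, Matrix.trace_sub, Matrix.trace_smul, Matrix.trace_smul, ih₀, ih₁, smul_eq_mul,
        smul_eq_mul]
      linear_combination -hrel
  exact fun n _ => key n
end

section
/- Let p be a prime and let R be a commutative ring of characteristic p. Then for every 2×2 matrix M with entries in R, trace(M^p) = (trace M)^p. -/
theorem Matrix.add_adjugate_fin_two {R : Type*} [CommRing R] (A : Matrix (Fin 2) (Fin 2) R) :
    A + A.adjugate = A.trace • (1 : Matrix (Fin 2) (Fin 2) R) := by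
  ext i j
  fin_cases i <;> fin_cases j <;>
    simp [Matrix.adjugate_fin_two, Matrix.trace_fin_two, add_comm]

/-- Let `p` be a prime and `R` a commutative ring of characteristic `p`. Then for every
`2 × 2` matrix `M` over `R`, `trace (M ^ p) = (trace M) ^ p`. -/
theorem trace_pow_char_two_by_two
    (p : ℕ) (hp : p.Prime) (R : Type*) [CommRing R] [CharP R p]
    (M : Matrix (Fin 2) (Fin 2) R) :
    Matrix.trace (M ^ p) = (Matrix.trace M) ^ p := by
  have : Fact p.Prime := ⟨hp⟩
  have hcomm : Commute M M.adjugate := by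
    rw [Commute, SemiconjBy, Matrix.mul_adjugate, Matrix.adjugate_mul]
  have h := add_pow_char_of_commute p hcomm
  rw [← Matrix.adjugate_pow, Matrix.add_adjugate_fin_two, Matrix.add_adjugate_fin_two,
    smul_pow, one_pow] at h
  simpa using (congrFun (congrFun h 0) 0).symm
end

section
/- The sum of the reciprocals of the squarefull positive integers converges, and ∑_{m squarefull} 1/m = ζ(2)ζ(3)/ζ(6), where ζ is the Riemann zeta function. Equivalently, ∑_{m squarefull, m > 1} 1/m = ζ(2)ζ(3)/ζ(6) − 1 = 0.9435…. -/
/-- A positive integer `m` is squarefull (powerful) if `p² ∣ m` for every prime `p ∣ m`. -/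
def IsSquarefull (m : ℕ) : Prop :=
  0 < m ∧ ∀ p : ℕ, p.Prime → p ∣ m → p ^ 2 ∣ m

/-- The squarefree part of a positive integer is unique. -/
theorem squarefree_eq_of_sq_mul_eq {a b c d : ℕ} (ha : a ≠ 0) (hc : c ≠ 0) (hb : Squarefree b)
    (hd : Squarefree d) (h : a ^ 2 * b = c ^ 2 * d) : b = d := by
  refine Nat.eq_of_factorization_eq hb.ne_zero hd.ne_zero fun p => ?_
  have hp := congrArg (fun n => n.factorization p) h
  simp only [Nat.factorization_mul (pow_ne_zero 2 ha) hb.ne_zero,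
    Nat.factorization_mul (pow_ne_zero 2 hc) hd.ne_zero, Nat.factorization_pow,
    Finsupp.add_apply, Finsupp.smul_apply, smul_eq_mul] at hp
  have h₁ := hb.natFactorization_le_one p
  have h₂ := hd.natFactorization_le_one p
  omega

theorem eq_of_sq_mul_eq {a b c d : ℕ} (ha : a ≠ 0) (hc : c ≠ 0) (hb : Squarefree b)
    (hd : Squarefree d) (h : a ^ 2 * b = c ^ 2 * d) : a = c ∧ b = d := by
  obtain rfl := squarefree_eq_of_sq_mul_eq ha hc hb hd h
  exact ⟨Nat.pow_left_injective two_ne_zero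
    (Nat.eq_of_mul_eq_mul_right (Nat.pos_of_ne_zero hb.ne_zero) h), rfl⟩

theorem eq_of_sq_mul_cube_eq {a b c d : ℕ} (ha : a ≠ 0) (hc : c ≠ 0) (hb : Squarefree b)
    (hd : Squarefree d) (h : a ^ 2 * b ^ 3 = c ^ 2 * d ^ 3) : a = c ∧ b = d := by
  obtain ⟨h₁, rfl⟩ := eq_of_sq_mul_eq (mul_ne_zero ha hb.ne_zero) (mul_ne_zero hc hd.ne_zero)
    hb hd (by linear_combination h)
  exact ⟨Nat.eq_of_mul_eq_mul_right (Nat.pos_of_ne_zero hb.ne_zero) h₁, rfl⟩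

theorem isSquarefull_sq_mul_cube {a b : ℕ} (ha : a ≠ 0) (hb : b ≠ 0) :
    IsSquarefull (a ^ 2 * b ^ 3) := by
  refine ⟨by positivity, fun p hp h => ?_⟩
  rcases hp.dvd_mul.1 h with h | h
  · exact (pow_dvd_pow_of_dvd (hp.dvd_of_dvd_pow h) 2).mul_right _
  · exact ((pow_dvd_pow_of_dvd (hp.dvd_of_dvd_pow h) 2).trans
      (pow_dvd_pow b (by norm_num))).mul_left _

theorem IsSquarefull.exists_sq_mul_cube {m : ℕ} (hm : IsSquarefull m) :
    ∃ a b : ℕ, 0 < a ∧ Squarefree b ∧ a ^ 2 * b ^ 3 = m := by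
  obtain ⟨b, c, -, hc, rfl, hb⟩ := Nat.sq_mul_squarefree_of_pos hm.1
  have hbc : b ∣ c := by
    rw [← Nat.prod_primeFactors_of_squarefree hb]
    refine Finset.prod_primes_dvd c (fun p hp => (Nat.prime_of_mem_primeFactors hp).prime)
      fun p hp => ?_
    have hp' := Nat.prime_of_mem_primeFactors hp
    by_contra hpc
    have hcop : Nat.Coprime (p ^ 2) (c ^ 2) := ((hp'.coprime_iff_not_dvd).2 hpc).pow 2 2
    have h := hcop.dvd_of_dvd_mul_left
      (hm.2 p hp' ((Nat.dvd_of_mem_primeFactors hp).mul_left _))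
    exact hp'.one_lt.ne' (Nat.isUnit_iff.1 (hb p (by rwa [← sq])))
  obtain ⟨a, rfl⟩ := hbc
  exact ⟨a, b, Nat.pos_of_mul_pos_left hc, hb, by ring⟩

/-- A positive integer is uniquely a square times a squarefree number. -/
noncomputable def pnatProdSquarefreeEquivPNat : ℕ+ × {b : ℕ // Squarefree b} ≃ ℕ+ :=
  Equiv.ofBijective
    (fun x => ⟨x.1 ^ 2 * x.2, Nat.mul_pos (pow_pos x.1.pos 2) x.2.2.ne_zero.bot_lt⟩) <| by
    refine ⟨fun ⟨a, b, hb⟩ ⟨c, d, hd⟩ h => ?_, fun n => ?_⟩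
    · obtain ⟨h₁, h₂⟩ := eq_of_sq_mul_eq a.ne_zero c.ne_zero hb hd (congrArg PNat.val h)
      exact Prod.ext (PNat.eq h₁) (Subtype.ext h₂)
    · obtain ⟨b, c, -, hc, h, hb⟩ := Nat.sq_mul_squarefree_of_pos n.pos
      exact ⟨(⟨c, hc⟩, ⟨b, hb⟩), PNat.eq h⟩

/-- A squarefull number is uniquely a square times the cube of a squarefree number. -/
noncomputable def pnatProdSquarefreeEquivSquarefull :
    ℕ+ × {b : ℕ // Squarefree b} ≃ {m : ℕ // IsSquarefull m} :=
  Equiv.ofBijective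
    (fun x => ⟨x.1 ^ 2 * x.2 ^ 3, isSquarefull_sq_mul_cube x.1.ne_zero x.2.2.ne_zero⟩) <| by
    refine ⟨fun ⟨a, b, hb⟩ ⟨c, d, hd⟩ h => ?_, fun ⟨m, hm⟩ => ?_⟩
    · obtain ⟨h₁, h₂⟩ := eq_of_sq_mul_cube_eq a.ne_zero c.ne_zero hb hd (congrArg Subtype.val h)
      exact Prod.ext (PNat.eq h₁) (Subtype.ext h₂)
    · obtain ⟨a, b, ha, hb, h⟩ := hm.exists_sq_mul_cube
      exact ⟨(⟨a, ha⟩, ⟨b, hb⟩), Subtype.ext h⟩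

theorem coe_pnatProdSquarefreeEquivPNat (x : ℕ+ × {b : ℕ // Squarefree b}) :
    (pnatProdSquarefreeEquivPNat x : ℕ) = x.1 ^ 2 * x.2 := rfl

theorem coe_pnatProdSquarefreeEquivSquarefull (x : ℕ+ × {b : ℕ // Squarefree b}) :
    (pnatProdSquarefreeEquivSquarefull x : ℕ) = x.1 ^ 2 * x.2 ^ 3 := rfl

theorem hasSum_pnat_one_div_pow {k : ℕ} (hk : 1 < k) :
    HasSum (fun n : ℕ+ => (1 : ℝ) / (n : ℝ) ^ k) (∑' n : ℕ, (1 : ℝ) / ((n : ℝ) + 1) ^ k) := by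
  have h : Summable fun n : ℕ+ => (1 : ℝ) / (n : ℝ) ^ k :=
    (Real.summable_one_div_nat_pow.2 hk).comp_injective PNat.coe_injective
  have := tsum_pnat_eq_tsum_succ (f := fun n : ℕ => (1 : ℝ) / (n : ℝ) ^ k)
  push_cast at this
  exact this ▸ h.hasSum

theorem summable_squarefree_one_div_cube :
    Summable fun b : {b : ℕ // Squarefree b} => (1 : ℝ) / (b : ℝ) ^ 3 :=
  (Real.summable_one_div_nat_pow.2 (by norm_num)).comp_injective Subtype.val_injective

theorem hasSum_mul_of_nonneg {ι κ : Type*} {f : ι → ℝ} {g : κ → ℝ} {a b : ℝ} (hf : HasSum f a)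
    (hg : HasSum g b) (hf₀ : ∀ i, 0 ≤ f i) (hg₀ : ∀ i, 0 ≤ g i) :
    HasSum (fun x : ι × κ => f x.1 * g x.2) (a * b) :=
  hf.mul hg (hf.summable.mul_of_nonneg hg.summable hf₀ hg₀)

theorem hasSum_pnat_prod_squarefree {k : ℕ} (hk : 1 < k) :
    HasSum (fun x : ℕ+ × {b : ℕ // Squarefree b} =>
        (1 : ℝ) / (x.1 : ℝ) ^ k * (1 / (x.2 : ℝ) ^ 3))
      ((∑' n : ℕ, (1 : ℝ) / ((n : ℝ) + 1) ^ k) *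
        ∑' b : {b : ℕ // Squarefree b}, (1 : ℝ) / (b : ℝ) ^ 3) :=
  hasSum_mul_of_nonneg (hasSum_pnat_one_div_pow hk) summable_squarefree_one_div_cube.hasSum
    (fun _ => by positivity) fun _ => by positivity

theorem tsum_one_div_cube_eq :
    (∑' n : ℕ, (1 : ℝ) / ((n : ℝ) + 1) ^ 3) = (∑' n : ℕ, (1 : ℝ) / ((n : ℝ) + 1) ^ 6) *
      ∑' b : {b : ℕ // Squarefree b}, (1 : ℝ) / (b : ℝ) ^ 3 := by
  refine (pnatProdSquarefreeEquivPNat.hasSum_iff.2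
    (hasSum_pnat_one_div_pow (k := 3) (by norm_num))).unique ?_
  convert hasSum_pnat_prod_squarefree (k := 6) (by norm_num) using 2 with x
  rw [Function.comp_apply, coe_pnatProdSquarefreeEquivPNat]
  push_cast
  rw [one_div_mul_one_div]
  ring

/-- The sum of the reciprocals of the squarefull positive integers converges, with value
`ζ(2) ζ(3) / ζ(6)`, where `ζ(s) = ∑ 1/nˢ`. -/
theorem hasSum_reciprocal_squarefull :
    HasSum (fun m : {m : ℕ // IsSquarefull m} => (1 : ℝ) / ((m : ℕ) : ℝ))
      ((∑' n : ℕ, (1 : ℝ) / ((n : ℝ) + 1) ^ 2) * (∑' n : ℕ, (1 : ℝ) / ((n : ℝ) + 1) ^ 3) /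
        (∑' n : ℕ, (1 : ℝ) / ((n : ℝ) + 1) ^ 6)) := by
  have h := hasSum_pnat_one_div_pow (k := 6) (by norm_num)
  have h6 : (∑' n : ℕ, (1 : ℝ) / ((n : ℝ) + 1) ^ 6) ≠ 0 :=
    (h.tsum_eq ▸ h.summable.tsum_pos (fun _ => by positivity) 1 (by simp)).ne'
  rw [tsum_one_div_cube_eq, mul_left_comm, mul_div_cancel_left₀ _ h6,
    ← pnatProdSquarefreeEquivSquarefull.hasSum_iff]
  convert hasSum_pnat_prod_squarefree (k := 2) (by norm_num) using 2 with x
  rw [Function.comp_apply, coe_pnatProdSquarefreeEquivSquarefull]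
  push_cast
  rw [one_div_mul_one_div]
end

section
/- For every integer h ≥ 1 there exists a constant C > 0 (depending only on h) such that for all real x ≥ 3, the number of integers n with 1 ≤ n ≤ x having exactly h distinct prime factors is at most C · x · (log log x)^{h−1} / log x. -/
open Finset

lemma sum_le_sum_of_injOn_comp {α β : Type*} [DecidableEq β] {s : Finset α} {t : Finset β}
    {f : α → ℝ} {g : β → ℝ} (i : α → β) (hi : ∀ a ∈ s, i a ∈ t) (hinj : Set.InjOn i s)
    (hfg : ∀ a ∈ s, f a ≤ g (i a)) (hg : ∀ b ∈ t, 0 ≤ g b) :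
    ∑ a ∈ s, f a ≤ ∑ b ∈ t, g b :=
  calc ∑ a ∈ s, f a ≤ ∑ a ∈ s, g (i a) := sum_le_sum hfg
    _ = ∑ b ∈ s.image i, g b := (sum_image hinj).symm
    _ ≤ ∑ b ∈ t, g b :=
      sum_le_sum_of_subset_of_nonneg (image_subset_iff.2 hi) fun b hb _ => hg b hb

/-- The integers `1 ≤ n ≤ N` with exactly `k` distinct prime factors. -/
def omegaEq (k N : ℕ) : Finset ℕ := {n ∈ Icc 1 N | n.primeFactors.card = k}

/-- The pairs `(p, a)` with `p` prime, `1 ≤ a` and `p ^ a ≤ N`. -/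
def primePowPairs (N : ℕ) : Finset (ℕ × ℕ) :=
  {q ∈ Icc 1 N ×ˢ Icc 1 N | q.1.Prime ∧ q.1 ^ q.2 ≤ N}

lemma mem_omegaEq {k N n : ℕ} : n ∈ omegaEq k N ↔ (1 ≤ n ∧ n ≤ N) ∧ n.primeFactors.card = k := by
  simp [omegaEq]

lemma mem_primePowPairs {N p a : ℕ} :
    (p, a) ∈ primePowPairs N ↔ p.Prime ∧ 1 ≤ a ∧ p ^ a ≤ N := by
  simp only [primePowPairs, mem_filter, mem_product, mem_Icc]
  refine ⟨fun h => ⟨h.2.1, h.1.2.1, h.2.2⟩, fun ⟨hp, ha, h⟩ => ⟨⟨⟨hp.one_le, ?_⟩, ha, ?_⟩, hp, h⟩⟩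
  · exact (Nat.le_self_pow (by omega) p).trans h
  · exact (Nat.lt_pow_self hp.one_lt).le.trans h

lemma ordCompl_mem_omegaEq {k N n p : ℕ} (hn : n ∈ omegaEq (k + 1) N) (hp : p ∈ n.primeFactors) :
    n / p ^ n.factorization p ∈ omegaEq k N := by
  obtain ⟨⟨h1, hN⟩, hk⟩ := mem_omegaEq.1 hn
  refine mem_omegaEq.2 ⟨⟨Nat.ordCompl_pos p (by omega), (Nat.div_le_self _ _).trans hN⟩, ?_⟩
  rw [← Nat.support_factorization, Nat.factorization_ordCompl, Finsupp.support_erase,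
    Nat.support_factorization, card_erase_of_mem hp, hk, Nat.add_sub_cancel]

lemma factorization_mem_primePowPairs {N n p : ℕ} (hN : n ≤ N) (hp : p ∈ n.primeFactors) :
    (p, n.factorization p) ∈ primePowPairs (N / (n / p ^ n.factorization p)) := by
  obtain ⟨hpp, hd, h0⟩ := Nat.mem_primeFactors.1 hp
  refine mem_primePowPairs.2 ⟨hpp, hpp.factorization_pos_of_dvd h0 hd, ?_⟩
  rw [Nat.le_div_iff_mul_le (Nat.ordCompl_pos p h0), Nat.ordProj_mul_ordCompl_eq_self]
  exact hN

lemma primePowPairs_mono {M N : ℕ} (h : M ≤ N) : primePowPairs M ⊆ primePowPairs N := by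
  rintro ⟨p, a⟩ hq
  rw [mem_primePowPairs] at hq ⊢
  exact ⟨hq.1, hq.2.1, hq.2.2.trans h⟩

lemma sum_log_omegaEq_le (k N : ℕ) :
    ∑ n ∈ omegaEq (k + 1) N, Real.log n ≤
      ∑ m ∈ omegaEq k N, ∑ q ∈ primePowPairs (N / m), (q.2 : ℝ) * Real.log q.1 := by
  have hlog (n : ℕ) : Real.log n =
      ∑ p ∈ n.primeFactors, (n.factorization p : ℝ) * Real.log p := by
    rw [Real.log_nat_eq_sum_factorization, Finsupp.sum, Nat.support_factorization]
  rw [sum_congr rfl fun n _ => hlog n, sum_sigma', sum_sigma']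
  refine sum_le_sum_of_injOn_comp
    (fun z => ⟨z.1 / z.2 ^ z.1.factorization z.2, (z.2, z.1.factorization z.2)⟩) ?_ ?_ ?_ ?_
  · rintro ⟨n, p⟩ h
    rw [mem_sigma] at h ⊢
    exact ⟨ordCompl_mem_omegaEq h.1 h.2,
      factorization_mem_primePowPairs (mem_omegaEq.1 h.1).1.2 h.2⟩
  · rintro ⟨n, p⟩ - ⟨n', p'⟩ - h
    simp only [Sigma.mk.injEq, heq_eq_eq, Prod.mk.injEq] at h
    obtain ⟨h1, rfl, h2⟩ := h
    have : n = n' := by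
      rw [← Nat.ordProj_mul_ordCompl_eq_self n p, ← Nat.ordProj_mul_ordCompl_eq_self n' p, h1, h2]
    rw [this]
  · intro _ _
    exact le_rfl
  · intro _ _
    exact mul_nonneg (Nat.cast_nonneg _) (Real.log_natCast_nonneg _)

lemma sum_inv_omegaEq_le (k N : ℕ) :
    ∑ n ∈ omegaEq k N, (n : ℝ)⁻¹ ≤ (∑ q ∈ primePowPairs N, ((q.1 : ℝ) ^ q.2)⁻¹) ^ k := by
  induction k with
  | zero =>
    have : omegaEq 0 N ⊆ {1} := by
      intro n hn
      obtain ⟨⟨h1, -⟩, h⟩ := mem_omegaEq.1 hn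
      rw [card_eq_zero, Nat.primeFactors_eq_empty] at h
      rw [mem_singleton]
      omega
    refine (sum_le_sum_of_subset_of_nonneg this fun _ _ _ => by positivity).trans ?_
    simp
  | succ k ih =>
    rw [pow_succ]
    refine le_trans ?_ (mul_le_mul_of_nonneg_right ih (sum_nonneg fun _ _ => by positivity))
    rw [sum_mul_sum, ← sum_product']
    refine sum_le_sum_of_injOn_comp (fun n => (n / n.minFac ^ n.factorization n.minFac,
      (n.minFac, n.factorization n.minFac))) ?_ ?_ ?_ ?_
    · intro n hn
      obtain ⟨⟨h1, hN⟩, hk⟩ := mem_omegaEq.1 hn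
      have hp : n.minFac ∈ n.primeFactors := by
        refine Nat.mem_primeFactors.2 ⟨Nat.minFac_prime ?_, n.minFac_dvd, by omega⟩
        rintro rfl
        simp at hk
      exact mem_product.2 ⟨ordCompl_mem_omegaEq hn hp,
        primePowPairs_mono (Nat.div_le_self _ _) (factorization_mem_primePowPairs hN hp)⟩
    · intro n _ n' _ h
      simp only [Prod.mk.injEq] at h
      obtain ⟨h1, h2, h3⟩ := h
      rw [← Nat.ordProj_mul_ordCompl_eq_self n n.minFac, h1, h3, h2,
        Nat.ordProj_mul_ordCompl_eq_self]
    · intro n _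
      dsimp only
      rw [← mul_inv, ← Nat.cast_pow, ← Nat.cast_mul, mul_comm, Nat.ordProj_mul_ordCompl_eq_self]
    · intro _ _
      positivity

lemma sqrt_mul_log_sq_le (y : ℕ) : √(y : ℝ) * Real.log y ^ 2 ≤ 16 * y := by
  have h0 : (0 : ℝ) ≤ y := Nat.cast_nonneg y
  have h1 : Real.log y ≤ 4 * √√(y : ℝ) := by
    have := Real.log_le_rpow_div h0 (ε := 1 / 4) (by norm_num)
    rw [Real.sqrt_eq_rpow, Real.sqrt_eq_rpow, ← Real.rpow_mul h0]
    norm_num at this ⊢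
    linarith
  have h2 : Real.log y ^ 2 ≤ 16 * √(y : ℝ) := by
    calc Real.log y ^ 2 ≤ (4 * √√(y : ℝ)) ^ 2 :=
          pow_le_pow_left₀ (Real.log_natCast_nonneg y) h1 2
      _ = 16 * √(y : ℝ) := by rw [mul_pow, Real.sq_sqrt (Real.sqrt_nonneg _)]; norm_num
  calc √(y : ℝ) * Real.log y ^ 2 ≤ √(y : ℝ) * (16 * √(y : ℝ)) := by gcongr
    _ = 16 * (√(y : ℝ) * √(y : ℝ)) := by ring
    _ = 16 * y := by rw [Real.mul_self_sqrt h0]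

lemma sum_mul_log_primePowPairs_le (y : ℕ) :
    ∑ q ∈ primePowPairs y, (q.2 : ℝ) * Real.log q.1 ≤ (Real.log 4 + 32) * y := by
  rw [← sum_filter_add_sum_filter_not _ (fun q : ℕ × ℕ => q.2 = 1), add_mul]
  refine add_le_add ?_ ?_
  · refine le_trans ?_ (Chebyshev.theta_le_log4_mul_x (Nat.cast_nonneg y))
    rw [Chebyshev.theta, Nat.floor_natCast]
    refine sum_le_sum_of_injOn_comp Prod.fst ?_ ?_ ?_ ?_
    · rintro ⟨p, a⟩ h
      rw [mem_filter, mem_primePowPairs] at h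
      obtain ⟨⟨hp, -, h⟩, rfl : a = 1⟩ := h
      rw [mem_filter, mem_Ioc]
      exact ⟨⟨hp.pos, by simpa using h⟩, hp⟩
    · rintro ⟨p, a⟩ h ⟨p', a'⟩ h' e
      simp only [coe_filter, Set.mem_ofPred_eq] at h h' e
      rw [h.2, h'.2, e]
    · rintro ⟨p, a⟩ h
      obtain rfl : a = 1 := (mem_filter.1 h).2
      simp
    · intro _ _
      exact Real.log_natCast_nonneg _
  · have hsub : {q ∈ primePowPairs y | ¬ q.2 = 1} ⊆ Icc 1 y.sqrt ×ˢ Icc 1 (Nat.log 2 y) := by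
      rintro ⟨p, a⟩ h
      rw [mem_filter, mem_primePowPairs] at h
      obtain ⟨⟨hp, h1, h⟩, h2 : ¬ a = 1⟩ := h
      rw [mem_product, mem_Icc, mem_Icc]
      refine ⟨⟨hp.one_le, Nat.le_sqrt'.2 ((Nat.pow_le_pow_right hp.pos (by omega)).trans h)⟩, h1,
        Nat.le_log_of_pow_le one_lt_two ((Nat.pow_le_pow_left hp.two_le a).trans h)⟩
    have hterm : ∀ q ∈ {q ∈ primePowPairs y | ¬ q.2 = 1},
        (q.2 : ℝ) * Real.log q.1 ≤ Real.log y := by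
      rintro ⟨p, a⟩ h
      rw [mem_filter, mem_primePowPairs] at h
      obtain ⟨⟨hp, h1, h⟩, -⟩ := h
      rw [← Real.log_pow]
      refine Real.log_le_log (pow_pos (Nat.cast_pos.2 hp.pos) _) ?_
      exact_mod_cast h
    have hl := Real.log_natCast_nonneg y
    have hlog2 : (Nat.log 2 y : ℝ) ≤ 2 * Real.log y := by
      have h1 := Real.natLog_le_logb y 2
      have h2 := Real.log_two_gt_d9
      rw [Real.logb, Nat.cast_two, le_div_iff₀ (by linarith)] at h1
      nlinarith [(Nat.cast_nonneg (Nat.log 2 y) : (0 : ℝ) ≤ _)]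
    calc _ ≤ _ := sum_le_card_nsmul _ _ _ hterm
      _ ≤ ((y.sqrt * Nat.log 2 y : ℕ) : ℝ) * Real.log y := by
        rw [nsmul_eq_mul]
        gcongr
        simpa using card_le_card hsub
      _ ≤ √(y : ℝ) * (2 * Real.log y) * Real.log y := by
        rw [Nat.cast_mul]
        gcongr
        exact Real.nat_sqrt_le_real_sqrt
      _ = 2 * (√(y : ℝ) * Real.log y ^ 2) := by ring
      _ ≤ 32 * y := by linarith [sqrt_mul_log_sq_le y]

lemma sum_inv_primes_dyadic_le (k : ℕ) :
    ∑ p ∈ Ioc (2 ^ (k + 1) : ℕ) (2 ^ (k + 2)) with p.Prime, (p : ℝ)⁻¹ ≤ 4 * ((k + 1 : ℕ) : ℝ)⁻¹ := by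
  have hlog : 0 < Real.log 2 := Real.log_pos one_lt_two
  have h : ∑ p ∈ Ioc (2 ^ (k + 1) : ℕ) (2 ^ (k + 2)) with p.Prime, Real.log p ≤
      Real.log 4 * (2 ^ (k + 2) : ℕ) := by
    refine le_trans ?_ (Chebyshev.theta_le_log4_mul_x (Nat.cast_nonneg _))
    rw [Chebyshev.theta, Nat.floor_natCast]
    exact sum_le_sum_of_subset_of_nonneg
      (filter_subset_filter _ (Ioc_subset_Ioc_left (Nat.zero_le _)))
      fun _ _ _ => Real.log_natCast_nonneg _
  have hterm : ∀ p ∈ {p ∈ Ioc (2 ^ (k + 1) : ℕ) (2 ^ (k + 2)) | p.Prime},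
      (p : ℝ)⁻¹ ≤ Real.log p * (((k + 1 : ℕ) : ℝ) * Real.log 2 * 2 ^ (k + 1))⁻¹ := by
    intro p hp
    simp only [mem_filter, mem_Ioc] at hp
    have h1 : (2 : ℝ) ^ (k + 1) ≤ p := by exact_mod_cast hp.1.1.le
    have h2 : ((k + 1 : ℕ) : ℝ) * Real.log 2 ≤ Real.log p := by
      rw [← Real.log_pow]
      exact Real.log_le_log (by positivity) h1
    have hp0 : (0 : ℝ) < p := lt_of_lt_of_le (by positivity) h1
    rw [← div_eq_mul_inv, le_div_iff₀ (by positivity), inv_mul_le_iff₀ hp0, mul_comm]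
    exact mul_le_mul h1 h2 (by positivity) hp0.le
  refine (sum_le_sum hterm).trans ?_
  rw [← sum_mul]
  refine (mul_le_mul_of_nonneg_right h (by positivity)).trans_eq ?_
  have h4 : Real.log 4 = 2 * Real.log 2 := by
    rw [← Real.log_rpow two_pos]; norm_num
  rw [h4]
  push_cast
  field_simp
  ring

lemma sum_inv_primes_two_pow_le (k : ℕ) :
    ∑ p ∈ Ioc (0 : ℕ) (2 ^ (k + 1)) with p.Prime, (p : ℝ)⁻¹ ≤ 1 / 2 + 4 * (harmonic k : ℝ) := by
  induction k with
  | zero =>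
    have : {p ∈ Ioc (0 : ℕ) (2 ^ (0 + 1)) | p.Prime} = {2} := by decide
    rw [this]
    simp
  | succ k ih =>
    have hs := Ioc_union_Ioc_eq_Ioc (Nat.zero_le (2 ^ (k + 1)))
      (Nat.pow_le_pow_right two_pos (Nat.le_succ (k + 1)))
    rw [← hs, filter_union, sum_union, harmonic_succ]
    · have := sum_inv_primes_dyadic_le k
      push_cast at this ⊢
      linarith
    · exact disjoint_filter_filter (Ioc_disjoint_Ioc_of_le le_rfl)

lemma sum_inv_primePowPairs_le_primes (N : ℕ) :
    ∑ q ∈ primePowPairs N, ((q.1 : ℝ) ^ q.2)⁻¹ ≤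
      2 * ∑ p ∈ Ioc 0 N with p.Prime, (p : ℝ)⁻¹ := by
  have hsub : primePowPairs N ⊆ {p ∈ Ioc 0 N | p.Prime} ×ˢ Ico 1 (N + 1) := by
    rintro ⟨p, a⟩ h
    simp only [primePowPairs, mem_filter, mem_product, mem_Icc, mem_Ioc, mem_Ico] at h ⊢
    exact ⟨⟨⟨h.1.1.1, h.1.1.2⟩, h.2.1⟩, h.1.2.1, by omega⟩
  refine (sum_le_sum_of_subset_of_nonneg hsub fun _ _ _ => by positivity).trans ?_
  rw [sum_product, mul_sum]
  refine sum_le_sum fun p hp => ?_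
  have hp2 : (2 : ℝ) ≤ p := by exact_mod_cast (mem_filter.1 hp).2.two_le
  have hinv : (p : ℝ)⁻¹ ≤ 1 / 2 := by
    rw [one_div]
    exact inv_anti₀ two_pos hp2
  simp only [← inv_pow]
  refine (geom_sum_Ico_le_of_lt_one (by positivity) (by linarith)).trans ?_
  rw [pow_one, div_le_iff₀ (by linarith)]
  nlinarith [inv_pos.2 (by linarith : (0 : ℝ) < p)]

lemma sum_inv_primePowPairs_le {x : ℝ} (hx : 3 ≤ x) :
    ∑ q ∈ primePowPairs ⌊x⌋₊, ((q.1 : ℝ) ^ q.2)⁻¹ ≤ 25 + 8 * Real.log (Real.log x) := by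
  set N := ⌊x⌋₊
  have hN : 3 ≤ N := Nat.le_floor (by exact_mod_cast hx)
  set k := Nat.log 2 N
  have hk : 1 ≤ k := Nat.le_log_of_pow_le one_lt_two (by omega)
  have hNk : N ≤ 2 ^ (k + 1) := (Nat.lt_pow_succ_log_self one_lt_two N).le
  have hprimes : ∑ p ∈ Ioc 0 N with p.Prime, (p : ℝ)⁻¹ ≤ 1 / 2 + 4 * (1 + Real.log k) := by
    refine le_trans (sum_le_sum_of_subset_of_nonneg
      (filter_subset_filter _ (Ioc_subset_Ioc_right hNk)) fun _ _ _ => by positivity) ?_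
    linarith [sum_inv_primes_two_pow_le k, harmonic_le_one_add_log k]
  have hlogx : 0 < Real.log x := Real.log_pos (by linarith)
  have hkx : (k : ℝ) ≤ 2 * Real.log x := by
    have h1 := Real.natLog_le_logb N 2
    have h2 := Real.log_two_gt_d9
    have h3 : Real.log N ≤ Real.log x :=
      Real.log_le_log (by positivity) (Nat.floor_le (by linarith))
    rw [Real.logb, Nat.cast_two, le_div_iff₀ (by linarith)] at h1
    nlinarith [(Nat.cast_nonneg k : (0 : ℝ) ≤ _)]
  have hlogk : Real.log k ≤ Real.log 2 + Real.log (Real.log x) := by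
    rw [← Real.log_mul two_ne_zero hlogx.ne']
    exact Real.log_le_log (by positivity) hkx
  linarith [sum_inv_primePowPairs_le_primes N, Real.log_two_lt_d9]

lemma sum_log_omegaEq_le_mul_pow (k N : ℕ) :
    ∑ n ∈ omegaEq (k + 1) N, Real.log n ≤
      (Real.log 4 + 32) * N * (∑ q ∈ primePowPairs N, ((q.1 : ℝ) ^ q.2)⁻¹) ^ k := by
  have hlog4 : 0 ≤ Real.log 4 := Real.log_nonneg (by norm_num)
  calc _ ≤ _ := sum_log_omegaEq_le k N
    _ ≤ ∑ m ∈ omegaEq k N, (Real.log 4 + 32) * N * (m : ℝ)⁻¹ := by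
      refine sum_le_sum fun m _ => (sum_mul_log_primePowPairs_le _).trans ?_
      rw [mul_assoc, ← div_eq_mul_inv]
      gcongr
      exact Nat.cast_div_le
    _ ≤ _ := by
      rw [← mul_sum]
      gcongr
      exact sum_inv_omegaEq_le k N

lemma card_omegaEq_mul_log_le (k : ℕ) {x : ℝ} (hx : 1 ≤ x) :
    ((omegaEq k ⌊x⌋₊).card : ℝ) * Real.log x ≤
      2 * x + 2 * ∑ n ∈ omegaEq k ⌊x⌋₊, Real.log n := by
  have hlogx : 0 ≤ Real.log x := Real.log_nonneg hx
  have hterm : ∀ n ∈ omegaEq k ⌊x⌋₊,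
      Real.log x ≤ (if n ≤ ⌊√x⌋₊ then Real.log x else 0) + 2 * Real.log n := by
    intro n _
    split_ifs with h
    · linarith [Real.log_natCast_nonneg n]
    · have h1 : √x ≤ n := (Nat.lt_of_floor_lt (not_le.1 h)).le
      have h2 := Real.log_le_log (Real.sqrt_pos.2 (by linarith)) h1
      rw [Real.log_sqrt (by linarith)] at h2
      linarith
  have hsmall : ∑ n ∈ omegaEq k ⌊x⌋₊, (if n ≤ ⌊√x⌋₊ then Real.log x else 0) ≤ 2 * x := by
    rw [← sum_filter, sum_const, nsmul_eq_mul]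
    have hsub : {n ∈ omegaEq k ⌊x⌋₊ | n ≤ ⌊√x⌋₊} ⊆ Icc 1 ⌊√x⌋₊ := by
      intro n hn
      rw [mem_filter, mem_omegaEq] at hn
      exact mem_Icc.2 ⟨hn.1.1.1, hn.2⟩
    have hcard : (({n ∈ omegaEq k ⌊x⌋₊ | n ≤ ⌊√x⌋₊}.card : ℕ) : ℝ) ≤ √x := by
      refine le_trans ?_ (Nat.floor_le (Real.sqrt_nonneg x))
      exact_mod_cast (card_le_card hsub).trans_eq (by simp)
    have hlog : Real.log x ≤ 2 * √x := by
      have := Real.log_le_self (Real.sqrt_nonneg x)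
      rw [Real.log_sqrt (by linarith)] at this
      linarith
    calc _ ≤ √x * (2 * √x) := by gcongr
      _ = 2 * (√x * √x) := by ring
      _ = 2 * x := by rw [Real.mul_self_sqrt (by linarith)]
  have := sum_le_sum hterm
  rw [sum_const, nsmul_eq_mul, sum_add_distrib, ← mul_sum] at this
  linarith

/-- For every integer `h ≥ 1` there is a constant `C > 0` (depending only on `h`) such that
for all real `x ≥ 3`, the number of integers `1 ≤ n ≤ x` with exactly `h` distinct prime
factors is at most `C · x · (log log x)^{h−1} / log x`. -/
theorem count_omega_eq_h_le (h : ℕ) (hh : 1 ≤ h) :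
    ∃ C : ℝ, 0 < C ∧ ∀ x : ℝ, 3 ≤ x →
      ({n : ℕ | 1 ≤ n ∧ (n : ℝ) ≤ x ∧ n.primeFactors.card = h}.ncard : ℝ) ≤
        C * x * Real.log (Real.log x) ^ (h - 1) / Real.log x := by
  obtain ⟨k, rfl⟩ := Nat.exists_eq_add_of_le' hh
  rw [Nat.add_sub_cancel]
  have hlog4 : 0 < Real.log 4 := Real.log_pos (by norm_num)
  have hlog3 : 1 < Real.log 3 := by
    rw [Real.lt_log_iff_exp_lt (by norm_num)]
    linarith [Real.exp_one_lt_d9]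
  set c := Real.log (Real.log 3)
  have hc : 0 < c := Real.log_pos hlog3
  refine ⟨2 * (1 / c) ^ k + 2 * (Real.log 4 + 32) * (25 / c + 8) ^ k, by positivity,
    fun x hx => ?_⟩
  have hlogx : Real.log 3 ≤ Real.log x := Real.log_le_log (by norm_num) hx
  have hcx : c ≤ Real.log (Real.log x) := Real.log_le_log (by linarith) hlogx
  set L := Real.log (Real.log x)
  have hset : {n : ℕ | 1 ≤ n ∧ (n : ℝ) ≤ x ∧ n.primeFactors.card = k + 1} =
      omegaEq (k + 1) ⌊x⌋₊ := by
    ext n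
    rw [Set.mem_ofPred_eq, mem_coe, mem_omegaEq, Nat.le_floor_iff (by linarith), and_assoc]
  rw [hset, Set.ncard_coe_finset, le_div_iff₀ (by linarith)]
  have hone : 1 ≤ (1 / c) ^ k * L ^ k := by
    rw [← mul_pow]
    refine one_le_pow₀ ?_
    rwa [one_div_mul_eq_div, one_le_div hc]
  have hT : ∑ q ∈ primePowPairs ⌊x⌋₊, ((q.1 : ℝ) ^ q.2)⁻¹ ≤ (25 / c + 8) * L := by
    refine (sum_inv_primePowPairs_le hx).trans ?_
    have : 25 ≤ 25 / c * L := by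
      rw [div_mul_eq_mul_div, le_div_iff₀ hc]
      linarith
    linarith
  have hsum : ∑ n ∈ omegaEq (k + 1) ⌊x⌋₊, Real.log n ≤
      (Real.log 4 + 32) * x * ((25 / c + 8) * L) ^ k := by
    refine (sum_log_omegaEq_le_mul_pow k _).trans ?_
    gcongr
    exact Nat.floor_le (by linarith)
  calc _ ≤ _ := card_omegaEq_mul_log_le (k + 1) (by linarith)
    _ ≤ 2 * x * ((1 / c) ^ k * L ^ k) +
        2 * ((Real.log 4 + 32) * x * ((25 / c + 8) * L) ^ k) := by
      exact add_le_add (le_mul_of_one_le_right (by linarith) hone)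
        (mul_le_mul_of_nonneg_left hsum zero_le_two)
    _ = _ := by
      rw [mul_pow]
      ring
end

section
/- Let N(x) denote the number of integers n with 1 ≤ n ≤ x such that n is squarefree and every prime divisor of n is congruent to 1 modulo 3. Then N(x) ~ C · x / (log x)^{1/2} as x → ∞, where C = (3^{1/4}/(π√2)) · ∏_{p ≡ 1 (mod 3)} (1 − 1/p²)^{1/2} = 0.2913…, the product (which converges absolutely) being over all primes p congruent to 1 modulo 3. -/
open Filter
open MeasureTheory Topology

/-- The Fourier transform of the triangle function `1 - |t|` on `[-1, 1]`. -/
noncomputable def fejerKernel (v : ℝ) : ℝ := ∫ t in (-1 : ℝ)..1, (1 - |t|) * Real.cos (t * v)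

lemma continuous_fejerKernel : Continuous fejerKernel :=
  intervalIntegral.continuous_parametric_intervalIntegral_of_continuous' (by fun_prop) _ _

lemma fejerKernel_of_ne_zero {v : ℝ} (hv : v ≠ 0) :
    fejerKernel v = 2 * (1 - Real.cos v) / v ^ 2 := by
  have key : ∫ t in (0 : ℝ)..1, (1 - t) * Real.cos (t * v) = (1 - Real.cos v) / v ^ 2 := by
    have hderiv : ∀ t ∈ Set.uIcc (0 : ℝ) 1, HasDerivAt
        (fun t => (1 - t) * (Real.sin (t * v) / v) - Real.cos (t * v) / v ^ 2)
        ((1 - t) * Real.cos (t * v)) t := by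
      intro t _
      have h1 : HasDerivAt (fun t : ℝ => t * v) v t := by simpa using (hasDerivAt_id t).mul_const v
      have h2 := ((hasDerivAt_id t).const_sub 1).mul (h1.sin.div_const v)
      have h3 := h2.sub (h1.cos.div_const (v ^ 2))
      convert! h3 using 1
      simp only [id]
      field_simp
      ring
    rw [intervalIntegral.integral_eq_sub_of_hasDerivAt hderiv
      (Continuous.intervalIntegrable (by fun_prop) _ _)]
    simp
    field_simp
    ring
  have hpos : ∫ t in (0 : ℝ)..1, (1 - |t|) * Real.cos (t * v) = (1 - Real.cos v) / v ^ 2 := by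
    rw [← key]
    refine intervalIntegral.integral_congr fun t ht => ?_
    rw [Set.uIcc_of_le zero_le_one] at ht
    simp only [abs_of_nonneg ht.1]
  have hneg : ∫ t in (-1 : ℝ)..0, (1 - |t|) * Real.cos (t * v) = (1 - Real.cos v) / v ^ 2 := by
    have := intervalIntegral.integral_comp_neg (a := 0) (b := 1)
      (fun t : ℝ => (1 - |t|) * Real.cos (t * v))
    simp only [abs_neg, neg_mul, Real.cos_neg, neg_zero] at this
    rw [← this, hpos]
  have hi : ∀ a b : ℝ, IntervalIntegrable (fun t => (1 - |t|) * Real.cos (t * v)) volume a b :=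
    fun a b => Continuous.intervalIntegrable (by fun_prop) _ _
  rw [fejerKernel, ← intervalIntegral.integral_add_adjacent_intervals (hi _ 0) (hi 0 _), hneg, hpos]
  ring

lemma fejerKernel_zero : fejerKernel 0 = 1 := by
  have hlim : Tendsto fejerKernel (𝓝[≠] 0) (𝓝 (fejerKernel 0)) :=
    (continuous_fejerKernel.tendsto 0).mono_left nhdsWithin_le_nhds
  have hi : ∀ a b : ℝ, IntervalIntegrable (fun t => 1 - |t|) volume a b :=
    fun a b => Continuous.intervalIntegrable (by fun_prop) _ _
  have hpos : ∫ t in (0 : ℝ)..1, (1 - |t|) = 1 / 2 := by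
    have : ∫ t in (0 : ℝ)..1, (1 - |t|) = ∫ t in (0 : ℝ)..1, (1 - t) := by
      refine intervalIntegral.integral_congr fun t ht => ?_
      rw [Set.uIcc_of_le zero_le_one] at ht
      simp only [abs_of_nonneg ht.1]
    rw [this, intervalIntegral.integral_sub (by simp) (by simp)]
    norm_num
  have hneg : ∫ t in (-1 : ℝ)..0, (1 - |t|) = 1 / 2 := by
    have := intervalIntegral.integral_comp_neg (a := 0) (b := 1) (fun t : ℝ => 1 - |t|)
    simp only [abs_neg, neg_zero] at this
    rw [← this, hpos]
  simp only [fejerKernel, mul_zero, Real.cos_zero, mul_one]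
  rw [← intervalIntegral.integral_add_adjacent_intervals (hi _ 0) (hi 0 _), hneg, hpos]
  norm_num

lemma fejerKernel_nonneg (v : ℝ) : 0 ≤ fejerKernel v := by
  rcases eq_or_ne v 0 with rfl | hv
  · simp [fejerKernel_zero]
  · rw [fejerKernel_of_ne_zero hv]
    have := Real.cos_le_one v
    exact div_nonneg (by linarith) (sq_nonneg v)

lemma fejerKernel_le (v : ℝ) : fejerKernel v ≤ 8 * (1 + v ^ 2)⁻¹ := by
  rcases eq_or_ne v 0 with rfl | hv
  · simp [fejerKernel_zero]
  · rw [fejerKernel_of_ne_zero hv, ← div_eq_mul_inv, div_le_div_iff₀ (by positivity) (by positivity)]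
    have h1 := @Real.one_sub_sq_div_two_le_cos v
    have h2 := Real.neg_one_le_cos v
    nlinarith [sq_nonneg v, mul_nonneg (sq_nonneg v) (sq_nonneg v)]

lemma integrable_fejerKernel : Integrable fejerKernel := by
  refine (integrable_inv_one_add_sq.const_mul 8).mono'
    continuous_fejerKernel.aestronglyMeasurable (Eventually.of_forall fun v => ?_)
  rw [Real.norm_of_nonneg (fejerKernel_nonneg v)]
  exact fejerKernel_le v

lemma integral_fejerKernel_pos : 0 < ∫ v, fejerKernel v :=
  integral_pos_of_integrable_nonneg_nonzero (x := 0) continuous_fejerKernel integrable_fejerKernel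
    fejerKernel_nonneg (by simp [fejerKernel_zero])

lemma integral_triangle_mul_cexp (v : ℝ) :
    ∫ t in (-1 : ℝ)..1, ((1 - |t| : ℝ) : ℂ) * Complex.exp (Complex.I * (t * v)) =
      fejerKernel v := by
  have hodd : ∫ t in (-1 : ℝ)..1, (1 - |t|) * Real.sin (t * v) = 0 := by
    have := intervalIntegral.integral_comp_neg (a := -1) (b := 1)
      (fun t : ℝ => (1 - |t|) * Real.sin (t * v))
    simp only [abs_neg, neg_mul, Real.sin_neg, neg_neg, mul_neg,
      intervalIntegral.integral_neg] at this
    linarith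
  have hcongr : ∀ t : ℝ, ((1 - |t| : ℝ) : ℂ) * Complex.exp (Complex.I * (t * v)) =
      (((1 - |t|) * Real.cos (t * v) : ℝ) : ℂ) +
        Complex.I * (((1 - |t|) * Real.sin (t * v) : ℝ) : ℂ) := by
    intro t
    rw [mul_comm Complex.I, Complex.exp_mul_I]
    push_cast
    ring
  simp_rw [hcongr]
  rw [intervalIntegral.integral_add (Continuous.intervalIntegrable (by fun_prop) _ _)
    (Continuous.intervalIntegrable (by fun_prop) _ _), intervalIntegral.integral_const_mul,
    intervalIntegral.integral_ofReal, intervalIntegral.integral_ofReal, hodd]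
  simp [fejerKernel]

lemma eventually_not_forall_le_of_tendsto_fejer {g : ℝ → ℝ} (hg : Measurable g) {M : ℝ}
    (hM : ∀ u, |g u| ≤ M)
    (hlim : ∀ l : ℝ, 0 < l → Tendsto (fun y => ∫ v, g (y - v / l) * fejerKernel v) atTop (𝓝 0))
    {δ h : ℝ} (hδ : 0 < δ) (hh : 0 < h) :
    ∀ᶠ y in atTop, ¬ ∀ u ∈ Set.Icc (y - h) (y + h), δ ≤ g u := by
  have hM0 : 0 ≤ M := (abs_nonneg _).trans (hM 0)
  set c := ∫ v, fejerKernel v with hc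
  have hcpos : 0 < c := integral_fejerKernel_pos
  have htail : Tendsto (fun R : ℝ => ∫ v in (-R)..R, fejerKernel v) atTop (𝓝 c) :=
    intervalIntegral_tendsto_integral integrable_fejerKernel tendsto_neg_atTop_atBot tendsto_id
  have hδM : 0 < M + δ := by linarith
  have hsmall : c - δ * c / (2 * (M + δ)) < c := by
    have : 0 < δ * c / (2 * (M + δ)) := by positivity
    linarith
  obtain ⟨R, hR, hR0⟩ := ((htail.eventually_const_lt hsmall).and (eventually_gt_atTop 0)).exists
  have hl : 0 < R / h := by positivity
  filter_upwards [(hlim (R / h) hl).eventually_lt_const (show 0 < δ * c / 2 by positivity)]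
    with y hy hall
  refine absurd hy (not_lt.mpr ?_)
  have hind : Integrable ((Set.Ioc (-R) R).indicator fejerKernel) :=
    integrable_fejerKernel.indicator measurableSet_Ioc
  have hlow : ∫ v, (-M * fejerKernel v +
      (M + δ) * (Set.Ioc (-R) R).indicator fejerKernel v) ≤
      ∫ v, g (y - v / (R / h)) * fejerKernel v := by
    refine integral_mono ((integrable_fejerKernel.const_mul _).add (hind.const_mul _)) ?_ ?_
    · refine (integrable_fejerKernel.const_mul M).mono' ?_ (Eventually.of_forall fun v => ?_)
      · exact ((hg.comp (by fun_prop)).mul continuous_fejerKernel.measurable).aestronglyMeasurable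
      · rw [norm_mul, Real.norm_of_nonneg (fejerKernel_nonneg v)]
        exact mul_le_mul_of_nonneg_right (hM _) (fejerKernel_nonneg v)
    · intro v
      have hk := fejerKernel_nonneg v
      by_cases hv : v ∈ Set.Ioc (-R) R
      · simp only [Set.indicator_of_mem hv]
        have hmem : y - v / (R / h) ∈ Set.Icc (y - h) (y + h) := by
          have h1 : v / (R / h) = v / R * h := by field_simp
          have h2 : v / R ≤ 1 := by rw [div_le_one hR0]; exact hv.2
          have h3 : -1 ≤ v / R := by rw [le_div_iff₀ hR0]; linarith [hv.1]
          rw [h1]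
          constructor <;> nlinarith
        nlinarith [mul_le_mul_of_nonneg_right (hall _ hmem) hk]
      · simp only [Set.indicator_of_notMem hv]
        nlinarith [mul_le_mul_of_nonneg_right (neg_le_of_abs_le (hM (y - v / (R / h)))) hk]
  refine le_trans ?_ hlow
  rw [integral_add (integrable_fejerKernel.const_mul _) (hind.const_mul _), integral_const_mul,
    integral_const_mul, integral_indicator measurableSet_Ioc,
    ← intervalIntegral.integral_of_le (by linarith), ← hc]
  have h1 : (M + δ) * (c - δ * c / (2 * (M + δ))) ≤ (M + δ) * ∫ v in (-R)..R, fejerKernel v :=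
    mul_le_mul_of_nonneg_left hR.le hδM.le
  have h2 : (M + δ) * (c - δ * c / (2 * (M + δ))) = (M + δ) * c - δ * c / 2 := by
    field_simp
  linarith

/-- A Tauberian theorem for bounded functions `f` on the half line such that `eᵘ (f u + c)` is
nonnegative and monotone. -/
lemma tendsto_zero_of_tendsto_fejer {f : ℝ → ℝ} (hf : Measurable f) {M c : ℝ} (hc : 0 < c)
    (hM : ∀ u, |f u| ≤ M)
    (hpos : ∀ u, 0 < u → 0 ≤ f u + c)
    (hmono : ∀ u v, 0 < u → u ≤ v → Real.exp u * (f u + c) ≤ Real.exp v * (f v + c))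
    (hlim : ∀ l : ℝ, 0 < l → Tendsto (fun y => ∫ v, f (y - v / l) * fejerKernel v) atTop (𝓝 0)) :
    Tendsto f atTop (𝓝 0) := by
  have hdecay : ∀ u v, 0 < u → u ≤ v → (f u + c) * Real.exp (u - v) ≤ f v + c := by
    intro u v hu huv
    have := hmono u v hu huv
    rw [Real.exp_sub, mul_div_assoc', div_le_iff₀ (Real.exp_pos v)]
    linarith
  have hupper : ∀ δ : ℝ, 0 < δ → ∀ᶠ y in atTop, f y < δ := by
    intro δ hδ
    set h := Real.log ((δ + c) / (δ / 2 + c)) / 2 with hh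
    have hratio : 1 < (δ + c) / (δ / 2 + c) := by
      rw [one_lt_div (by positivity)]; linarith
    have hhpos : 0 < h := half_pos (Real.log_pos hratio)
    have hexp : (δ + c) * Real.exp (-(2 * h)) = δ / 2 + c := by
      rw [hh, mul_div_cancel₀ _ two_ne_zero, Real.exp_neg, Real.exp_log (by positivity)]
      field_simp
    have hev := eventually_not_forall_le_of_tendsto_fejer hf hM hlim (half_pos hδ) hhpos
    filter_upwards [(tendsto_atTop_add_const_right atTop h tendsto_id).eventually hev,
      eventually_gt_atTop 0] with y hy hy0
    by_contra! hcon
    refine hy fun u hu => ?_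
    simp only [id] at hu
    have h1 := hdecay y u hy0 (by linarith [hu.1])
    have h2 : Real.exp (-(2 * h)) ≤ Real.exp (y - u) := Real.exp_le_exp.mpr (by linarith [hu.2])
    have h3 : (δ + c) * Real.exp (-(2 * h)) ≤ (f y + c) * Real.exp (y - u) :=
      mul_le_mul (by linarith) h2 (Real.exp_pos _).le (by linarith)
    linarith
  have hlower : ∀ δ : ℝ, 0 < δ → δ < c → ∀ᶠ y in atTop, -δ < f y := by
    intro δ hδ hδc
    have hcδ : 0 < c - δ := by linarith
    set h := Real.log ((c - δ / 2) / (c - δ)) / 2 with hh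
    have hratio : 1 < (c - δ / 2) / (c - δ) := by
      rw [one_lt_div (by positivity)]; linarith
    have hhpos : 0 < h := half_pos (Real.log_pos hratio)
    have hexp : (c - δ / 2) * Real.exp (-(2 * h)) = c - δ := by
      rw [hh, mul_div_cancel₀ _ two_ne_zero, Real.exp_neg, Real.exp_log (by linarith)]
      rw [inv_div, mul_div_cancel₀ _ (by linarith)]
    have hlim' : ∀ l : ℝ, 0 < l →
        Tendsto (fun y => ∫ v, (fun u => - f u) (y - v / l) * fejerKernel v) atTop (𝓝 0) := by
      intro l hl
      simpa only [neg_mul, integral_neg, neg_zero] using (hlim l hl).neg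
    have hev := eventually_not_forall_le_of_tendsto_fejer hf.neg (M := M) (fun u => by simpa using hM u)
      hlim' (half_pos hδ) hhpos
    filter_upwards [(tendsto_atTop_add_const_right atTop (-h) tendsto_id).eventually hev,
      eventually_gt_atTop (2 * h)] with y hy hy0
    by_contra! hcon
    refine hy fun u hu => ?_
    simp only [id] at hu
    have h1 := hdecay u y (by linarith [hu.1]) (by linarith [hu.2])
    have h2 : Real.exp (-(2 * h)) ≤ Real.exp (u - y) := Real.exp_le_exp.mpr (by linarith [hu.1])
    have h3 : (f u + c) * Real.exp (-(2 * h)) ≤ (f u + c) * Real.exp (u - y) :=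
      mul_le_mul_of_nonneg_left h2 (hpos u (by linarith [hu.1]))
    have h4 : (f u + c) * Real.exp (-(2 * h)) ≤ (c - δ / 2) * Real.exp (-(2 * h)) := by linarith
    have h5 := le_of_mul_le_mul_right h4 (Real.exp_pos _)
    simp only [Pi.neg_apply]
    linarith
  rw [tendsto_order]
  refine ⟨fun a ha => ?_, fun a ha => hupper a ha⟩
  have hmin : 0 < min (-a) (c / 2) := lt_min (by linarith) (by linarith)
  filter_upwards [hlower _ hmin ((min_le_right _ _).trans_lt (by linarith))] with y hy
  have := min_le_left (-a) (c / 2)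
  linarith

lemma integral_triangle_mul_laplace {f : ℝ → ℝ} (hf : Measurable f) {M : ℝ}
    (hM : ∀ u, |f u| ≤ M) {G : ℂ → ℂ}
    (hLap : ∀ s : ℂ, 0 < s.re → ∫ u in Set.Ioi (0 : ℝ), (f u : ℂ) * Complex.exp (-s * u) = G s)
    {l ε : ℝ} (hε : 0 < ε) (y : ℝ) :
    ∫ t in (-1 : ℝ)..1, ((1 - |t| : ℝ) : ℂ) * (G (ε + l * t * Complex.I) *
      Complex.exp (Complex.I * (t * (l * y)))) =
    ∫ u in Set.Ioi (0 : ℝ), ((f u * Real.exp (-ε * u) * fejerKernel (l * (y - u)) : ℝ) : ℂ) := by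
  have hM0 : 0 ≤ M := (abs_nonneg _).trans (hM 0)
  set F : ℝ → ℝ → ℂ := fun t u => ((1 - |t| : ℝ) : ℂ) *
    ((f u : ℂ) * Complex.exp (-(ε + l * t * Complex.I) * u) *
      Complex.exp (Complex.I * (t * (l * y)))) with hF
  have hFmeas : Measurable (Function.uncurry F) := by
    simp only [hF]
    have : Measurable fun p : ℝ × ℝ => ((f p.2 : ℝ) : ℂ) :=
      Complex.measurable_ofReal.comp (hf.comp measurable_snd)
    unfold Function.uncurry
    refine Measurable.mul ?_ ((this.mul ?_).mul ?_)
    · exact Continuous.measurable (by fun_prop)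
    · exact Continuous.measurable (by fun_prop)
    · exact Continuous.measurable (by fun_prop)
  have hFnorm : ∀ t ∈ Set.Ioc (-1 : ℝ) 1, ∀ u, ‖F t u‖ ≤ 1 * (M * Real.exp (-ε * u)) := by
    intro t ht u
    simp only [hF, norm_mul, Complex.norm_exp, Complex.norm_real]
    have h1 : ‖(1 - |t| : ℝ)‖ ≤ 1 := by
      rw [Real.norm_eq_abs, abs_le]
      have := abs_le.mpr ⟨ht.1.le, ht.2⟩
      constructor <;> linarith [abs_nonneg t]
    have h2 : (-(ε + l * t * Complex.I) * u : ℂ).re = -ε * u := by simp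
    have h3 : (Complex.I * (t * (l * y)) : ℂ).re = 0 := by simp
    rw [h2, h3, Real.exp_zero, mul_one]
    gcongr
    exact hM u
  have hint : Integrable (Function.uncurry F)
      ((volume.restrict (Set.Ioc (-1 : ℝ) 1)).prod (volume.restrict (Set.Ioi (0 : ℝ)))) := by
    have hb : Integrable (fun z : ℝ × ℝ => (1 : ℝ) * (M * Real.exp (-ε * z.2)))
        ((volume.restrict (Set.Ioc (-1 : ℝ) 1)).prod (volume.restrict (Set.Ioi (0 : ℝ)))) :=
      Integrable.mul_prod (f := fun _ => (1 : ℝ)) (g := fun u => M * Real.exp (-ε * u))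
        (integrable_const _) ((exp_neg_integrableOn_Ioi 0 hε).const_mul M)
    refine hb.mono' hFmeas.aestronglyMeasurable ?_
    rw [Measure.prod_restrict]
    filter_upwards [ae_restrict_mem (measurableSet_Ioc.prod measurableSet_Ioi)] with z hz
    exact hFnorm z.1 hz.1 z.2
  rw [intervalIntegral.integral_of_le (by norm_num)]
  have hleft : ∀ t : ℝ, ((1 - |t| : ℝ) : ℂ) * (G (ε + l * t * Complex.I) *
      Complex.exp (Complex.I * (t * (l * y)))) = ∫ u in Set.Ioi (0 : ℝ), F t u := by
    intro t
    simp only [hF]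
    rw [integral_const_mul, integral_mul_const, hLap _ (by simpa using hε)]
  simp_rw [hleft]
  rw [integral_integral_swap hint]
  refine integral_congr_ae (Eventually.of_forall fun u => ?_)
  simp only
  rw [← intervalIntegral.integral_of_le (by norm_num), Complex.ofReal_mul,
    ← integral_triangle_mul_cexp, ← intervalIntegral.integral_const_mul]
  refine intervalIntegral.integral_congr fun t _ => ?_
  simp only [hF]
  have : Complex.exp (-(ε + l * t * Complex.I) * u) * Complex.exp (Complex.I * (t * (l * y))) =
      Complex.exp (-ε * u) * Complex.exp (Complex.I * (t * (l * (y - u) : ℝ))) := by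
    rw [← Complex.exp_add, ← Complex.exp_add]
    push_cast
    ring_nf
  push_cast at this ⊢
  linear_combination (1 - ((|t| : ℝ) : ℂ)) * (f u : ℂ) * this

lemma integral_triangle_mul_boundary {f : ℝ → ℝ} (hf : Measurable f) {M : ℝ}
    (hM : ∀ u, |f u| ≤ M) {G : ℂ → ℂ} (hG : ContinuousOn G {s | 0 ≤ s.re})
    (hLap : ∀ s : ℂ, 0 < s.re → ∫ u in Set.Ioi (0 : ℝ), (f u : ℂ) * Complex.exp (-s * u) = G s)
    {l : ℝ} (hl : 0 < l) (y : ℝ) :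
    ∫ t in (-1 : ℝ)..1, ((1 - |t| : ℝ) : ℂ) * (G (l * t * Complex.I) *
      Complex.exp (Complex.I * (t * (l * y)))) =
    ∫ u in Set.Ioi (0 : ℝ), ((f u * fejerKernel (l * (y - u)) : ℝ) : ℂ) := by
  have hM0 : 0 ≤ M := (abs_nonneg _).trans (hM 0)
  set S : Set (ℝ × ℝ) := Set.Icc 0 1 ×ˢ Set.Icc (-1) 1 with hS
  have hGc : ContinuousOn (fun p : ℝ × ℝ => G (p.1 + l * p.2 * Complex.I)) S := by
    refine hG.comp (Continuous.continuousOn (by fun_prop)) fun p hp => ?_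
    simpa using hp.1.1
  obtain ⟨B, hB⟩ := (isCompact_Icc.prod isCompact_Icc).exists_bound_of_continuousOn hGc
  have hev : ∀ᶠ ε : ℝ in 𝓝[>] 0, ε ∈ Set.Ioc (0 : ℝ) 1 :=
    Ioc_mem_nhdsGT zero_lt_one
  have hL : Tendsto (fun ε : ℝ => ∫ t in (-1 : ℝ)..1, ((1 - |t| : ℝ) : ℂ) *
      (G (ε + l * t * Complex.I) * Complex.exp (Complex.I * (t * (l * y))))) (𝓝[>] 0)
      (𝓝 (∫ t in (-1 : ℝ)..1, ((1 - |t| : ℝ) : ℂ) * (G (l * t * Complex.I) *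
        Complex.exp (Complex.I * (t * (l * y)))))) := by
    refine intervalIntegral.tendsto_integral_filter_of_dominated_convergence (fun _ => B) ?_ ?_
      (by simp) ?_
    · filter_upwards [hev] with ε hε
      refine ContinuousOn.aestronglyMeasurable ?_ measurableSet_uIoc
      refine ContinuousOn.mul (Continuous.continuousOn (by fun_prop))
        (ContinuousOn.mul ?_ (Continuous.continuousOn (by fun_prop)))
      refine hG.comp (Continuous.continuousOn (by fun_prop)) fun t _ => ?_
      simpa using hε.1.le
    · filter_upwards [hev] with ε hε
      refine Eventually.of_forall fun t ht => ?_
      rw [Set.uIoc_of_le (by norm_num)] at ht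
      have h1 : ‖(1 - |t| : ℝ)‖ ≤ 1 := by
        rw [Real.norm_eq_abs, abs_le]
        have := abs_le.mpr ⟨ht.1.le, ht.2⟩
        constructor <;> linarith [abs_nonneg t]
      have h2 := hB (ε, t) ⟨⟨hε.1.le, hε.2⟩, ht.1.le, ht.2⟩
      have h3 : (Complex.I * (t * (l * y)) : ℂ).re = 0 := by simp
      rw [norm_mul, norm_mul, Complex.norm_exp, h3, Real.exp_zero, mul_one, Complex.norm_real]
      calc _ ≤ 1 * B := mul_le_mul h1 h2 (norm_nonneg _) zero_le_one
        _ = B := one_mul B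
    · refine Eventually.of_forall fun t ht => ?_
      refine (Tendsto.mul_const _ ?_).const_mul _
      have hw : ContinuousWithinAt G {s | 0 ≤ s.re} (l * t * Complex.I) := hG _ (by simp)
      refine hw.tendsto.comp (tendsto_nhdsWithin_iff.mpr ⟨?_, ?_⟩)
      · have : Tendsto (fun ε : ℝ => (ε : ℂ) + l * t * Complex.I) (𝓝 0)
            (𝓝 (((0 : ℝ) : ℂ) + l * t * Complex.I)) := Continuous.tendsto (by fun_prop) 0
        simpa using this.mono_left nhdsWithin_le_nhds
      · filter_upwards [hev] with ε hε
        simpa using hε.1.le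
  have hkint : Integrable fun u : ℝ => fejerKernel (l * (y - u)) :=
    (integrable_fejerKernel.comp_mul_left' hl.ne').comp_sub_left y
  have hR : Tendsto (fun ε : ℝ => ∫ u in Set.Ioi (0 : ℝ),
      ((f u * Real.exp (-ε * u) * fejerKernel (l * (y - u)) : ℝ) : ℂ)) (𝓝[>] 0)
      (𝓝 (∫ u in Set.Ioi (0 : ℝ), ((f u * fejerKernel (l * (y - u)) : ℝ) : ℂ))) := by
    refine tendsto_integral_filter_of_dominated_convergence
      (fun u => M * fejerKernel (l * (y - u))) ?_ ?_ (hkint.const_mul M).integrableOn ?_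
    · refine Eventually.of_forall fun ε => Measurable.aestronglyMeasurable ?_
      refine Complex.measurable_ofReal.comp ((hf.mul (by fun_prop)).mul ?_)
      exact (continuous_fejerKernel.comp (by fun_prop)).measurable
    · filter_upwards [hev] with ε hε
      filter_upwards [ae_restrict_mem measurableSet_Ioi] with u hu
      rw [Complex.norm_real, norm_mul, norm_mul, Real.norm_of_nonneg (fejerKernel_nonneg _),
        Real.norm_of_nonneg (Real.exp_pos _).le]
      have : Real.exp (-ε * u) ≤ 1 := by
        rw [Real.exp_le_one_iff]
        have := mul_pos hε.1 (Set.mem_Ioi.mp hu)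
        linarith
      refine mul_le_mul_of_nonneg_right ?_ (fejerKernel_nonneg _)
      calc ‖f u‖ * Real.exp (-ε * u) ≤ M * 1 :=
            mul_le_mul (hM u) this (Real.exp_pos _).le hM0
        _ = M := mul_one M
    · refine Eventually.of_forall fun u => ?_
      have : Tendsto (fun ε : ℝ => ((f u * Real.exp (-ε * u) * fejerKernel (l * (y - u)) : ℝ) : ℂ))
          (𝓝 0) (𝓝 ((f u * Real.exp (-0 * u) * fejerKernel (l * (y - u)) : ℝ) : ℂ)) :=
        Continuous.tendsto (by fun_prop) 0
      simpa using this.mono_left nhdsWithin_le_nhds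
  refine tendsto_nhds_unique hL (hR.congr' ?_)
  filter_upwards [hev] with ε hε
  exact (integral_triangle_mul_laplace hf hM hLap hε.1 y).symm

lemma tendsto_fejer_of_laplace {f : ℝ → ℝ} (hf : Measurable f) {M : ℝ}
    (hM : ∀ u, |f u| ≤ M) (hf0 : ∀ u ≤ 0, f u = 0) {G : ℂ → ℂ}
    (hG : ContinuousOn G {s | 0 ≤ s.re})
    (hLap : ∀ s : ℂ, 0 < s.re → ∫ u in Set.Ioi (0 : ℝ), (f u : ℂ) * Complex.exp (-s * u) = G s)
    {l : ℝ} (hl : 0 < l) :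
    Tendsto (fun y => ∫ v, f (y - v / l) * fejerKernel v) atTop (𝓝 0) := by
  set Φ : ℝ → ℂ := (Set.Ioc (-1 : ℝ) 1).indicator
    fun t => ((1 - |t| : ℝ) : ℂ) * G (l * t * Complex.I) with hΦ
  have hRL := Real.tendsto_integral_exp_smul_cocompact Φ
  have hw : Tendsto (fun y : ℝ => -(l / (2 * Real.pi)) * y) atTop (cocompact ℝ) := by
    have : Tendsto (fun y : ℝ => -(l / (2 * Real.pi)) * y) atTop atBot :=
      tendsto_id.const_mul_atTop_of_neg (by have := Real.pi_pos; simp; positivity)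
    exact this.mono_right atBot_le_cocompact
  have hC := (hRL.comp hw).const_mul (l : ℂ)
  rw [mul_zero] at hC
  have heq : ∀ y : ℝ, (l : ℂ) * ∫ v : ℝ, Real.fourierChar (-(v * (-(l / (2 * Real.pi)) * y))) • Φ v =
      ((∫ v, f (y - v / l) * fejerKernel v : ℝ) : ℂ) := by
    intro y
    have h1 : ∫ v : ℝ, Real.fourierChar (-(v * (-(l / (2 * Real.pi)) * y))) • Φ v =
        ∫ t in (-1 : ℝ)..1, ((1 - |t| : ℝ) : ℂ) * (G (l * t * Complex.I) *
          Complex.exp (Complex.I * (t * (l * y)))) := by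
      rw [intervalIntegral.integral_of_le (by norm_num), ← integral_indicator measurableSet_Ioc]
      refine integral_congr_ae (Eventually.of_forall fun t => ?_)
      simp only [hΦ, Set.indicator_apply]
      split_ifs
      · rw [Circle.smul_def, Real.fourierChar_apply, smul_eq_mul]
        have : (((2 * Real.pi * (-(t * (-(l / (2 * Real.pi)) * y))) : ℝ) : ℂ) * Complex.I) =
            Complex.I * (t * (l * y)) := by
          have hr : 2 * Real.pi * (-(t * (-(l / (2 * Real.pi)) * y))) = t * (l * y) := by
            have := Real.pi_ne_zero
            field_simp
          rw [hr]
          push_cast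
          ring
        rw [this]
        ring
      · simp
    rw [h1, integral_triangle_mul_boundary hf hM hG hLap hl, integral_complex_ofReal]
    have h2 : ∫ u in Set.Ioi (0 : ℝ), f u * fejerKernel (l * (y - u)) =
        ∫ u, f u * fejerKernel (l * (y - u)) :=
      setIntegral_eq_integral_of_forall_compl_eq_zero fun u hu => by
        rw [hf0 u (not_lt.mp hu), zero_mul]
    have h3 : ∫ u, f u * fejerKernel (l * (y - u)) =
        ∫ w, f (y - w) * fejerKernel (l * w) := by
      rw [← integral_sub_left_eq_self _ volume y]
      simp
    have h4 : ∫ w, f (y - w) * fejerKernel (l * w) =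
        |l⁻¹| • ∫ v, f (y - v / l) * fejerKernel v := by
      rw [← Measure.integral_comp_mul_left (fun v => f (y - v / l) * fejerKernel v) l]
      refine integral_congr_ae (Eventually.of_forall fun w => ?_)
      simp only
      rw [mul_div_cancel_left₀ _ hl.ne']
    rw [h2]
    rw [h3, h4, abs_of_pos (inv_pos.mpr hl), smul_eq_mul]
    push_cast
    rw [mul_inv_cancel_left₀ (by exact_mod_cast hl.ne')]
  have hC' := hC.congr heq
  exact_mod_cast (Complex.continuous_re.tendsto 0).comp hC'

open ArithmeticFunction.vonMangoldt in
/-- The Chebyshev function `ψ` of the residue class `a`. -/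
noncomputable def psiClass {q : ℕ} (a : ZMod q) (x : ℝ) : ℝ :=
  ∑ k ∈ Finset.Icc 1 ⌊x⌋₊, residueClass a k

section psiClass

variable {q : ℕ} (a : ZMod q)

open ArithmeticFunction.vonMangoldt

lemma psiClass_nonneg (x : ℝ) : 0 ≤ psiClass a x :=
  Finset.sum_nonneg fun _ _ => residueClass_nonneg a _

lemma psiClass_mono : Monotone (psiClass a) := fun _ _ hxy =>
  Finset.sum_le_sum_of_subset_of_nonneg (Finset.Icc_subset_Icc_right (Nat.floor_mono hxy))
    fun _ _ _ => residueClass_nonneg a _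

lemma psiClass_le_psi (x : ℝ) : psiClass a x ≤ Chebyshev.psi x := by
  rw [psiClass, Chebyshev.psi]
  exact Finset.sum_le_sum fun _ _ => residueClass_le a _

lemma psiClass_le {x : ℝ} (hx : 0 ≤ x) : psiClass a x ≤ (Real.log 4 + 4) * x :=
  (psiClass_le_psi a x).trans (Chebyshev.psi_le_const_mul_self hx)

variable {a} [NeZero q]

lemma integral_psiClass_exp (ha : IsUnit a) {s : ℂ} (hs : 0 < s.re) :
    ∫ u in Set.Ioi (0 : ℝ), ((Real.exp (-u) * psiClass a (Real.exp u) : ℝ) : ℂ) *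
      Complex.exp (-s * u) =
    (LFunctionResidueClassAux a (s + 1) + (q.totient : ℂ)⁻¹ / s) / (s + 1) := by
  have hs1 : (1 : ℝ) < (s + 1).re := by simpa using hs
  have hne : s + 1 ≠ 0 := fun h => by rw [h] at hs1; simp at hs1; linarith
  have hO : (fun n : ℕ => ∑ k ∈ Finset.Icc 1 n, residueClass a k) =O[atTop]
      fun n : ℕ => (n : ℝ) ^ (1 : ℝ) := by
    refine Asymptotics.IsBigO.of_bound (Real.log 4 + 4) (Eventually.of_forall fun n => ?_)
    have := psiClass_le a (Nat.cast_nonneg (α := ℝ) n)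
    rw [psiClass, Nat.floor_natCast] at this
    rw [Real.norm_of_nonneg (Finset.sum_nonneg fun _ _ => residueClass_nonneg a _), Real.rpow_one,
      Real.norm_of_nonneg (Nat.cast_nonneg n)]
    exact this
  have hL := LSeries_eq_mul_integral_of_nonneg (residueClass a) zero_le_one hs1 hO
    (residueClass_nonneg a)
  have hAux := eqOn_LFunctionResidueClassAux ha (Set.mem_ofPred.mpr hs1)
  simp only [add_sub_cancel_right] at hAux
  rw [hAux, sub_add_cancel, hL, mul_div_cancel_left₀ _ hne]
  have himage : Real.exp '' Set.Ioi 0 = Set.Ioi 1 := by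
    simp
  rw [← himage, integral_image_eq_integral_abs_deriv_smul measurableSet_Ioi
    (fun x _ => (Real.hasDerivAt_exp x).hasDerivWithinAt) Real.exp_injective.injOn]
  refine integral_congr_ae (Eventually.of_forall fun u => ?_)
  simp only [psiClass, abs_of_pos (Real.exp_pos u), Complex.real_smul]
  rw [Complex.cpow_def_of_ne_zero (by exact_mod_cast (Real.exp_pos u).ne'),
    ← Complex.ofReal_log (Real.exp_pos u).le, Real.log_exp]
  push_cast
  have : Complex.exp (-u) * Complex.exp (-s * u) =
      Complex.exp u * Complex.exp (u * -(s + 1 + 1)) := by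
    rw [← Complex.exp_add, ← Complex.exp_add]
    ring_nf
  linear_combination (∑ k ∈ Finset.Icc 1 ⌊Real.exp u⌋₊, (residueClass a k : ℂ)) * this

/-- The prime number theorem in arithmetic progressions. -/
theorem tendsto_psiClass_div (ha : IsUnit a) :
    Tendsto (fun x => psiClass a x / x) atTop (𝓝 (q.totient : ℝ)⁻¹) := by
  set c : ℝ := (q.totient : ℝ)⁻¹ with hc
  have hcpos : 0 < c := inv_pos.mpr (by exact_mod_cast q.totient_pos.mpr (NeZero.pos q))
  set f : ℝ → ℝ := fun u => if u ≤ 0 then 0 else Real.exp (-u) * psiClass a (Real.exp u) - c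
    with hf
  have hfpos : ∀ u, 0 < u → f u = Real.exp (-u) * psiClass a (Real.exp u) - c := fun u hu => by
    simp [hf, not_le.mpr hu]
  have hmeas : Measurable fun u : ℝ => Real.exp (-u) * psiClass a (Real.exp u) :=
    (by fun_prop : Measurable fun u : ℝ => Real.exp (-u)).mul
      ((psiClass_mono a).measurable.comp Real.measurable_exp)
  have hfmeas : Measurable f :=
    Measurable.ite measurableSet_Iic measurable_const (hmeas.sub_const c)
  have hbound : ∀ u, 0 ≤ Real.exp (-u) * psiClass a (Real.exp u) ∧
      Real.exp (-u) * psiClass a (Real.exp u) ≤ Real.log 4 + 4 := by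
    intro u
    refine ⟨mul_nonneg (Real.exp_pos _).le (psiClass_nonneg a _), ?_⟩
    rw [Real.exp_neg, inv_mul_le_iff₀ (Real.exp_pos u), mul_comm]
    exact psiClass_le a (Real.exp_pos u).le
  have hlog : 0 ≤ Real.log 4 := Real.log_nonneg (by norm_num)
  have hM : ∀ u, |f u| ≤ Real.log 4 + 4 + c := by
    intro u
    have := hbound u
    rw [abs_le]
    by_cases hu : u ≤ 0
    · simp only [hf, if_pos hu]
      constructor <;> linarith
    · simp only [hf, if_neg hu]
      constructor <;> linarith
  have hLap : ∀ s : ℂ, 0 < s.re → ∫ u in Set.Ioi (0 : ℝ), (f u : ℂ) * Complex.exp (-s * u) =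
      (LFunctionResidueClassAux a (s + 1) - c) / (s + 1) := by
    intro s hs
    have hne : s ≠ 0 := fun h => by simp [h] at hs
    have hne1 : s + 1 ≠ 0 := fun h => by
      have := congrArg Complex.re h
      simp at this
      linarith
    have hs' : (-s).re < 0 := by simpa using hs
    have hexp := integrableOn_exp_mul_complex_Ioi hs' 0
    have hint : IntegrableOn (fun u : ℝ => ((Real.exp (-u) * psiClass a (Real.exp u) : ℝ) : ℂ) *
        Complex.exp (-s * u)) (Set.Ioi 0) := by
      refine Integrable.bdd_mul hexp (c := Real.log 4 + 4)
        (Complex.measurable_ofReal.comp hmeas).aestronglyMeasurable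
        (Eventually.of_forall fun u => ?_)
      rw [Complex.norm_real, Real.norm_of_nonneg (hbound u).1]
      exact (hbound u).2
    have h1 : ∫ u in Set.Ioi (0 : ℝ), (f u : ℂ) * Complex.exp (-s * u) =
        ∫ u in Set.Ioi (0 : ℝ), (((Real.exp (-u) * psiClass a (Real.exp u) : ℝ) : ℂ) *
          Complex.exp (-s * u) - c * Complex.exp (-s * u)) := by
      refine setIntegral_congr_fun measurableSet_Ioi fun u hu => ?_
      simp only [hfpos u hu]
      push_cast
      ring
    rw [h1, integral_sub hint (hexp.const_mul _), integral_psiClass_exp ha hs, integral_const_mul,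
      integral_exp_mul_complex_Ioi hs']
    simp only [Complex.ofReal_zero, mul_zero, Complex.exp_zero, hc]
    push_cast
    field_simp
    ring
  have hG : ContinuousOn (fun s : ℂ => (LFunctionResidueClassAux a (s + 1) - c) / (s + 1))
      {s | 0 ≤ s.re} := by
    refine ContinuousOn.div (ContinuousOn.sub ?_ continuousOn_const)
      (Continuous.continuousOn (by fun_prop)) fun s hs h => ?_
    · refine (continuousOn_LFunctionResidueClassAux a).comp
        (Continuous.continuousOn (by fun_prop)) fun s hs => ?_
      simpa using hs
    · have := congrArg Complex.re h
      simp at this hs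
      linarith
  have hlim : Tendsto f atTop (𝓝 0) := by
    refine tendsto_zero_of_tendsto_fejer hfmeas hcpos hM (fun u hu => ?_) (fun u v hu huv => ?_)
      fun l hl => tendsto_fejer_of_laplace hfmeas hM (fun u hu => by simp [hf, hu]) hG hLap hl
    · rw [hfpos u hu]
      linarith [(hbound u).1]
    · rw [hfpos u hu, hfpos v (by linarith), sub_add_cancel, sub_add_cancel, ← mul_assoc,
        ← mul_assoc, ← Real.exp_add, ← Real.exp_add, add_neg_cancel, add_neg_cancel, Real.exp_zero,
        one_mul, one_mul]
      exact psiClass_mono a (Real.exp_le_exp.mpr huv)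
  have := (hlim.comp Real.tendsto_log_atTop).add_const c
  rw [zero_add] at this
  refine this.congr' ?_
  filter_upwards [eventually_gt_atTop 1] with x hx
  simp only [Function.comp_apply]
  rw [hfpos _ (Real.log_pos hx), Real.exp_neg, Real.exp_log (by linarith)]
  ring

end psiClass

/-- The Chebyshev function `θ` of the primes congruent to `1` modulo `3`. -/
noncomputable def thetaOneModThree (x : ℝ) : ℝ :=
  ∑ p ∈ Finset.Icc 1 ⌊x⌋₊ with p.Prime ∧ p % 3 = 1, Real.log p

lemma tendsto_thetaOneModThree_div :
    Tendsto (fun x => thetaOneModThree x / x) atTop (𝓝 (1 / 2)) := by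
  have hψ := tendsto_psiClass_div (q := 3) (a := 1) isUnit_one
  have h2 : ((Nat.totient 3 : ℕ) : ℝ)⁻¹ = 1 / 2 := by
    rw [Nat.totient_prime Nat.prime_three]
    norm_num
  rw [h2] at hψ
  obtain ⟨C, hC⟩ := Chebyshev.psi_sub_theta_le_mul_sqrt
  have hmod : ∀ n : ℕ, ((n : ZMod 3) = 1) ↔ n % 3 = 1 := fun n => by
    have := ZMod.natCast_eq_natCast_iff n 1 3
    simpa [Nat.ModEq] using this
  have hdiff : ∀ x, 0 ≤ psiClass (1 : ZMod 3) x - thetaOneModThree x ∧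
      psiClass (1 : ZMod 3) x - thetaOneModThree x ≤ C * √x := by
    intro x
    have h1 : psiClass (1 : ZMod 3) x - thetaOneModThree x = ∑ k ∈ Finset.Icc 1 ⌊x⌋₊,
        (if k % 3 = 1 then (if k.Prime then 0 else ArithmeticFunction.vonMangoldt k) else 0) := by
      rw [psiClass, thetaOneModThree, Finset.sum_filter, ← Finset.sum_sub_distrib]
      refine Finset.sum_congr rfl fun k _ => ?_
      simp only [ArithmeticFunction.vonMangoldt.residueClass, Set.indicator_apply,
        Set.mem_ofPred_eq, hmod]
      by_cases hp : k.Prime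
      · by_cases hk : k % 3 = 1 <;> simp [hp, hk, ArithmeticFunction.vonMangoldt_apply_prime]
      · simp [hp]
    have h2 : Chebyshev.psi x - Chebyshev.theta x = ∑ k ∈ Finset.Icc 1 ⌊x⌋₊,
        (if k.Prime then 0 else ArithmeticFunction.vonMangoldt k) := by
      rw [Chebyshev.psi, Chebyshev.theta, Finset.sum_filter, ← Finset.sum_sub_distrib]
      refine Finset.sum_congr rfl fun k _ => ?_
      by_cases hp : k.Prime <;> simp [hp, ArithmeticFunction.vonMangoldt_apply_prime]
    have h3 : ∀ k : ℕ, 0 ≤ (if k.Prime then (0 : ℝ) else ArithmeticFunction.vonMangoldt k) :=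
      fun k => by
        split_ifs
        exacts [le_rfl, ArithmeticFunction.vonMangoldt_nonneg]
    constructor
    · rw [h1]
      refine Finset.sum_nonneg fun k _ => ?_
      split_ifs
      exacts [le_rfl, ArithmeticFunction.vonMangoldt_nonneg, le_rfl]
    · refine le_trans ?_ (hC x)
      rw [h1, h2]
      refine Finset.sum_le_sum fun k _ => ?_
      by_cases hk : k % 3 = 1
      · rw [if_pos hk]
      · rw [if_neg hk]
        exact h3 k
  have hsqrt : Tendsto (fun x : ℝ => C * (√x)⁻¹) atTop (𝓝 0) := by
    simpa using (tendsto_inv_atTop_zero.comp Real.tendsto_sqrt_atTop).const_mul C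
  have hzero : Tendsto (fun x => (psiClass (1 : ZMod 3) x - thetaOneModThree x) / x) atTop (𝓝 0) := by
    refine tendsto_of_tendsto_of_tendsto_of_le_of_le' tendsto_const_nhds hsqrt ?_ ?_
    · filter_upwards [eventually_gt_atTop 0] with x hx
      exact div_nonneg (hdiff x).1 hx.le
    · filter_upwards [eventually_gt_atTop 0] with x hx
      rw [div_le_iff₀ hx]
      refine (hdiff x).2.trans_eq ?_
      have hs : √x ≠ 0 := (Real.sqrt_pos.mpr hx).ne'
      field_simp
      rw [Real.sq_sqrt hx.le]
  have := hψ.sub hzero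
  rw [sub_zero] at this
  refine this.congr fun x => ?_
  ring

/-- A continuous approximation of `x ↦ x⁻¹ 1_{x ≥ β}`, vanishing for `x ≤ α`. -/
noncomputable def invRamp (α β x : ℝ) : ℝ := max 0 (min 1 ((x - α) / (β - α))) / max x α

section invRamp

variable {α β x : ℝ}

lemma continuous_invRamp (hα : 0 < α) : Continuous (invRamp α β) := by
  refine Continuous.div (by fun_prop) (by fun_prop) fun x => ?_
  exact (lt_max_of_lt_right hα).ne'

lemma mul_invRamp_nonneg (hx : 0 < x) : 0 ≤ x * invRamp α β x := by
  have : 0 < max x α := lt_max_of_lt_left hx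
  exact mul_nonneg hx.le (div_nonneg (le_max_left _ _) this.le)

lemma mul_invRamp_le_one (hx : 0 < x) : x * invRamp α β x ≤ 1 := by
  have h0 : 0 < max x α := lt_max_of_lt_left hx
  rw [invRamp, mul_div_assoc', div_le_one h0]
  have h1 : max 0 (min 1 ((x - α) / (β - α))) ≤ 1 := max_le zero_le_one (min_le_left _ _)
  nlinarith [le_max_left x α]

lemma mul_invRamp_of_le (hαβ : α < β) (hx : x ≤ α) : x * invRamp α β x = 0 := by
  have : (x - α) / (β - α) ≤ 0 := div_nonpos_of_nonpos_of_nonneg (by linarith) (by linarith)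
  rw [invRamp, max_eq_left ((min_le_right _ _).trans this), zero_div, mul_zero]

lemma mul_invRamp_of_ge (hα : 0 < α) (hαβ : α < β) (hx : β ≤ x) : x * invRamp α β x = 1 := by
  have h1 : 1 ≤ (x - α) / (β - α) := by rw [one_le_div (by linarith)]; linarith
  have hx0 : x ≠ 0 := by linarith
  rw [invRamp, min_eq_left h1, max_eq_right zero_le_one, max_eq_left (by linarith)]
  field_simp

end invRamp

section Karamata

variable {b ℓ : ℕ → ℝ} {c ρ : ℝ}

lemma summable_mul_exp_mul_bounded (hb : ∀ n, 0 ≤ b n)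
    (hsum : ∀ σ : ℝ, 0 < σ → Summable fun n => b n * Real.exp (-σ * ℓ n)) {σ : ℝ} (hσ : 0 < σ)
    {g : ℕ → ℝ} {B : ℝ} (hg : ∀ n, |g n| ≤ B) :
    Summable fun n => b n * Real.exp (-σ * ℓ n) * g n := by
  refine Summable.of_norm_bounded ((hsum σ hσ).mul_right B) fun n => ?_
  have h0 : 0 ≤ b n * Real.exp (-σ * ℓ n) := mul_nonneg (hb n) (Real.exp_pos _).le
  rw [norm_mul, Real.norm_of_nonneg h0]
  exact mul_le_mul_of_nonneg_left (hg n) h0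

lemma integrableOn_exp_neg_mul_rpow_mul (hρ : 0 < ρ) {h : ℝ → ℝ} (hh : Continuous h) :
    IntegrableOn (fun u : ℝ => Real.exp (-u) * u ^ (ρ - 1) * h (Real.exp (-u))) (Set.Ioi 0) := by
  obtain ⟨B, hB⟩ := isCompact_Icc.exists_bound_of_continuousOn (s := Set.Icc (0 : ℝ) 1)
    hh.continuousOn
  refine Integrable.mul_bdd (c := B) (Real.GammaIntegral_convergent hρ)
    (hh.comp (by fun_prop)).aestronglyMeasurable ?_
  filter_upwards [ae_restrict_mem measurableSet_Ioi] with u hu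
  refine hB _ ⟨(Real.exp_pos _).le, ?_⟩
  rw [Real.exp_le_one_iff]
  linarith [Set.mem_Ioi.mp hu]

lemma karamata_polynomial (hρ : 0 < ρ) (hb : ∀ n, 0 ≤ b n) (hℓ : ∀ n, 0 ≤ ℓ n)
    (hsum : ∀ σ : ℝ, 0 < σ → Summable fun n => b n * Real.exp (-σ * ℓ n))
    (hlim : Tendsto (fun σ : ℝ => σ ^ ρ * ∑' n, b n * Real.exp (-σ * ℓ n)) (𝓝[>] 0) (𝓝 c))
    (P : Polynomial ℝ) :
    Tendsto (fun σ : ℝ => σ ^ ρ * ∑' n, b n * Real.exp (-σ * ℓ n) * P.eval (Real.exp (-σ * ℓ n)))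
      (𝓝[>] 0) (𝓝 (c / Real.Gamma ρ *
        ∫ u in Set.Ioi (0 : ℝ), Real.exp (-u) * u ^ (ρ - 1) * P.eval (Real.exp (-u)))) := by
  have hbdd : ∀ (Q : Polynomial ℝ) (σ : ℝ), 0 < σ →
      Summable fun n => b n * Real.exp (-σ * ℓ n) * Q.eval (Real.exp (-σ * ℓ n)) := by
    intro Q σ hσ
    obtain ⟨B, hB⟩ := isCompact_Icc.exists_bound_of_continuousOn (s := Set.Icc (0 : ℝ) 1)
      Q.continuous.continuousOn
    refine summable_mul_exp_mul_bounded hb hsum hσ (B := B) fun n => hB _ ⟨(Real.exp_pos _).le, ?_⟩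
    rw [Real.exp_le_one_iff]
    nlinarith [mul_nonneg hσ.le (hℓ n)]
  induction P using Polynomial.induction_on' with
  | add P Q hP hQ =>
    refine ((hP.add hQ).congr' ?_).trans (le_of_eq ?_)
    · filter_upwards [self_mem_nhdsWithin] with σ hσ
      rw [← mul_add, ← (hbdd P σ hσ).tsum_add (hbdd Q σ hσ)]
      simp only [Polynomial.eval_add, mul_add]
    · rw [← mul_add, ← integral_add (integrableOn_exp_neg_mul_rpow_mul hρ P.continuous)
        (integrableOn_exp_neg_mul_rpow_mul hρ Q.continuous)]
      simp only [Polynomial.eval_add, mul_add]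
  | monomial k a =>
    have hk : (0 : ℝ) < k + 1 := by positivity
    have hscale : Tendsto (fun σ : ℝ => (k + 1) * σ) (𝓝[>] 0) (𝓝[>] 0) := by
      refine tendsto_nhdsWithin_iff.mpr ⟨?_, ?_⟩
      · have : Tendsto (fun σ : ℝ => ((k : ℝ) + 1) * σ) (𝓝 0) (𝓝 (((k : ℝ) + 1) * 0)) :=
          Continuous.tendsto (by fun_prop) 0
        rw [mul_zero] at this
        exact this.mono_left nhdsWithin_le_nhds
      · filter_upwards [self_mem_nhdsWithin] with σ hσ
        exact mul_pos hk hσ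
    refine (((hlim.comp hscale).const_mul (a * ((k : ℝ) + 1) ^ (-ρ))).congr' ?_).trans (le_of_eq ?_)
    · filter_upwards [self_mem_nhdsWithin] with σ hσ
      have hσ' : (0 : ℝ) < σ := hσ
      simp only [Function.comp_apply, Polynomial.eval_monomial]
      have hterm : ∀ n, b n * Real.exp (-σ * ℓ n) * (a * Real.exp (-σ * ℓ n) ^ k) =
          a * (b n * Real.exp (-((k + 1) * σ) * ℓ n)) := by
        intro n
        rw [← Real.exp_nat_mul]
        have : Real.exp (-((k + 1) * σ) * ℓ n) =
            Real.exp (-σ * ℓ n) * Real.exp (k * (-σ * ℓ n)) := by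
          rw [← Real.exp_add]
          ring_nf
        rw [this]
        ring
      simp_rw [hterm]
      rw [tsum_mul_left, Real.mul_rpow hk.le hσ'.le, Real.rpow_neg hk.le]
      have : ((k : ℝ) + 1) ^ ρ ≠ 0 := (Real.rpow_pos_of_pos hk ρ).ne'
      field_simp
    · have hI : ∫ u in Set.Ioi (0 : ℝ), Real.exp (-u) * u ^ (ρ - 1) *
          (Polynomial.monomial k a).eval (Real.exp (-u)) =
          a * ((1 / ((k : ℝ) + 1)) ^ ρ * Real.Gamma ρ) := by
        rw [← Real.integral_rpow_mul_exp_neg_mul_Ioi hρ hk, ← integral_const_mul]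
        refine integral_congr_ae (Eventually.of_forall fun u => ?_)
        simp only [Polynomial.eval_monomial]
        rw [← Real.exp_nat_mul]
        have : Real.exp (-((k + 1) * u)) = Real.exp (-u) * Real.exp (k * -u) := by
          rw [← Real.exp_add]
          ring_nf
        rw [this]
        ring
      rw [hI, one_div, Real.inv_rpow hk.le, ← Real.rpow_neg hk.le]
      have := (Real.Gamma_pos_of_pos hρ).ne'
      congr 1
      field_simp

lemma karamata_continuous (hρ : 0 < ρ) (hb : ∀ n, 0 ≤ b n) (hℓ : ∀ n, 0 ≤ ℓ n)
    (hsum : ∀ σ : ℝ, 0 < σ → Summable fun n => b n * Real.exp (-σ * ℓ n))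
    (hlim : Tendsto (fun σ : ℝ => σ ^ ρ * ∑' n, b n * Real.exp (-σ * ℓ n)) (𝓝[>] 0) (𝓝 c))
    {h : ℝ → ℝ} (hh : Continuous h) :
    Tendsto (fun σ : ℝ => σ ^ ρ * ∑' n, b n * Real.exp (-σ * ℓ n) * h (Real.exp (-σ * ℓ n)))
      (𝓝[>] 0) (𝓝 (c / Real.Gamma ρ *
        ∫ u in Set.Ioi (0 : ℝ), Real.exp (-u) * u ^ (ρ - 1) * h (Real.exp (-u)))) := by
  have hΓ := Real.Gamma_pos_of_pos hρ
  have hc : 0 ≤ c := by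
    refine ge_of_tendsto hlim ?_
    filter_upwards [self_mem_nhdsWithin] with σ hσ
    exact mul_nonneg (Real.rpow_nonneg (le_of_lt hσ) _)
      (tsum_nonneg fun n => mul_nonneg (hb n) (Real.exp_pos _).le)
  have hexp : ∀ σ : ℝ, 0 < σ → ∀ n, Real.exp (-σ * ℓ n) ∈ Set.Icc (0 : ℝ) 1 := by
    intro σ hσ n
    refine ⟨(Real.exp_pos _).le, ?_⟩
    rw [Real.exp_le_one_iff]
    nlinarith [mul_nonneg hσ.le (hℓ n)]
  have hbdd : ∀ g : ℝ → ℝ, Continuous g → ∀ σ : ℝ, 0 < σ →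
      Summable fun n => b n * Real.exp (-σ * ℓ n) * g (Real.exp (-σ * ℓ n)) := by
    intro g hg σ hσ
    obtain ⟨B, hB⟩ := isCompact_Icc.exists_bound_of_continuousOn (s := Set.Icc (0 : ℝ) 1)
      hg.continuousOn
    exact summable_mul_exp_mul_bounded hb hsum hσ (B := B) fun n => hB _ (hexp σ hσ n)
  rw [Metric.tendsto_nhds]
  intro ε hε
  set η := ε / (3 * (c + 1)) with hη
  have hη0 : 0 < η := by positivity
  have hηc : η * (c + 1) = ε / 3 := by rw [hη]; field_simp
  obtain ⟨P, hP⟩ := exists_polynomial_near_of_continuousOn 0 1 h hh.continuousOn η hη0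
  have hPlim := karamata_polynomial hρ hb hℓ hsum hlim P
  rw [Metric.tendsto_nhds] at hPlim
  have hI : |c / Real.Gamma ρ *
      (∫ u in Set.Ioi (0 : ℝ), Real.exp (-u) * u ^ (ρ - 1) * P.eval (Real.exp (-u))) -
      c / Real.Gamma ρ *
      ∫ u in Set.Ioi (0 : ℝ), Real.exp (-u) * u ^ (ρ - 1) * h (Real.exp (-u))| ≤ ε / 3 := by
    rw [← mul_sub, ← integral_sub (integrableOn_exp_neg_mul_rpow_mul hρ P.continuous)
      (integrableOn_exp_neg_mul_rpow_mul hρ hh), abs_mul, abs_of_nonneg (by positivity)]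
    have h1 : |∫ u in Set.Ioi (0 : ℝ), (Real.exp (-u) * u ^ (ρ - 1) * P.eval (Real.exp (-u)) -
        Real.exp (-u) * u ^ (ρ - 1) * h (Real.exp (-u)))| ≤ Real.Gamma ρ * η := by
      rw [Real.Gamma_eq_integral hρ, ← integral_mul_const, ← Real.norm_eq_abs]
      refine norm_integral_le_of_norm_le ((Real.GammaIntegral_convergent hρ).mul_const η) ?_
      filter_upwards [ae_restrict_mem measurableSet_Ioi] with u hu
      have hu0 : (0 : ℝ) < u := hu
      rw [← mul_sub, norm_mul, Real.norm_of_nonneg (by positivity)]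
      refine mul_le_mul_of_nonneg_left (hP _ ⟨(Real.exp_pos _).le, ?_⟩).le (by positivity)
      rw [Real.exp_le_one_iff]
      linarith
    calc _ ≤ c / Real.Gamma ρ * (Real.Gamma ρ * η) := by gcongr
      _ = η * c := by field_simp
      _ ≤ ε / 3 := by rw [← hηc]; nlinarith
  filter_upwards [hPlim (ε / 3) (by positivity), self_mem_nhdsWithin,
    hlim.eventually_lt_const (show c < c + 1 by linarith)] with σ h1 hσ h2
  have hσ' : (0 : ℝ) < σ := hσ
  have h3 : |σ ^ ρ * (∑' n, b n * Real.exp (-σ * ℓ n) * h (Real.exp (-σ * ℓ n))) -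
      σ ^ ρ * ∑' n, b n * Real.exp (-σ * ℓ n) * P.eval (Real.exp (-σ * ℓ n))| < ε / 3 := by
    rw [← mul_sub, ← (hbdd h hh σ hσ).tsum_sub (hbdd _ P.continuous σ hσ), abs_mul,
      abs_of_nonneg (by positivity)]
    have h4 : |∑' n, (b n * Real.exp (-σ * ℓ n) * h (Real.exp (-σ * ℓ n)) -
        b n * Real.exp (-σ * ℓ n) * P.eval (Real.exp (-σ * ℓ n)))| ≤
        (∑' n, b n * Real.exp (-σ * ℓ n)) * η := by
      rw [← tsum_mul_right, ← Real.norm_eq_abs]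
      refine tsum_of_norm_bounded ((hsum σ hσ).mul_right η).hasSum fun n => ?_
      have h0 : 0 ≤ b n * Real.exp (-σ * ℓ n) := mul_nonneg (hb n) (Real.exp_pos _).le
      rw [← mul_sub, norm_mul, Real.norm_of_nonneg h0, norm_sub_rev]
      exact mul_le_mul_of_nonneg_left (hP _ (hexp σ hσ n)).le h0
    calc _ ≤ σ ^ ρ * ((∑' n, b n * Real.exp (-σ * ℓ n)) * η) := by gcongr
      _ = (σ ^ ρ * ∑' n, b n * Real.exp (-σ * ℓ n)) * η := by ring
      _ < (c + 1) * η := by gcongr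
      _ = ε / 3 := by rw [mul_comm, hηc]
  rw [Real.dist_eq] at h1 ⊢
  rw [abs_lt] at h1 h3 ⊢
  rw [abs_le] at hI
  constructor <;> linarith [h1.1, h1.2, h3.1, h3.2, hI.1, hI.2]

/-- Karamata's Tauberian theorem for generalized Dirichlet series. -/
theorem karamata (hρ : 0 < ρ) (hb : ∀ n, 0 ≤ b n) (hℓ : ∀ n, 0 ≤ ℓ n)
    (hsum : ∀ σ : ℝ, 0 < σ → Summable fun n => b n * Real.exp (-σ * ℓ n))
    (hlim : Tendsto (fun σ : ℝ => σ ^ ρ * ∑' n, b n * Real.exp (-σ * ℓ n)) (𝓝[>] 0) (𝓝 c)) :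
    Tendsto (fun T : ℝ => (∑' n, if ℓ n ≤ T then b n else 0) / T ^ ρ) atTop
      (𝓝 (c / Real.Gamma (ρ + 1))) := by
  have hΓ := Real.Gamma_pos_of_pos hρ
  have hc : 0 ≤ c := by
    refine ge_of_tendsto hlim ?_
    filter_upwards [self_mem_nhdsWithin] with σ hσ
    exact mul_nonneg (Real.rpow_nonneg (le_of_lt hσ) _)
      (tsum_nonneg fun n => mul_nonneg (hb n) (Real.exp_pos _).le)
  set D := c / Real.Gamma (ρ + 1) with hD
  have hpow : ∀ s : ℝ, 0 ≤ s → c / Real.Gamma ρ * ∫ u in (0 : ℝ)..s, u ^ (ρ - 1) = D * s ^ ρ := by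
    intro s hs
    rw [integral_rpow (Or.inl (by linarith)), sub_add_cancel, Real.zero_rpow hρ.ne', hD,
      Real.Gamma_add_one hρ.ne']
    field_simp
    ring
  have hinv : Tendsto (fun T : ℝ => T⁻¹) atTop (𝓝[>] 0) := tendsto_inv_atTop_nhdsGT_zero
  have hramp : ∀ α β : ℝ, 0 < α → Tendsto (fun T : ℝ => (∑' n, b n * Real.exp (-T⁻¹ * ℓ n) *
      invRamp α β (Real.exp (-T⁻¹ * ℓ n))) / T ^ ρ) atTop (𝓝 (c / Real.Gamma ρ *
        ∫ u in Set.Ioi (0 : ℝ), Real.exp (-u) * u ^ (ρ - 1) * invRamp α β (Real.exp (-u)))) := by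
    intro α β hα
    refine ((karamata_continuous hρ hb hℓ hsum hlim (continuous_invRamp (β := β) hα)).comp
      hinv).congr' ?_
    filter_upwards [eventually_gt_atTop 0] with T hT
    simp only [Function.comp_apply]
    rw [Real.inv_rpow hT.le, div_eq_inv_mul]
  have hrampsum : ∀ α β : ℝ, 0 < α → ∀ T : ℝ, 0 < T → Summable fun n =>
      b n * Real.exp (-T⁻¹ * ℓ n) * invRamp α β (Real.exp (-T⁻¹ * ℓ n)) := by
    intro α β hα T hT
    obtain ⟨B, hB⟩ := isCompact_Icc.exists_bound_of_continuousOn (s := Set.Icc (0 : ℝ) 1)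
      (continuous_invRamp (β := β) hα).continuousOn
    refine summable_mul_exp_mul_bounded hb hsum (inv_pos.mpr hT) (B := B)
      fun n => hB _ ⟨(Real.exp_pos _).le, ?_⟩
    rw [Real.exp_le_one_iff]
    nlinarith [mul_nonneg (inv_pos.mpr hT).le (hℓ n)]
  have hcut : ∀ T : ℝ, 0 < T → ∀ n, ℓ n ≤ T ↔ Real.exp (-1) ≤ Real.exp (-T⁻¹ * ℓ n) := by
    intro T hT n
    rw [Real.exp_le_exp, neg_mul, neg_le_neg_iff, inv_mul_le_iff₀ hT, mul_one]
  have hcutsum : ∀ T : ℝ, 0 < T → Summable fun n => if ℓ n ≤ T then b n else 0 := by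
    intro T hT
    refine Summable.of_nonneg_of_le (fun n => ?_) (fun n => ?_)
      ((hsum T⁻¹ (inv_pos.mpr hT)).mul_left (Real.exp 1))
    · split_ifs
      exacts [hb n, le_rfl]
    · split_ifs with h
      · have h1 := (hcut T hT n).mp h
        have h2 : Real.exp 1 * Real.exp (-1) = 1 := by rw [← Real.exp_add]; simp
        calc b n = b n * (Real.exp 1 * Real.exp (-1)) := by rw [h2, mul_one]
          _ ≤ b n * (Real.exp 1 * Real.exp (-T⁻¹ * ℓ n)) :=
            mul_le_mul_of_nonneg_left (mul_le_mul_of_nonneg_left h1 (Real.exp_pos _).le) (hb n)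
          _ = _ := by ring
      · exact mul_nonneg (Real.exp_pos _).le (mul_nonneg (hb n) (Real.exp_pos _).le)
  have hintIoc : ∀ s : ℝ, 0 ≤ s → IntegrableOn (fun u : ℝ => u ^ (ρ - 1)) (Set.Ioc 0 s) := by
    intro s hs
    rw [← intervalIntegrable_iff_integrableOn_Ioc_of_le hs]
    exact intervalIntegral.intervalIntegrable_rpow' (by linarith)
  have hindint : ∀ s : ℝ, 0 ≤ s → ∫ u in Set.Ioi (0 : ℝ),
      (Set.Ioc 0 s).indicator (fun u : ℝ => u ^ (ρ - 1)) u = ∫ u in (0 : ℝ)..s, u ^ (ρ - 1) := by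
    intro s hs
    rw [setIntegral_indicator measurableSet_Ioc, Set.inter_eq_right.mpr Set.Ioc_subset_Ioi_self,
      intervalIntegral.integral_of_le hs]
  have hindintegrable : ∀ s : ℝ, 0 ≤ s → IntegrableOn
      ((Set.Ioc 0 s).indicator (fun u : ℝ => u ^ (ρ - 1))) (Set.Ioi 0) := fun s hs =>
    ((integrable_indicator_iff measurableSet_Ioc).mpr (hintIoc s hs)).integrableOn
  have hpowcont : ContinuousAt (fun s : ℝ => D * s ^ ρ) 1 :=
    (Real.continuousAt_rpow_const 1 ρ (Or.inl one_ne_zero)).const_mul D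
  have hpowlim : Tendsto (fun s : ℝ => D * s ^ ρ) (𝓝 1) (𝓝 D) := by
    simpa [ContinuousAt] using hpowcont
  rw [tendsto_order]
  constructor
  · intro a ha
    obtain ⟨s, has, hs⟩ := (((hpowlim.mono_left (nhdsWithin_le_nhds (s := Set.Iio 1))).eventually_const_lt
      ha).and (Ioo_mem_nhdsLT zero_lt_one)).exists
    have hαβ : Real.exp (-1) < Real.exp (-s) := Real.exp_lt_exp.mpr (by linarith [hs.2])
    have hle : D * s ^ ρ ≤ c / Real.Gamma ρ * ∫ u in Set.Ioi (0 : ℝ), Real.exp (-u) *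
        u ^ (ρ - 1) * invRamp (Real.exp (-1)) (Real.exp (-s)) (Real.exp (-u)) := by
      rw [← hpow s hs.1.le, ← hindint s hs.1.le]
      refine mul_le_mul_of_nonneg_left ?_ (by positivity)
      refine setIntegral_mono_on (hindintegrable s hs.1.le)
        (integrableOn_exp_neg_mul_rpow_mul hρ (continuous_invRamp (Real.exp_pos _)))
        measurableSet_Ioi fun u hu => ?_
      have hu0 : (0 : ℝ) < u := hu
      rw [mul_right_comm]
      by_cases hus : u ≤ s
      · rw [Set.indicator_of_mem (show u ∈ Set.Ioc 0 s from ⟨hu0, hus⟩),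
          mul_invRamp_of_ge (Real.exp_pos _) hαβ (Real.exp_le_exp.mpr (by linarith)), one_mul]
      · rw [Set.indicator_of_notMem fun h : u ∈ Set.Ioc 0 s => hus h.2]
        exact mul_nonneg (mul_invRamp_nonneg (Real.exp_pos _)) (by positivity)
    filter_upwards [(hramp (Real.exp (-1)) (Real.exp (-s)) (Real.exp_pos _)).eventually_const_lt
      (has.trans_le hle), eventually_gt_atTop 0] with T hT hT0
    refine hT.trans_le (div_le_div_of_nonneg_right ?_ (by positivity))
    refine (hrampsum _ _ (Real.exp_pos _) T hT0).tsum_le_tsum (fun n => ?_) (hcutsum T hT0)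
    rw [mul_assoc]
    split_ifs with h
    · exact mul_le_of_le_one_right (hb n) (mul_invRamp_le_one (Real.exp_pos _))
    · rw [hcut T hT0, not_le] at h
      rw [mul_invRamp_of_le hαβ h.le, mul_zero]
  · intro a ha
    obtain ⟨s, has, hs⟩ := (((hpowlim.mono_left (nhdsWithin_le_nhds (s := Set.Ioi 1))).eventually_lt_const
      ha).and self_mem_nhdsWithin).exists
    have hs1 : 1 < s := hs
    have hs0 : 0 ≤ s := by linarith
    have hαβ : Real.exp (-s) < Real.exp (-1) := Real.exp_lt_exp.mpr (by linarith)
    have hle : c / Real.Gamma ρ * ∫ u in Set.Ioi (0 : ℝ), Real.exp (-u) *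
        u ^ (ρ - 1) * invRamp (Real.exp (-s)) (Real.exp (-1)) (Real.exp (-u)) ≤ D * s ^ ρ := by
      rw [← hpow s hs0, ← hindint s hs0]
      refine mul_le_mul_of_nonneg_left ?_ (by positivity)
      refine setIntegral_mono_on
        (integrableOn_exp_neg_mul_rpow_mul hρ (continuous_invRamp (Real.exp_pos _)))
        (hindintegrable s hs0) measurableSet_Ioi fun u hu => ?_
      have hu0 : (0 : ℝ) < u := hu
      rw [mul_right_comm]
      by_cases hus : u ≤ s
      · rw [Set.indicator_of_mem (show u ∈ Set.Ioc 0 s from ⟨hu0, hus⟩)]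
        exact mul_le_of_le_one_left (by positivity) (mul_invRamp_le_one (Real.exp_pos _))
      · rw [Set.indicator_of_notMem fun h : u ∈ Set.Ioc 0 s => hus h.2,
          mul_invRamp_of_le hαβ (Real.exp_le_exp.mpr (by linarith)), zero_mul]
    filter_upwards [(hramp (Real.exp (-s)) (Real.exp (-1)) (Real.exp_pos _)).eventually_lt_const
      (hle.trans_lt has), eventually_gt_atTop 0] with T hT hT0
    refine lt_of_le_of_lt (div_le_div_of_nonneg_right ?_ (by positivity)) hT
    refine (hcutsum T hT0).tsum_le_tsum (fun n => ?_) (hrampsum _ _ (Real.exp_pos _) T hT0)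
    rw [mul_assoc]
    split_ifs with h
    · rw [hcut T hT0] at h
      rw [mul_invRamp_of_ge (Real.exp_pos _) hαβ h, mul_one]
    · exact mul_nonneg (hb n) (mul_invRamp_nonneg (Real.exp_pos _))

end Karamata

/-- Every prime factor of `n` is congruent to `1` modulo `3`. -/
def PrimeFactorsOneModThree (n : ℕ) : Prop := ∀ p : ℕ, p.Prime → p ∣ n → p % 3 = 1

open Classical in
/-- The indicator of the squarefree numbers composed of primes congruent to `1` modulo `3`. -/
noncomputable def sqfreeOneModThree (n : ℕ) : ℝ :=
  if Squarefree n ∧ PrimeFactorsOneModThree n then 1 else 0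

lemma primeFactorsOneModThree_mul {m n : ℕ} :
    PrimeFactorsOneModThree (m * n) ↔ PrimeFactorsOneModThree m ∧ PrimeFactorsOneModThree n := by
  refine ⟨fun h => ⟨fun p hp hd => h p hp (hd.mul_right _), fun p hp hd => h p hp (hd.mul_left _)⟩,
    fun h p hp hd => ?_⟩
  rcases hp.dvd_mul.mp hd with h1 | h1
  exacts [h.1 p hp h1, h.2 p hp h1]

lemma primeFactorsOneModThree_one : PrimeFactorsOneModThree 1 := fun _ hp hd =>
  absurd (Nat.dvd_one.mp hd) hp.ne_one

lemma primeFactorsOneModThree_prime {p : ℕ} (hp : p.Prime) :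
    PrimeFactorsOneModThree p ↔ p % 3 = 1 := by
  refine ⟨fun h => h p hp dvd_rfl, fun h q hq hd => ?_⟩
  rwa [(Nat.prime_dvd_prime_iff_eq hq hp).mp hd]

lemma sqfreeOneModThree_nonneg (n : ℕ) : 0 ≤ sqfreeOneModThree n := by
  unfold sqfreeOneModThree
  split_ifs <;> norm_num

lemma sqfreeOneModThree_le_one (n : ℕ) : sqfreeOneModThree n ≤ 1 := by
  unfold sqfreeOneModThree
  split_ifs <;> norm_num

@[simp] lemma sqfreeOneModThree_zero : sqfreeOneModThree 0 = 0 := by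
  simp [sqfreeOneModThree]

@[simp] lemma sqfreeOneModThree_one : sqfreeOneModThree 1 = 1 := by
  simp [sqfreeOneModThree, primeFactorsOneModThree_one]

lemma sqfreeOneModThree_prime {p : ℕ} (hp : p.Prime) :
    sqfreeOneModThree p = if p % 3 = 1 then 1 else 0 := by
  simp [sqfreeOneModThree, hp.prime.squarefree, primeFactorsOneModThree_prime hp]

lemma sqfreeOneModThree_mul {m n : ℕ} (h : Nat.Coprime m n) :
    sqfreeOneModThree (m * n) = sqfreeOneModThree m * sqfreeOneModThree n := by
  by_cases h1 : Squarefree m <;> by_cases h2 : Squarefree n <;>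
    by_cases h3 : PrimeFactorsOneModThree m <;> by_cases h4 : PrimeFactorsOneModThree n <;>
    simp [sqfreeOneModThree, Nat.squarefree_mul h, primeFactorsOneModThree_mul, h1, h2, h3, h4]

open Classical in
/-- The completely multiplicative indicator of the numbers composed of primes congruent to `1`
modulo `3`. -/
noncomputable def indOneModThree : ℕ →*₀ ℝ where
  toFun n := if n ≠ 0 ∧ PrimeFactorsOneModThree n then 1 else 0
  map_zero' := by simp
  map_one' := by simp [primeFactorsOneModThree_one]
  map_mul' m n := by
    have key : m * n ≠ 0 ∧ PrimeFactorsOneModThree (m * n) ↔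
        (m ≠ 0 ∧ PrimeFactorsOneModThree m) ∧ (n ≠ 0 ∧ PrimeFactorsOneModThree n) := by
      rw [mul_ne_zero_iff, primeFactorsOneModThree_mul]
      tauto
    simp only [key]
    by_cases h1 : m ≠ 0 ∧ PrimeFactorsOneModThree m <;>
      by_cases h2 : n ≠ 0 ∧ PrimeFactorsOneModThree n <;> simp [h1, h2]

/-- The quadratic character modulo `3`, with real values. -/
noncomputable def chiThree : ℕ →*₀ ℝ where
  toFun n := if n % 3 = 1 then 1 else if n % 3 = 2 then -1 else 0
  map_zero' := by simp
  map_one' := by simp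
  map_mul' m n := by
    rw [Nat.mul_mod]
    have hm : m % 3 < 3 := Nat.mod_lt _ (by norm_num)
    have hn : n % 3 < 3 := Nat.mod_lt _ (by norm_num)
    interval_cases m % 3 <;> interval_cases n % 3 <;> norm_num

/-- The function `n ↦ n ^ (-s)`. -/
noncomputable def rpowNegHom {s : ℝ} (hs : s ≠ 0) : ℕ →*₀ ℝ where
  toFun n := (n : ℝ) ^ (-s)
  map_zero' := by simp [Real.zero_rpow (neg_ne_zero.mpr hs)]
  map_one' := by simp
  map_mul' m n := by
    push_cast
    rw [Real.mul_rpow (by positivity) (by positivity)]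

open Classical in
lemma indOneModThree_apply (n : ℕ) :
    indOneModThree n = if n ≠ 0 ∧ PrimeFactorsOneModThree n then 1 else 0 := rfl

lemma abs_indOneModThree_le (n : ℕ) : |indOneModThree n| ≤ 1 := by
  rw [indOneModThree_apply]
  split_ifs <;> norm_num

lemma chiThree_apply (n : ℕ) :
    chiThree n = if n % 3 = 1 then 1 else if n % 3 = 2 then -1 else 0 := rfl

lemma abs_chiThree_le (n : ℕ) : |chiThree n| ≤ 1 := by
  rw [chiThree_apply]
  split_ifs <;> norm_num

lemma indOneModThree_prime {p : ℕ} (hp : p.Prime) :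
    indOneModThree p = if p % 3 = 1 then 1 else 0 := by
  simp [indOneModThree_apply, hp.ne_zero, primeFactorsOneModThree_prime hp]

lemma summable_bounded_mul_rpow_neg {g : ℕ → ℝ} (hg : ∀ n, |g n| ≤ 1) {s : ℝ} (hs : 1 < s) :
    Summable fun n : ℕ => g n * (n : ℝ) ^ (-s) := by
  refine Summable.of_norm_bounded (Real.summable_nat_rpow.mpr (by linarith : -s < -1)) fun n => ?_
  rw [norm_mul, Real.norm_of_nonneg (show 0 ≤ (n : ℝ) ^ (-s) by positivity)]
  exact mul_le_of_le_one_left (by positivity) (hg n)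

lemma hasProd_completelyMultiplicative {g : ℕ →*₀ ℝ} (hg : ∀ n, |g n| ≤ 1) {s : ℝ} (hs : 1 < s) :
    HasProd (fun p : Nat.Primes => (1 - g p * (p : ℝ) ^ (-s))⁻¹)
      (∑' n : ℕ, g n * (n : ℝ) ^ (-s)) := by
  have h := EulerProduct.eulerProduct_completely_multiplicative_hasProd
    (f := g * rpowNegHom (show s ≠ 0 by linarith)) (summable_bounded_mul_rpow_neg hg hs).norm
  exact h

lemma hasProd_sqfreeOneModThree {s : ℝ} (hs : 1 < s) :
    HasProd (fun p : Nat.Primes => 1 + sqfreeOneModThree p * (p : ℝ) ^ (-s))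
      (∑' n : ℕ, sqfreeOneModThree n * (n : ℝ) ^ (-s)) := by
  have hg : ∀ n, |sqfreeOneModThree n| ≤ 1 := fun n => by
    rw [abs_of_nonneg (sqfreeOneModThree_nonneg n)]
    exact sqfreeOneModThree_le_one n
  have h := EulerProduct.eulerProduct_hasProd (f := fun n => sqfreeOneModThree n * (n : ℝ) ^ (-s))
    (by simp) (fun {m n} hmn => by
      push_cast
      rw [sqfreeOneModThree_mul hmn, Real.mul_rpow (by positivity) (by positivity)]
      ring) (summable_bounded_mul_rpow_neg hg hs).norm (by simp)
  convert! h using 2 with p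
  have hp := p.2
  rw [tsum_eq_sum (s := Finset.range 2) fun e he => ?_]
  · simp [Finset.sum_range_succ]
  · have he : 1 < e := by simpa using he
    have : ¬ Squarefree ((p : ℕ) ^ e) := fun hsq => by
      rcases (Nat.squarefree_pow_iff hp.ne_one (by omega)).mp hsq with ⟨_, h1⟩
      omega
    simp [sqfreeOneModThree, this]

open Classical in
lemma eulerFactor_identity {s : ℝ} (hs : 1 < s) (p : Nat.Primes) :
    (1 + sqfreeOneModThree p * (p : ℝ) ^ (-s)) * (1 + sqfreeOneModThree p * (p : ℝ) ^ (-s)) *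
      (1 - indOneModThree p * (p : ℝ) ^ (-(2 * s)))⁻¹ * (1 - 1 * (p : ℝ) ^ (-(2 * s)))⁻¹ *
      (if p = ⟨3, Nat.prime_three⟩ then 1 + (3 : ℝ) ^ (-s) else 1) =
    (1 - 1 * (p : ℝ) ^ (-s))⁻¹ * (1 - chiThree p * (p : ℝ) ^ (-s))⁻¹ := by
  have hp := p.2
  rw [sqfreeOneModThree_prime hp, indOneModThree_prime hp, chiThree_apply]
  have hp0 : (0 : ℝ) < (p : ℕ) := by exact_mod_cast hp.pos
  have hx2 : ((p : ℕ) : ℝ) ^ (-(2 * s)) = (((p : ℕ) : ℝ) ^ (-s)) ^ 2 := by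
    rw [← Real.rpow_natCast, ← Real.rpow_mul hp0.le]
    congr 1
    push_cast
    ring
  have hx1 : ((p : ℕ) : ℝ) ^ (-s) < 1 :=
    Real.rpow_lt_one_of_one_lt_of_neg (by exact_mod_cast hp.one_lt) (by linarith)
  have hx0 : 0 < ((p : ℕ) : ℝ) ^ (-s) := by positivity
  rw [hx2]
  by_cases h3 : p = ⟨3, Nat.prime_three⟩
  · have hv : (p : ℕ) = 3 := congrArg Subtype.val h3
    rw [if_pos h3]
    simp only [hv, Nat.cast_ofNat] at hx0 hx1 ⊢
    set x := (3 : ℝ) ^ (-s)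
    have e1 : 1 - x ≠ 0 := by linarith
    have e2 : 1 - x ^ 2 ≠ 0 := by nlinarith
    norm_num
    field_simp
    ring
  · have h3' : (p : ℕ) ≠ 3 := fun h => h3 (Subtype.ext h)
    have hmod : (p : ℕ) % 3 ≠ 0 := fun h =>
      h3' ((Nat.prime_dvd_prime_iff_eq Nat.prime_three hp).mp (Nat.dvd_of_mod_eq_zero h)).symm
    rw [if_neg h3]
    set x := ((p : ℕ) : ℝ) ^ (-s)
    have e1 : 1 - x ≠ 0 := by linarith
    have e3 : 1 + x ≠ 0 := by linarith
    have e2 : 1 - x ^ 2 = (1 - x) * (1 + x) := by ring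
    have hlt : (p : ℕ) % 3 < 3 := Nat.mod_lt _ (by norm_num)
    generalize (p : ℕ) % 3 = r at *
    interval_cases r
    · exact absurd rfl hmod
    · norm_num [e2]
      field_simp
    · norm_num [e2]
      field_simp

open Classical in
/-- The square of the generating series of `sqfreeOneModThree` in terms of `L`-series. -/
theorem sq_tsum_sqfreeOneModThree {s : ℝ} (hs : 1 < s) :
    (∑' n : ℕ, sqfreeOneModThree n * (n : ℝ) ^ (-s)) ^ 2 *
      (∑' n : ℕ, indOneModThree n * (n : ℝ) ^ (-(2 * s))) *
      (∑' n : ℕ, (n : ℝ) ^ (-(2 * s))) * (1 + (3 : ℝ) ^ (-s)) =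
    (∑' n : ℕ, (n : ℝ) ^ (-s)) * ∑' n : ℕ, chiThree n * (n : ℝ) ^ (-s) := by
  let one' : ℕ →*₀ ℝ :=
    { toFun := fun n => if n = 0 then 0 else 1
      map_zero' := by simp
      map_one' := by simp
      map_mul' := fun m n => by
        rcases eq_or_ne m 0 with rfl | hm <;> rcases eq_or_ne n 0 with rfl | hn <;> simp [*] }
  have hone (n : ℕ) : one' n = if n = 0 then 0 else 1 := rfl
  have hone' : ∀ n, |one' n| ≤ 1 := fun n => by rw [hone]; split_ifs <;> norm_num
  have honep (p : Nat.Primes) : one' p = 1 := by rw [hone, if_neg p.2.ne_zero]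
  have hones {t : ℝ} (ht : 1 < t) : ∑' n : ℕ, one' n * (n : ℝ) ^ (-t) = ∑' n : ℕ, (n : ℝ) ^ (-t) :=
    tsum_congr fun n => by
      rcases eq_or_ne n 0 with rfl | hn
      · simp [Real.zero_rpow (show -t ≠ 0 by linarith)]
      · rw [hone, if_neg hn, one_mul]
  have h2s : 1 < 2 * s := by linarith
  have hT : HasProd (fun p : Nat.Primes => if p = ⟨3, Nat.prime_three⟩ then 1 + (3 : ℝ) ^ (-s) else 1)
      (1 + (3 : ℝ) ^ (-s)) := hasProd_ite_eq _ _
  have hF := hasProd_sqfreeOneModThree hs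
  have hL := ((((hF.mul hF).mul (hasProd_completelyMultiplicative abs_indOneModThree_le h2s)).mul
    (hasProd_completelyMultiplicative hone' h2s)).mul hT)
  have hR := (hasProd_completelyMultiplicative hone' hs).mul
    (hasProd_completelyMultiplicative abs_chiThree_le hs)
  rw [hones h2s] at hL
  rw [hones hs] at hR
  rw [sq]
  refine hL.unique ?_
  convert! hR using 2 with p
  rw [honep]
  exact eulerFactor_identity hs p

lemma tendsto_sub_one_mul_tsum_rpow_neg :
    Tendsto (fun s : ℝ => (s - 1) * ∑' n : ℕ, (n : ℝ) ^ (-s)) (𝓝[>] 1) (𝓝 1) := by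
  refine tendsto_sub_mul_tsum_nat_rpow.congr fun s => ?_
  congr 1
  exact tsum_congr fun n => by rw [Real.rpow_neg (by positivity), one_div]

lemma tendsto_tsum_mul_rpow_neg_two_mul {g : ℕ → ℝ} (hg : ∀ n, |g n| ≤ 1) :
    Tendsto (fun s : ℝ => ∑' n : ℕ, g n * (n : ℝ) ^ (-(2 * s))) (𝓝[>] 1)
      (𝓝 (∑' n : ℕ, g n * (n : ℝ) ^ (-2 : ℝ))) := by
  refine tendsto_tsum_of_dominated_convergence (bound := fun n : ℕ => (n : ℝ) ^ (-2 : ℝ))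
    (Real.summable_nat_rpow.mpr (by norm_num)) (fun n => ?_) ?_
  · refine Tendsto.const_mul _ ?_
    rcases eq_or_ne n 0 with rfl | hn
    · refine tendsto_const_nhds.congr' ?_
      filter_upwards [self_mem_nhdsWithin] with s hs
      have hs : (1 : ℝ) < s := hs
      rw [Nat.cast_zero, Real.zero_rpow (show (-2 : ℝ) ≠ 0 by norm_num),
        Real.zero_rpow (show -(2 * s) ≠ 0 by linarith)]
    · have hn' : (n : ℝ) ≠ 0 := by exact_mod_cast hn
      have h : ContinuousAt (fun s : ℝ => (n : ℝ) ^ (-(2 * s))) 1 :=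
        ContinuousAt.rpow continuousAt_const (by fun_prop) (Or.inl hn')
      have h2 := h.tendsto
      rw [mul_one] at h2
      exact h2.mono_left nhdsWithin_le_nhds
  · filter_upwards [self_mem_nhdsWithin] with s hs n
    have hs : (1 : ℝ) < s := hs
    have hnn : 0 ≤ (n : ℝ) ^ (-(2 * s)) := Real.rpow_nonneg n.cast_nonneg _
    rw [norm_mul, Real.norm_of_nonneg hnn]
    refine (mul_le_of_le_one_left hnn (hg n)).trans ?_
    rcases eq_or_ne n 0 with rfl | hn
    · rw [Nat.cast_zero, Real.zero_rpow (show (-2 : ℝ) ≠ 0 by norm_num),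
        Real.zero_rpow (show -(2 * s) ≠ 0 by linarith)]
    · exact Real.rpow_le_rpow_of_exponent_le (by exact_mod_cast Nat.one_le_iff_ne_zero.mpr hn)
        (by linarith)

lemma tendsto_tsum_rpow_neg_two_mul :
    Tendsto (fun s : ℝ => ∑' n : ℕ, (n : ℝ) ^ (-(2 * s))) (𝓝[>] 1) (𝓝 (Real.pi ^ 2 / 6)) := by
  have h := tendsto_tsum_mul_rpow_neg_two_mul (g := fun _ => 1) (by simp)
  simp only [one_mul] at h
  convert! h using 2
  rw [← hasSum_zeta_two.tsum_eq]
  refine tsum_congr fun n => ?_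
  rw [Real.rpow_neg (by positivity), one_div, Real.rpow_two]

lemma rpow_neg_sub_rpow_neg_succ_le {a s : ℝ} (ha : 1 ≤ a) (hs : 1 ≤ s) (hs2 : s ≤ 2) :
    a ^ (-s) - (a + 1) ^ (-s) ≤ 2 / a ^ 2 := by
  have ha0 : 0 < a := by linarith
  have h1 : (a + 1) ^ (-s) = a ^ (-s) * (1 + -(1 / (a + 1))) ^ s := by
    rw [show 1 + -(1 / (a + 1)) = a / (a + 1) by field_simp; ring,
      Real.div_rpow (by positivity) (by positivity), Real.rpow_neg (by positivity),
      Real.rpow_neg (by positivity)]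
    field_simp
  have h2 := one_add_mul_self_le_rpow_one_add (s := -(1 / (a + 1)))
    (by rw [neg_le_neg_iff, div_le_one (by positivity)]; linarith) hs
  have h3 : a ^ (-s) ≤ a⁻¹ := by
    rw [← Real.rpow_neg_one]
    exact Real.rpow_le_rpow_of_exponent_le ha (by linarith)
  calc a ^ (-s) - (a + 1) ^ (-s) = a ^ (-s) * (1 - (1 + -(1 / (a + 1))) ^ s) := by rw [h1]; ring
    _ ≤ a ^ (-s) * (s / (a + 1)) := by
      refine mul_le_mul_of_nonneg_left ?_ (by positivity)
      have : s * -(1 / (a + 1)) = -(s / (a + 1)) := by ring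
      linarith
    _ ≤ a⁻¹ * (2 / a) := by
      gcongr
      linarith
    _ = 2 / a ^ 2 := by field_simp

lemma tsum_chiThree {s : ℝ} (hs : 1 < s) :
    ∑' n : ℕ, chiThree n * (n : ℝ) ^ (-s) =
      ∑' m : ℕ, ((3 * m + 1 : ℝ) ^ (-s) - (3 * m + 2 : ℝ) ^ (-s)) := by
  have hsum := Real.summable_nat_rpow.mpr (by linarith : -s < -1)
  have e1 : Summable fun m : ℕ => (3 * m + 1 : ℝ) ^ (-s) := by
    have := hsum.comp_injective (i := fun m : ℕ => 3 * m + 1) fun a b h => by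
      simpa using h
    exact this.congr fun m => by simp
  have e2 : Summable fun m : ℕ => (3 * m + 2 : ℝ) ^ (-s) := by
    have := hsum.comp_injective (i := fun m : ℕ => 3 * m + 2) fun a b h => by
      simpa using h
    exact this.congr fun m => by simp
  rw [Nat.sumByResidueClasses (summable_bounded_mul_rpow_neg abs_chiThree_le hs) 3, e1.tsum_sub e2]
  rw [show (Finset.univ : Finset (ZMod 3)) = {0, 1, 2} from rfl,
    Finset.sum_insert (by decide), Finset.sum_insert (by decide), Finset.sum_singleton]
  rw [show (0 : ZMod 3).val = 0 from rfl, show (1 : ZMod 3).val = 1 from rfl,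
    show (2 : ZMod 3).val = 2 from rfl]
  have c0 (m : ℕ) : chiThree (3 * m) = 0 := by
    rw [chiThree_apply]; simp
  have c1 (m : ℕ) : chiThree (1 + 3 * m) = 1 := by
    rw [chiThree_apply]; simp
  have c2 (m : ℕ) : chiThree (2 + 3 * m) = -1 := by
    rw [chiThree_apply]; simp
  simp only [zero_add, c0, c1, c2, zero_mul, tsum_zero, one_mul, neg_mul, tsum_neg]
  push_cast
  simp only [add_comm]
  ring

lemma summable_bound_aux : Summable fun m : ℕ => 2 / (3 * m + 1 : ℝ) ^ 2 := by
  have h := ((summable_nat_add_iff 1).mpr (Real.summable_one_div_nat_pow.mpr one_lt_two)).mul_left 2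
  refine Summable.of_nonneg_of_le (fun m => by positivity) (fun m => ?_) h
  rw [mul_one_div]
  push_cast
  gcongr
  nlinarith [(Nat.cast_nonneg m : (0 : ℝ) ≤ m)]

lemma abs_rpow_sub_rpow_le {s : ℝ} (hs : 1 ≤ s) (hs2 : s ≤ 2) (m : ℕ) :
    ‖(3 * m + 1 : ℝ) ^ (-s) - (3 * m + 2 : ℝ) ^ (-s)‖ ≤ 2 / (3 * m + 1 : ℝ) ^ 2 := by
  have hm : (0 : ℝ) ≤ m := m.cast_nonneg
  rw [Real.norm_of_nonneg]
  · have := rpow_neg_sub_rpow_neg_succ_le (a := 3 * m + 1) (by linarith) hs hs2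
    rwa [show (3 * m + 1 + 1 : ℝ) = 3 * m + 2 by ring] at this
  · rw [sub_nonneg]
    exact Real.rpow_le_rpow_of_nonpos (by positivity) (by linarith) (by linarith)

lemma hasSum_LOne_chiThree :
    HasSum (fun m : ℕ => (3 * m + 1 : ℝ)⁻¹ - (3 * m + 2 : ℝ)⁻¹) (Real.pi / (3 * √3)) := by
  have hsum : Summable fun m : ℕ => (3 * m + 1 : ℝ)⁻¹ - (3 * m + 2 : ℝ)⁻¹ := by
    refine Summable.of_norm_bounded summable_bound_aux fun m => ?_
    have := abs_rpow_sub_rpow_le (s := 1) le_rfl (by norm_num) m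
    rwa [Real.rpow_neg_one, Real.rpow_neg_one] at this
  rw [hsum.hasSum_iff_tendsto_nat]
  have hz : (1 / 3 : ℂ) ∈ Complex.integerComplement := by
    rintro ⟨n, hn⟩
    have h3 : ((3 * n : ℤ) : ℂ) = ((1 : ℤ) : ℂ) := by push_cast; rw [hn]; norm_num
    have : 3 * n = 1 := by exact_mod_cast h3
    omega
  have h := tendsto_logDeriv_euler_cot_sub hz
  have hlim : (Real.pi : ℂ) * Complex.cot (Real.pi * (1 / 3)) - 1 / (1 / 3) =
      ((Real.pi / √3 - 3 : ℝ) : ℂ) := by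
    have h1 : Complex.cot (Real.pi * (1 / 3)) = ((1 / √3 : ℝ) : ℂ) := by
      rw [Complex.cot, show (Real.pi : ℂ) * (1 / 3) = ((Real.pi / 3 : ℝ) : ℂ) by push_cast; ring,
        ← Complex.ofReal_cos, ← Complex.ofReal_sin, Real.cos_pi_div_three, Real.sin_pi_div_three,
        ← Complex.ofReal_div]
      congr 1
      field_simp
    rw [h1]
    push_cast
    ring
  rw [hlim] at h
  have hre := (Complex.continuous_re.tendsto _).comp h
  have hterm (n : ℕ) : (Complex.re ∘ fun n : ℕ => ∑ j ∈ Finset.range n, cotTerm (1 / 3) j) n =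
      3 * (∑ j ∈ Finset.range n, ((3 * j + 1 : ℝ)⁻¹ - (3 * j + 2 : ℝ)⁻¹) +
        (3 * n + 1 : ℝ)⁻¹ - 1) := by
    induction n with
    | zero => simp
    | succ n ih =>
      simp only [Function.comp_apply, Finset.sum_range_succ] at ih ⊢
      rw [Complex.add_re, ih]
      have : cotTerm (1 / 3) n = ((3 * ((3 * (n + 1) + 1 : ℝ)⁻¹ - (3 * n + 2 : ℝ)⁻¹) : ℝ) : ℂ) := by
        rw [cotTerm]
        push_cast
        have e1 : (1 / 3 - (n + 1) : ℂ) = -(3 * n + 2) / 3 := by ring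
        have e2 : (1 / 3 + (n + 1) : ℂ) = (3 * (n + 1) + 1) / 3 := by ring
        rw [e1, e2, one_div_div, one_div_div, div_neg, div_eq_mul_inv, div_eq_mul_inv]
        ring
      rw [this, Complex.ofReal_re]
      push_cast
      ring
  have hre' := hre.congr hterm
  rw [Complex.ofReal_re] at hre'
  have h0 : Tendsto (fun n : ℕ => (3 * n + 1 : ℝ)⁻¹) atTop (𝓝 0) := by
    refine tendsto_inv_atTop_zero.comp ?_
    refine tendsto_atTop_add_const_right _ _ ?_
    exact tendsto_natCast_atTop_atTop.const_mul_atTop (by norm_num)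
  have := ((hre'.div_const 3).sub h0).add_const 1
  convert! this using 2
  · ring
  · field_simp
    ring

lemma tendsto_tsum_chiThree :
    Tendsto (fun s : ℝ => ∑' n : ℕ, chiThree n * (n : ℝ) ^ (-s)) (𝓝[>] 1)
      (𝓝 (Real.pi / (3 * √3))) := by
  have h : Tendsto (fun s : ℝ => ∑' m : ℕ, ((3 * m + 1 : ℝ) ^ (-s) - (3 * m + 2 : ℝ) ^ (-s)))
      (𝓝[>] 1) (𝓝 (∑' m : ℕ, ((3 * m + 1 : ℝ)⁻¹ - (3 * m + 2 : ℝ)⁻¹))) := by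
    refine tendsto_tsum_of_dominated_convergence summable_bound_aux (fun m => ?_) ?_
    · have h : ContinuousAt (fun s : ℝ => (3 * m + 1 : ℝ) ^ (-s) - (3 * m + 2 : ℝ) ^ (-s)) 1 :=
        (ContinuousAt.rpow continuousAt_const (by fun_prop) (Or.inl (by positivity))).sub
        (ContinuousAt.rpow continuousAt_const (by fun_prop) (Or.inl (by positivity)))
      have h2 := h.tendsto
      rw [Real.rpow_neg_one, Real.rpow_neg_one] at h2
      exact h2.mono_left nhdsWithin_le_nhds
    · filter_upwards [Ioo_mem_nhdsGT (show (1 : ℝ) < 2 by norm_num)] with s hs m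
      exact abs_rpow_sub_rpow_le hs.1.le hs.2.le m
  rw [hasSum_LOne_chiThree.tsum_eq] at h
  refine h.congr' ?_
  filter_upwards [self_mem_nhdsWithin] with s hs
  exact (tsum_chiThree hs).symm

lemma one_le_tsum_indOneModThree : 1 ≤ ∑' n : ℕ, indOneModThree n * (n : ℝ) ^ (-2 : ℝ) := by
  have h := (summable_bounded_mul_rpow_neg abs_indOneModThree_le one_lt_two).le_tsum 1
    fun n _ => by
      rw [indOneModThree_apply]
      split_ifs <;> positivity
  simpa using h

lemma hasProd_primes_one_mod_three :
    HasProd (fun p : {p : ℕ // p.Prime ∧ p % 3 = 1} =>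
      (1 - 1 / ((p : ℕ) : ℝ) ^ 2) ^ ((1 : ℝ) / 2))
      ((∑' n : ℕ, indOneModThree n * (n : ℝ) ^ (-2 : ℝ))⁻¹ ^ ((1 : ℝ) / 2)) := by
  have hD := one_le_tsum_indOneModThree
  have h1 := hasProd_completelyMultiplicative abs_indOneModThree_le one_lt_two
  have h2 : HasProd (fun p : Nat.Primes => 1 - indOneModThree p * (p : ℝ) ^ (-2 : ℝ))
      (∑' n : ℕ, indOneModThree n * (n : ℝ) ^ (-2 : ℝ))⁻¹ := by
    have := Tendsto.inv₀ h1 (by positivity)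
    refine this.congr fun s => ?_
    rw [← Finset.prod_inv_distrib]
    exact Finset.prod_congr rfl fun p _ => inv_inv _
  let i : {p : ℕ // p.Prime ∧ p % 3 = 1} → Nat.Primes := fun p => ⟨p, p.2.1⟩
  have hi : Function.Injective i := fun p q h => by
    have := congrArg (fun r : Nat.Primes => (r : ℕ)) h
    exact Subtype.ext this
  rw [← hi.hasProd_iff fun p hp => ?_] at h2
  · have h3 := (Real.continuousAt_rpow_const _ ((1 : ℝ) / 2) (Or.inr (by norm_num))).tendsto.comp h2
    refine h3.congr fun s => ?_
    rw [Function.comp_apply, ← Real.finsetProd_rpow]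
    · refine Finset.prod_congr rfl fun p _ => ?_
      change (1 - indOneModThree (p : ℕ) * ((p : ℕ) : ℝ) ^ (-2 : ℝ)) ^ ((1 : ℝ) / 2) =
        (1 - 1 / ((p : ℕ) : ℝ) ^ 2) ^ ((1 : ℝ) / 2)
      rw [indOneModThree_prime p.2.1, if_pos p.2.2, Real.rpow_neg (by positivity), Real.rpow_two,
        one_mul, inv_eq_one_div]
    · intro p _
      change 0 ≤ 1 - indOneModThree (p : ℕ) * ((p : ℕ) : ℝ) ^ (-2 : ℝ)
      rw [indOneModThree_prime p.2.1, if_pos p.2.2, one_mul, sub_nonneg]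
      exact Real.rpow_le_one_of_one_le_of_nonpos (by exact_mod_cast p.2.1.one_lt.le) (by norm_num)
  · rw [indOneModThree_prime p.2, if_neg, zero_mul, sub_zero]
    exact fun h => hp ⟨⟨p, p.2, h⟩, rfl⟩

lemma tendsto_sub_one_mul_sq_tsum_sqfreeOneModThree :
    Tendsto (fun s : ℝ => (s - 1) * (∑' n : ℕ, sqfreeOneModThree n * (n : ℝ) ^ (-s)) ^ 2) (𝓝[>] 1)
      (𝓝 (√3 / (2 * Real.pi) * (∑' n : ℕ, indOneModThree n * (n : ℝ) ^ (-2 : ℝ))⁻¹)) := by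
  have hD := one_le_tsum_indOneModThree
  have h3 : Tendsto (fun s : ℝ => 1 + (3 : ℝ) ^ (-s)) (𝓝[>] 1) (𝓝 (4 / 3)) := by
    have h : ContinuousAt (fun s : ℝ => 1 + (3 : ℝ) ^ (-s)) 1 :=
      continuousAt_const.add
        (ContinuousAt.rpow continuousAt_const (by fun_prop) (Or.inl (by norm_num)))
    have h2 := h.tendsto
    rw [Real.rpow_neg_one, show (1 + 3⁻¹ : ℝ) = 4 / 3 by norm_num] at h2
    exact h2.mono_left nhdsWithin_le_nhds
  have hden := ((tendsto_tsum_mul_rpow_neg_two_mul abs_indOneModThree_le).mul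
    tendsto_tsum_rpow_neg_two_mul).mul h3
  set D := ∑' n : ℕ, indOneModThree n * (n : ℝ) ^ (-2 : ℝ) with hDdef
  have hne : D * (Real.pi ^ 2 / 6) * (4 / 3) ≠ 0 := by positivity
  have hnum := tendsto_sub_one_mul_tsum_rpow_neg.mul tendsto_tsum_chiThree
  have h := hnum.div hden hne
  have hval : 1 * (Real.pi / (3 * √3)) / (D * (Real.pi ^ 2 / 6) * (4 / 3)) =
      √3 / (2 * Real.pi) * D⁻¹ := by
    have hD0 : D ≠ 0 := by positivity
    have := Real.pi_ne_zero
    field_simp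
    norm_num
  rw [hval] at h
  refine h.congr' ?_
  filter_upwards [self_mem_nhdsWithin, hden.eventually_ne hne] with s hs hs0
  rw [Pi.div_apply, div_eq_iff hs0, mul_assoc, ← sq_tsum_sqfreeOneModThree hs]
  ring

lemma tendsto_sqrt_mul_tsum_sqfreeOneModThree :
    Tendsto (fun σ : ℝ => σ ^ ((1 : ℝ) / 2) *
        ∑' n : ℕ, sqfreeOneModThree n / n * Real.exp (-σ * Real.log n)) (𝓝[>] 0)
      (𝓝 ((√3 / (2 * Real.pi) *
        (∑' n : ℕ, indOneModThree n * (n : ℝ) ^ (-2 : ℝ))⁻¹) ^ ((1 : ℝ) / 2))) := by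
  have hshift : Tendsto (fun σ : ℝ => σ + 1) (𝓝[>] 0) (𝓝[>] 1) := by
    refine tendsto_nhdsWithin_iff.mpr ⟨?_, ?_⟩
    · have : Tendsto (fun σ : ℝ => σ + 1) (𝓝 0) (𝓝 (0 + 1)) := (by fun_prop : Continuous _).tendsto _
      rw [zero_add] at this
      exact this.mono_left nhdsWithin_le_nhds
    · filter_upwards [self_mem_nhdsWithin] with σ hσ
      have : (0 : ℝ) < σ := hσ
      simpa using this
  have h := (Real.continuousAt_rpow_const _ ((1 : ℝ) / 2) (Or.inr (by norm_num))).tendsto.comp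
    (tendsto_sub_one_mul_sq_tsum_sqfreeOneModThree.comp hshift)
  refine h.congr' ?_
  filter_upwards [self_mem_nhdsWithin] with σ hσ
  have hσ : (0 : ℝ) < σ := hσ
  have hnn : 0 ≤ ∑' n : ℕ, sqfreeOneModThree n * (n : ℝ) ^ (-(σ + 1)) :=
    tsum_nonneg fun n => mul_nonneg (sqfreeOneModThree_nonneg n) (by positivity)
  simp only [Function.comp_apply, add_sub_cancel_right]
  rw [Real.mul_rpow hσ.le (by positivity), ← Real.sqrt_eq_rpow (_ ^ 2), Real.sqrt_sq hnn]
  congr 1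
  refine tsum_congr fun n => ?_
  rcases eq_or_ne n 0 with rfl | hn
  · simp
  · have hn0 : (0 : ℝ) < n := by exact_mod_cast Nat.pos_of_ne_zero hn
    rw [Real.rpow_def_of_pos hn0, div_mul_eq_mul_div, mul_div_assoc,
      show Real.log n * -(σ + 1) = -σ * Real.log n - Real.log n by ring, Real.exp_sub,
      Real.exp_log hn0]

/-- The logarithmic mean of `sqfreeOneModThree`. -/
theorem tendsto_sum_sqfreeOneModThree_div :
    Tendsto (fun x : ℝ => (∑ n ∈ Finset.Icc 1 ⌊x⌋₊, sqfreeOneModThree n / n) /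
        Real.log x ^ ((1 : ℝ) / 2)) atTop
      (𝓝 ((√3 / (2 * Real.pi) *
        (∑' n : ℕ, indOneModThree n * (n : ℝ) ^ (-2 : ℝ))⁻¹) ^ ((1 : ℝ) / 2) /
        (√Real.pi / 2))) := by
  have h := karamata (b := fun n : ℕ => sqfreeOneModThree n / n) (ℓ := fun n : ℕ => Real.log n)
    (by norm_num : (0 : ℝ) < 1 / 2)
    (fun n => div_nonneg (sqfreeOneModThree_nonneg n) n.cast_nonneg)
    (fun n => Real.log_natCast_nonneg n) (fun σ hσ => ?_) tendsto_sqrt_mul_tsum_sqfreeOneModThree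
  · rw [Real.Gamma_add_one (by norm_num), Real.Gamma_one_half_eq, one_div_mul_eq_div] at h
    refine (h.comp Real.tendsto_log_atTop).congr' ?_
    filter_upwards [eventually_ge_atTop 1] with x hx
    rw [Function.comp_apply]
    congr 1
    rw [tsum_eq_sum (s := Finset.Icc 1 ⌊x⌋₊) fun n hn => ?_]
    · refine Finset.sum_congr rfl fun n hn => ?_
      rw [Finset.mem_Icc] at hn
      rw [if_pos]
      exact Real.log_le_log (by exact_mod_cast hn.1) ((Nat.le_floor_iff (by linarith)).mp hn.2)
    · rcases eq_or_ne n 0 with rfl | hn0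
      · simp
      · rw [if_neg]
        rw [Finset.mem_Icc, not_and, not_le] at hn
        exact not_le.mpr (Real.log_lt_log (by linarith)
          ((Nat.floor_lt (by linarith)).mp (hn (Nat.one_le_iff_ne_zero.mpr hn0))))
  · have hg : ∀ n, |sqfreeOneModThree n| ≤ 1 := fun n => by
      rw [abs_of_nonneg (sqfreeOneModThree_nonneg n)]
      exact sqfreeOneModThree_le_one n
    refine (summable_bounded_mul_rpow_neg hg (show 1 < σ + 1 by linarith)).congr fun n => ?_
    rcases eq_or_ne n 0 with rfl | hn
    · simp
    · have hn0 : (0 : ℝ) < n := by exact_mod_cast Nat.pos_of_ne_zero hn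
      rw [Real.rpow_def_of_pos hn0, div_mul_eq_mul_div, mul_div_assoc,
        show Real.log n * -(σ + 1) = -σ * Real.log n - Real.log n by ring, Real.exp_sub,
        Real.exp_log hn0]

/-- The logarithm restricted to primes congruent to `1` modulo `3`. -/
noncomputable def logOneModThree : ArithmeticFunction ℝ where
  toFun n := if n.Prime ∧ n % 3 = 1 then Real.log n else 0
  map_zero' := by simp

lemma logOneModThree_apply (n : ℕ) :
    logOneModThree n = if n.Prime ∧ n % 3 = 1 then Real.log n else 0 := rfl

/-- `sqfreeOneModThree` as an arithmetic function. -/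
noncomputable def sqfreeArith : ArithmeticFunction ℝ where
  toFun := sqfreeOneModThree
  map_zero' := sqfreeOneModThree_zero

lemma sqfreeArith_apply (n : ℕ) : sqfreeArith n = sqfreeOneModThree n := rfl

lemma logOneModThree_nonneg (n : ℕ) : 0 ≤ logOneModThree n := by
  rw [logOneModThree_apply]
  split_ifs
  exacts [Real.log_natCast_nonneg n, le_rfl]

lemma logOneModThree_le (n : ℕ) : logOneModThree n ≤ Real.log n := by
  rw [logOneModThree_apply]
  split_ifs
  exacts [le_rfl, Real.log_natCast_nonneg n]

lemma sqfreeOneModThree_le_of_dvd {d n : ℕ} (h : d ∣ n) :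
    sqfreeOneModThree n ≤ sqfreeOneModThree d := by
  by_cases hn : Squarefree n ∧ PrimeFactorsOneModThree n
  · have : Squarefree d ∧ PrimeFactorsOneModThree d :=
      ⟨hn.1.squarefree_of_dvd h, fun p hp hd => hn.2 p hp (hd.trans h)⟩
    rw [sqfreeOneModThree, sqfreeOneModThree, if_pos hn, if_pos this]
  · rw [sqfreeOneModThree, if_neg hn]
    exact sqfreeOneModThree_nonneg d

lemma sqfreeOneModThree_mul_log (n : ℕ) :
    sqfreeOneModThree n * Real.log n =
      ∑ x ∈ n.divisorsAntidiagonal, logOneModThree x.1 * sqfreeOneModThree n := by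
  rw [← ArithmeticFunction.vonMangoldt_sum, Finset.mul_sum,
    ← Nat.sum_divisorsAntidiagonal (fun i _ => sqfreeOneModThree n * ArithmeticFunction.vonMangoldt i)]
  refine Finset.sum_congr rfl fun x hx => ?_
  by_cases hn : Squarefree n ∧ PrimeFactorsOneModThree n
  · have hx1 : x.1 ∣ n := ⟨x.2, (Nat.mem_divisorsAntidiagonal.mp hx).1.symm⟩
    rw [mul_comm]
    congr 1
    rw [logOneModThree_apply]
    split_ifs with h
    · rw [ArithmeticFunction.vonMangoldt_apply_prime h.1]
    · rw [ArithmeticFunction.vonMangoldt_eq_zero_iff]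
      intro hpp
      have hp : x.1.Prime :=
        Nat.squarefree_and_prime_pow_iff_prime.mp ⟨hn.1.squarefree_of_dvd hx1, hpp⟩
      exact h ⟨hp, hn.2 _ hp hx1⟩
  · rw [sqfreeOneModThree, if_neg hn, zero_mul, mul_zero]

lemma sqfreeOneModThree_mul_log_le (n : ℕ) :
    sqfreeOneModThree n * Real.log n ≤ (logOneModThree * sqfreeArith) n := by
  rw [sqfreeOneModThree_mul_log, ArithmeticFunction.mul_apply]
  refine Finset.sum_le_sum fun x hx => ?_
  exact mul_le_mul_of_nonneg_left
    (sqfreeOneModThree_le_of_dvd ⟨x.1, by rw [mul_comm, (Nat.mem_divisorsAntidiagonal.mp hx).1]⟩)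
    (logOneModThree_nonneg _)

lemma mul_sqfreeArith_sub_le {n N : ℕ} (hn : n ∈ Finset.Ioc 0 N) :
    (logOneModThree * sqfreeArith) n - sqfreeOneModThree n * Real.log n ≤
      ∑ d ∈ Finset.Ioc 0 N, if d ^ 2 ∣ n then Real.log d else 0 := by
  rw [Finset.mem_Ioc] at hn
  rw [sqfreeOneModThree_mul_log, ArithmeticFunction.mul_apply, ← Finset.sum_sub_distrib]
  have hsub : n.divisors ⊆ Finset.Ioc 0 N := fun d hd => by
    have h1 := Nat.divisor_le hd
    have h2 := Nat.pos_of_mem_divisors hd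
    exact Finset.mem_Ioc.mpr ⟨h2, h1.trans hn.2⟩
  refine le_trans ?_ (Finset.sum_le_sum_of_subset_of_nonneg hsub fun d _ _ => by
    split_ifs
    exacts [Real.log_natCast_nonneg d, le_rfl])
  rw [← Nat.sum_divisorsAntidiagonal (fun d _ : ℕ => if d ^ 2 ∣ n then Real.log d else 0)]
  refine Finset.sum_le_sum fun x hx => ?_
  have hxn := (Nat.mem_divisorsAntidiagonal.mp hx).1
  rw [sqfreeArith_apply]
  by_cases h2 : x.1 ^ 2 ∣ n
  · rw [if_pos h2]
    have := mul_le_of_le_one_right (logOneModThree_nonneg x.1) (sqfreeOneModThree_le_one x.2)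
    have h3 := mul_nonneg (logOneModThree_nonneg x.1) (sqfreeOneModThree_nonneg n)
    linarith [logOneModThree_le x.1]
  · rw [if_neg h2, logOneModThree_apply]
    split_ifs with hp
    · have hcop : Nat.Coprime x.1 x.2 := (Nat.Prime.coprime_iff_not_dvd hp.1).mpr fun hd =>
        h2 (by rw [← hxn, sq]; exact mul_dvd_mul_left _ hd)
      rw [← hxn, sqfreeOneModThree_mul hcop, sqfreeOneModThree_prime hp.1, if_pos hp.2, one_mul,
        sub_self]
    · simp

lemma summable_log_div_sq : Summable fun d : ℕ => Real.log d / (d : ℝ) ^ 2 := by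
  have h := (Real.summable_nat_rpow.mpr (by norm_num : (-(3 / 2) : ℝ) < -1)).mul_left 2
  refine Summable.of_nonneg_of_le
    (fun d => div_nonneg (Real.log_natCast_nonneg d) (by positivity)) (fun d => ?_) h
  rcases eq_or_ne d 0 with rfl | hd
  · simp
  · have hd0 : (0 : ℝ) < d := by exact_mod_cast Nat.pos_of_ne_zero hd
    have hl := Real.log_le_rpow_div hd0.le (show (0 : ℝ) < 1 / 2 by norm_num)
    calc Real.log d / (d : ℝ) ^ 2 ≤ (d : ℝ) ^ (1 / 2 : ℝ) / (1 / 2) / (d : ℝ) ^ 2 := by gcongr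
      _ = 2 * ((d : ℝ) ^ (1 / 2 : ℝ) / (d : ℝ) ^ (2 : ℝ)) := by rw [Real.rpow_two]; ring
      _ = 2 * (d : ℝ) ^ (-(3 / 2) : ℝ) := by
        rw [← Real.rpow_sub hd0]
        norm_num

lemma sum_mul_sqfreeArith_sub_le (N : ℕ) :
    ∑ n ∈ Finset.Ioc 0 N, (logOneModThree * sqfreeArith) n -
      ∑ n ∈ Finset.Ioc 0 N, sqfreeOneModThree n * Real.log n ≤
      (∑' d : ℕ, Real.log d / (d : ℝ) ^ 2) * N := by
  rw [← Finset.sum_sub_distrib]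
  refine (Finset.sum_le_sum fun n hn => mul_sqfreeArith_sub_le hn).trans ?_
  rw [Finset.sum_comm]
  refine le_trans ?_ (mul_le_mul_of_nonneg_right (summable_log_div_sq.sum_le_tsum (Finset.Ioc 0 N)
    fun d _ => div_nonneg (Real.log_natCast_nonneg d) (by positivity)) N.cast_nonneg)
  rw [Finset.sum_mul]
  refine Finset.sum_le_sum fun d hd => ?_
  rw [← Finset.sum_filter, Finset.sum_const, Nat.Ioc_filter_dvd_card_eq_div, nsmul_eq_mul,
    div_mul_eq_mul_div, mul_comm, mul_div_assoc]
  refine mul_le_mul_of_nonneg_left ?_ (Real.log_natCast_nonneg d)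
  have := Nat.cast_div_le (m := N) (n := d ^ 2) (α := ℝ)
  rwa [Nat.cast_pow] at this

lemma Icc_one_eq_Ioc_zero (N : ℕ) : Finset.Icc 1 N = Finset.Ioc 0 N := by
  ext n
  simp [Nat.succ_le_iff]

lemma sum_mul_sqfreeArith (x : ℝ) :
    ∑ n ∈ Finset.Ioc 0 ⌊x⌋₊, (logOneModThree * sqfreeArith) n =
      ∑ m ∈ Finset.Ioc 0 ⌊x⌋₊, sqfreeOneModThree m * thetaOneModThree (x / m) := by
  rw [mul_comm, ArithmeticFunction.sum_Ioc_mul_eq_sum_sum]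
  refine Finset.sum_congr rfl fun m _ => ?_
  rw [thetaOneModThree, Nat.floor_div_natCast, Icc_one_eq_Ioc_zero, Finset.sum_filter]
  rfl

lemma thetaOneModThree_nonneg (x : ℝ) : 0 ≤ thetaOneModThree x :=
  Finset.sum_nonneg fun p _ => Real.log_natCast_nonneg p

lemma thetaOneModThree_mono : Monotone thetaOneModThree := fun _ _ hxy =>
  Finset.sum_le_sum_of_subset_of_nonneg
    (Finset.filter_subset_filter _ (Finset.Icc_subset_Icc le_rfl (Nat.floor_mono hxy)))
    fun p _ _ => Real.log_natCast_nonneg p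

lemma exists_abs_thetaOneModThree_sub_le {ε : ℝ} (hε : 0 < ε) :
    ∃ C, 0 ≤ C ∧ ∀ y, 0 ≤ y → |thetaOneModThree y - y / 2| ≤ ε * y + C := by
  have h := tendsto_thetaOneModThree_div
  rw [Metric.tendsto_atTop] at h
  obtain ⟨Y, hY⟩ := h ε hε
  set Z := max Y 1
  refine ⟨thetaOneModThree Z + Z, by have := thetaOneModThree_nonneg Z; positivity,
    fun y hy => ?_⟩
  rcases le_or_gt Z y with h1 | h1
  · have hy1 : 1 ≤ y := (le_max_right _ _).trans h1
    have h2 := hY y ((le_max_left _ _).trans h1)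
    rw [Real.dist_eq] at h2
    have h3 : thetaOneModThree y - y / 2 = (thetaOneModThree y / y - 1 / 2) * y := by field_simp
    rw [h3, abs_mul, abs_of_nonneg hy]
    have h4 := mul_le_mul_of_nonneg_right h2.le hy
    have h5 := thetaOneModThree_nonneg Z
    have h6 : 0 ≤ Z := by positivity
    linarith
  · have h2 := thetaOneModThree_mono h1.le
    have h3 := thetaOneModThree_nonneg y
    have h4 : 0 ≤ ε * y := by positivity
    have h5 := thetaOneModThree_nonneg Z
    rw [abs_le]
    constructor <;> linarith

lemma sum_inv_sqrt_le (N : ℕ) : ∑ n ∈ Finset.Ioc 0 N, 1 / √(n : ℝ) ≤ 2 * √(N : ℝ) := by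
  induction N with
  | zero => simp
  | succ N ih =>
    rw [Finset.sum_Ioc_succ_top (Nat.zero_le _)]
    push_cast
    have h1 : (0 : ℝ) < √(N + 1) := by positivity
    have h2 : √(N : ℝ) ^ 2 = N := Real.sq_sqrt N.cast_nonneg
    have h3 : √(N + 1 : ℝ) ^ 2 = N + 1 := Real.sq_sqrt (by positivity)
    have h4 : 1 / √(N + 1 : ℝ) ≤ 2 * √(N + 1 : ℝ) - 2 * √(N : ℝ) := by
      rw [div_le_iff₀ h1]
      nlinarith [sq_nonneg (√(N + 1 : ℝ) - √(N : ℝ))]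
    linarith

lemma sum_log_div_le {x : ℝ} (hx : 1 ≤ x) :
    ∑ n ∈ Finset.Ioc 0 ⌊x⌋₊, Real.log (x / n) ≤ 4 * x := by
  have hx0 : 0 ≤ x := by linarith
  calc ∑ n ∈ Finset.Ioc 0 ⌊x⌋₊, Real.log (x / n)
      ≤ ∑ n ∈ Finset.Ioc 0 ⌊x⌋₊, 2 * √x * (1 / √(n : ℝ)) := by
        refine Finset.sum_le_sum fun n _ => ?_
        have h := Real.log_le_rpow_div (show 0 ≤ x / n by positivity)
          (show (0 : ℝ) < 1 / 2 by norm_num)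
        rw [← Real.sqrt_eq_rpow, Real.sqrt_div hx0] at h
        calc _ ≤ _ := h
          _ = _ := by ring
    _ ≤ 2 * √x * (2 * √(⌊x⌋₊ : ℝ)) := by
        rw [← Finset.mul_sum]
        exact mul_le_mul_of_nonneg_left (sum_inv_sqrt_le _) (by positivity)
    _ ≤ 2 * √x * (2 * √x) := by
        gcongr
        exact Nat.floor_le hx0
    _ = 4 * x := by
        have := Real.mul_self_sqrt hx0
        linear_combination 4 * this

lemma exists_abs_sum_mul_log_sub_le {ε : ℝ} (hε : 0 < ε) :
    ∃ C, 0 ≤ C ∧ ∀ x, 1 ≤ x →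
      |(∑ n ∈ Finset.Ioc 0 ⌊x⌋₊, sqfreeOneModThree n) * Real.log x -
        x / 2 * ∑ n ∈ Finset.Ioc 0 ⌊x⌋₊, sqfreeOneModThree n / n| ≤
      ε * x * ∑ n ∈ Finset.Ioc 0 ⌊x⌋₊, sqfreeOneModThree n / n + C * x := by
  obtain ⟨C, hC0, hC⟩ := exists_abs_thetaOneModThree_sub_le hε
  have hK : 0 ≤ ∑' d : ℕ, Real.log d / (d : ℝ) ^ 2 :=
    tsum_nonneg fun d => div_nonneg (Real.log_natCast_nonneg d) (by positivity)
  set K := ∑' d : ℕ, Real.log d / (d : ℝ) ^ 2 with hKdef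
  refine ⟨C + K + 4, by positivity, fun x hx => ?_⟩
  have hx0 : 0 ≤ x := by linarith
  have hfloor : (⌊x⌋₊ : ℝ) ≤ x := Nat.floor_le hx0
  have h1 : |(∑ n ∈ Finset.Ioc 0 ⌊x⌋₊, (logOneModThree * sqfreeArith) n) -
      x / 2 * ∑ n ∈ Finset.Ioc 0 ⌊x⌋₊, sqfreeOneModThree n / n| ≤
      ε * x * (∑ n ∈ Finset.Ioc 0 ⌊x⌋₊, sqfreeOneModThree n / n) + C * x := by
    rw [sum_mul_sqfreeArith, Finset.mul_sum, Finset.mul_sum, ← Finset.sum_sub_distrib]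
    have h2 : ∑ n ∈ Finset.Ioc 0 ⌊x⌋₊, C ≤ C * x := by
      rw [Finset.sum_const, Nat.card_Ioc, Nat.sub_zero, nsmul_eq_mul, mul_comm]
      exact mul_le_mul_of_nonneg_left hfloor hC0
    refine (Finset.abs_sum_le_sum_abs _ _).trans (le_trans ?_ (add_le_add_right h2 _))
    rw [← Finset.sum_add_distrib]
    refine Finset.sum_le_sum fun n _ => ?_
    have ha := sqfreeOneModThree_nonneg n
    have h3 := hC (x / n) (by positivity)
    calc |sqfreeOneModThree n * thetaOneModThree (x / n) - x / 2 * (sqfreeOneModThree n / n)|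
        = sqfreeOneModThree n * |thetaOneModThree (x / n) - x / n / 2| := by
          rw [← abs_of_nonneg ha, ← abs_mul, abs_of_nonneg ha]
          congr 1
          ring
      _ ≤ sqfreeOneModThree n * (ε * (x / n) + C) := mul_le_mul_of_nonneg_left h3 ha
      _ = ε * x * (sqfreeOneModThree n / n) + sqfreeOneModThree n * C := by ring
      _ ≤ _ := by
        gcongr
        exact mul_le_of_le_one_left hC0 (sqfreeOneModThree_le_one n)
  have h2 := sum_mul_sqfreeArith_sub_le ⌊x⌋₊
  rw [← hKdef] at h2
  have h2' : K * (⌊x⌋₊ : ℝ) ≤ K * x := mul_le_mul_of_nonneg_left hfloor hK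
  have h3 : ∑ n ∈ Finset.Ioc 0 ⌊x⌋₊, sqfreeOneModThree n * Real.log n ≤
      ∑ n ∈ Finset.Ioc 0 ⌊x⌋₊, (logOneModThree * sqfreeArith) n :=
    Finset.sum_le_sum fun n _ => sqfreeOneModThree_mul_log_le n
  have hlog : ∀ n ∈ Finset.Ioc 0 ⌊x⌋₊, 0 ≤ Real.log (x / n) ∧
      Real.log (x / n) = Real.log x - Real.log n := fun n hn => by
    rw [Finset.mem_Ioc] at hn
    have hn0 : (0 : ℝ) < n := by exact_mod_cast hn.1
    have hnx : (n : ℝ) ≤ x := (Nat.le_floor_iff hx0).mp hn.2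
    exact ⟨Real.log_nonneg ((one_le_div hn0).mpr hnx), Real.log_div (by linarith) hn0.ne'⟩
  have h4 : (∑ n ∈ Finset.Ioc 0 ⌊x⌋₊, sqfreeOneModThree n) * Real.log x -
      ∑ n ∈ Finset.Ioc 0 ⌊x⌋₊, sqfreeOneModThree n * Real.log n =
      ∑ n ∈ Finset.Ioc 0 ⌊x⌋₊, sqfreeOneModThree n * Real.log (x / n) := by
    rw [Finset.sum_mul, ← Finset.sum_sub_distrib]
    refine Finset.sum_congr rfl fun n hn => ?_
    rw [(hlog n hn).2]
    ring
  have h5 : 0 ≤ ∑ n ∈ Finset.Ioc 0 ⌊x⌋₊, sqfreeOneModThree n * Real.log (x / n) :=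
    Finset.sum_nonneg fun n hn => mul_nonneg (sqfreeOneModThree_nonneg n) (hlog n hn).1
  have h6 : ∑ n ∈ Finset.Ioc 0 ⌊x⌋₊, sqfreeOneModThree n * Real.log (x / n) ≤ 4 * x :=
    (Finset.sum_le_sum fun n hn => mul_le_of_le_one_left (hlog n hn).1
      (sqfreeOneModThree_le_one n)).trans (sum_log_div_le hx)
  have h7 : 0 ≤ K * x := by positivity
  have h8 : (C + K + 4) * x = C * x + K * x + 4 * x := by ring
  rw [abs_le] at h1 ⊢
  rw [h8]
  constructor <;> linarith [h1.1, h1.2]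

/-- If the logarithmic mean of `sqfreeOneModThree` is asymptotic to `c √(log x)`, then its
summatory function is asymptotic to `c x / (2 √(log x))`. -/
lemma tendsto_sum_sqfreeOneModThree_of_logMean {c : ℝ}
    (h : Tendsto (fun x : ℝ => (∑ n ∈ Finset.Icc 1 ⌊x⌋₊, sqfreeOneModThree n / n) /
        Real.log x ^ ((1 : ℝ) / 2)) atTop (𝓝 c)) :
    Tendsto (fun x : ℝ => (∑ n ∈ Finset.Ioc 0 ⌊x⌋₊, sqfreeOneModThree n) /
      (x / Real.log x ^ ((1 : ℝ) / 2))) atTop (𝓝 (c / 2)) := by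
  simp only [Icc_one_eq_Ioc_zero] at h
  have hc : 0 ≤ c := by
    refine ge_of_tendsto h ?_
    filter_upwards [eventually_ge_atTop 1] with x hx
    exact div_nonneg (Finset.sum_nonneg fun n _ =>
      div_nonneg (sqfreeOneModThree_nonneg n) n.cast_nonneg)
      (Real.rpow_nonneg (Real.log_nonneg hx) _)
  have hsub : Tendsto (fun x : ℝ => (∑ n ∈ Finset.Ioc 0 ⌊x⌋₊, sqfreeOneModThree n) /
      (x / Real.log x ^ ((1 : ℝ) / 2)) -
      (∑ n ∈ Finset.Ioc 0 ⌊x⌋₊, sqfreeOneModThree n / n) /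
        Real.log x ^ ((1 : ℝ) / 2) / 2) atTop (𝓝 0) := by
    rw [Metric.tendsto_nhds]
    intro ε hε
    obtain ⟨C, hC0, hC⟩ := exists_abs_sum_mul_log_sub_le
      (show 0 < ε / (2 * (c + 1)) by positivity)
    have hL : Tendsto (fun x : ℝ => C / Real.log x ^ ((1 : ℝ) / 2)) atTop (𝓝 0) :=
      ((tendsto_rpow_atTop (by norm_num)).comp Real.tendsto_log_atTop).const_div_atTop C
    filter_upwards [h.eventually_lt_const (show c < c + 1 by linarith),
      hL.eventually_lt_const (show 0 < ε / 2 by positivity), eventually_gt_atTop 1]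
      with x h1 h2 hx
    have hx0 : 0 < x := by linarith
    have hlog : 0 < Real.log x := Real.log_pos hx
    have hr : 0 < Real.log x ^ ((1 : ℝ) / 2) := by positivity
    have hr2 : Real.log x = (Real.log x ^ ((1 : ℝ) / 2)) ^ 2 := by
      rw [← Real.sqrt_eq_rpow, Real.sq_sqrt hlog.le]
    have h3 := hC x hx.le
    set r := Real.log x ^ ((1 : ℝ) / 2)
    set S := ∑ n ∈ Finset.Ioc 0 ⌊x⌋₊, sqfreeOneModThree n / n
    set N := ∑ n ∈ Finset.Ioc 0 ⌊x⌋₊, sqfreeOneModThree n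
    rw [hr2] at h3
    have h4 : N / (x / r) - S / r / 2 = (N * r ^ 2 - x / 2 * S) / (x * r) := by
      field_simp
    rw [Real.dist_eq, sub_zero, h4, abs_div, abs_of_pos (show 0 < x * r by positivity)]
    calc _ ≤ (ε / (2 * (c + 1)) * x * S + C * x) / (x * r) := by gcongr
      _ = ε / (2 * (c + 1)) * (S / r) + C / r := by field_simp
      _ < ε / (2 * (c + 1)) * (c + 1) + ε / 2 := by gcongr
      _ = ε := by field_simp; ring
  have := hsub.add (h.div_const 2)
  rw [zero_add] at this
  exact this.congr fun x => by ring

lemma ncard_eq_sum_sqfreeOneModThree {x : ℝ} (hx : 0 ≤ x) :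
    ({n : ℕ | 1 ≤ n ∧ (n : ℝ) ≤ x ∧ Squarefree n ∧
      ∀ p : ℕ, p.Prime → p ∣ n → p % 3 = 1}.ncard : ℝ) =
    ∑ n ∈ Finset.Ioc 0 ⌊x⌋₊, sqfreeOneModThree n := by
  classical
  have hset : {n : ℕ | 1 ≤ n ∧ (n : ℝ) ≤ x ∧ Squarefree n ∧
      ∀ p : ℕ, p.Prime → p ∣ n → p % 3 = 1} =
      ({n ∈ Finset.Ioc 0 ⌊x⌋₊ | Squarefree n ∧ PrimeFactorsOneModThree n} : Finset ℕ) := by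
    ext n
    rw [Finset.mem_coe, Finset.mem_filter, Finset.mem_Ioc, Nat.le_floor_iff hx]
    exact ⟨fun ⟨a, b, c, d⟩ => ⟨⟨a, b⟩, c, d⟩, fun ⟨⟨a, b⟩, c, d⟩ => ⟨a, b, c, d⟩⟩
  rw [hset, Set.ncard_coe_finset, Finset.card_filter]
  push_cast
  exact Finset.sum_congr rfl fun n _ => by rw [sqfreeOneModThree]

lemma landauConstant_eq {D : ℝ} (hD : 0 < D) :
    (√3 / (2 * Real.pi) * D⁻¹) ^ ((1 : ℝ) / 2) / (√Real.pi / 2) / 2 =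
      (3 : ℝ) ^ ((1 : ℝ) / 4) / (Real.pi * √2) * D⁻¹ ^ ((1 : ℝ) / 2) := by
  have hπ := Real.pi_pos
  have h3 : (√3 : ℝ) ^ ((1 : ℝ) / 2) = (3 : ℝ) ^ ((1 : ℝ) / 4) := by
    rw [Real.sqrt_eq_rpow, ← Real.rpow_mul (by norm_num)]
    norm_num
  rw [Real.mul_rpow (by positivity) (by positivity), Real.div_rpow (by positivity) (by positivity),
    h3, Real.mul_rpow (by norm_num) hπ.le, ← Real.sqrt_eq_rpow 2, ← Real.sqrt_eq_rpow Real.pi]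
  have h2 : √Real.pi * √Real.pi = Real.pi := Real.mul_self_sqrt hπ.le
  rw [← h2, Real.sqrt_mul_self (by positivity)]
  field_simp

/-- Let `N x` be the number of squarefree integers `1 ≤ n ≤ x` all of whose prime divisors are
`≡ 1 (mod 3)`. Then `N x ~ C · x / (log x)^{1/2}` as `x → ∞`, where
`C = (3^{1/4} / (π √2)) · ∏_{p ≡ 1 (3)} (1 − 1/p²)^{1/2}`, the product over the primes
`p ≡ 1 (mod 3)` converging (absolutely). -/
theorem squarefree_primes_one_mod_three_asymptotic :
    Multipliable (fun p : {p : ℕ // p.Prime ∧ p % 3 = 1} =>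
      (1 - 1 / ((p : ℕ) : ℝ) ^ 2) ^ ((1 : ℝ) / 2)) ∧
    Tendsto (fun x : ℝ =>
      ({n : ℕ | 1 ≤ n ∧ (n : ℝ) ≤ x ∧ Squarefree n ∧
          ∀ p : ℕ, p.Prime → p ∣ n → p % 3 = 1}.ncard : ℝ) /
        (((3 : ℝ) ^ ((1 : ℝ) / 4) / (Real.pi * Real.sqrt 2)) *
          (∏' p : {p : ℕ // p.Prime ∧ p % 3 = 1},
            (1 - 1 / ((p : ℕ) : ℝ) ^ 2) ^ ((1 : ℝ) / 2)) *
          x / Real.log x ^ ((1 : ℝ) / 2)))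
      atTop (nhds 1) := by
  refine ⟨hasProd_primes_one_mod_three.multipliable, ?_⟩
  rw [hasProd_primes_one_mod_three.tprod_eq]
  have hD := one_le_tsum_indOneModThree
  have h := tendsto_sum_sqfreeOneModThree_of_logMean tendsto_sum_sqfreeOneModThree_div
  rw [landauConstant_eq (by positivity)] at h
  set C := (3 : ℝ) ^ ((1 : ℝ) / 4) / (Real.pi * √2) *
    (∑' n : ℕ, indOneModThree n * (n : ℝ) ^ (-2 : ℝ))⁻¹ ^ ((1 : ℝ) / 2) with hC
  have hC0 : C ≠ 0 := by positivity
  have h1 := h.div_const C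
  rw [div_self hC0] at h1
  refine h1.congr' ?_
  filter_upwards [eventually_ge_atTop 0] with x hx
  rw [ncard_eq_sum_sqfreeOneModThree hx, div_div, mul_div_assoc, mul_comm C]
end
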